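/- arXiv:2007.07578 — 12 statements merged into one kernel-verified Lean document; each statement's English description precedes it below -/
import Mathlib

section
/- Let p be an odd prime and q ≥ 2 an integer not divisible by p. Then there exist infinitely many primes r such that the multiplicative order of r modulo p equals the multiplicative order of −q modulo p, and the p-adic valuation of r^(p−1) − 1 equals the p-adic valuation of q^(p−1) − 1. -/
/-- Numbers congruent modulo `p ^ (v_p(a) + 1)` have the same `p`-adic valuation. -/
theorem padicValNat_eq_of_modEq {p a b : ℕ} [Fact p.Prime] (ha : a ≠ 0) (hb : b ≠ 0)
    (h : b ≡ a [MOD p ^ (padicValNat p a + 1)]) : padicValNat p b = padicValNat p a := by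
  apply le_antisymm
  · by_contra! hlt
    have hdvd : p ^ (padicValNat p a + 1) ∣ b := (padicValNat_dvd_iff_le hb).2 hlt
    exact pow_succ_padicValNat_not_dvd ha ((h.dvd_iff dvd_rfl).1 hdvd)
  · rw [← padicValNat_dvd_iff_le hb]
    exact (h.dvd_iff (pow_dvd_pow p (Nat.le_succ _))).2 pow_padicValNat_dvd

/-- For an odd prime `p` and an integer `q ≥ 2` not divisible by `p`,
there are infinitely many primes `r` whose multiplicative order mod `p` equals that of `-q`,
and with `v_p(r^(p-1) - 1) = v_p(q^(p-1) - 1)`. -/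
theorem stmt0 (p q : ℕ) (hp : p.Prime) (hodd : Odd p) (hq : 2 ≤ q) (hpq : ¬ p ∣ q) :
    {r : ℕ | r.Prime ∧
      orderOf ((r : ZMod p)) = orderOf (-(q : ZMod p)) ∧
      padicValNat p (r ^ (p - 1) - 1) = padicValNat p (q ^ (p - 1) - 1)}.Infinite := by
  have : Fact p.Prime := ⟨hp⟩
  have hp1 : p - 1 ≠ 0 := by have := hp.two_le; omega
  have hone_lt {n : ℕ} (hn : 2 ≤ n) : 1 < n ^ (p - 1) := Nat.one_lt_pow hp1 hn
  set M := p ^ (padicValNat p (q ^ (p - 1) - 1) + 1) with hM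
  have : NeZero M := ⟨pow_ne_zero _ hp.ne_zero⟩
  have hunit : IsUnit (-(q : ZMod M)) := by
    rw [IsUnit.neg_iff, ZMod.isUnit_iff_coprime]
    exact (((Nat.Prime.coprime_iff_not_dvd hp).2 hpq).symm).pow_right _
  refine (Nat.infinite_setOfPred_prime_and_eq_mod hunit).mono ?_
  rintro r ⟨hr, hrq⟩
  refine ⟨hr, ?_, ?_⟩
  · have h := congrArg (ZMod.castHom (dvd_pow_self p (Nat.succ_ne_zero _) : p ∣ M) (ZMod p)) hrq
    simp only [map_neg, map_natCast] at h
    rw [h]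
  · have hA := hone_lt hq
    have hB := hone_lt hr.two_le
    refine padicValNat_eq_of_modEq (by omega) (by omega) ?_
    rw [← hM, ← ZMod.natCast_eq_natCast_iff, Nat.cast_sub hB.le, Nat.cast_sub hA.le]
    push_cast
    rw [hrq, (Nat.Odd.sub_odd hodd odd_one).neg_pow]
end

section
/- Let p be an odd prime, F a finite field of cardinality q with p ∤ q, and n ≥ 2. Assume that the multiplicative order of q modulo p does not divide n + 1. Let ι : GL_n(F) → GL_{n+1}(F) be the block-diagonal embedding M ↦ diag(M, 1), and let S be a Sylow p-subgroup of GL_n(F). Then ι(S) is a Sylow p-subgroup of GL_{n+1}(F), and for all subgroups P, Q ≤ ι(S) and every g ∈ GL_{n+1}(F) with gPg⁻¹ ≤ Q, there exists h in the image of ι such that hxh⁻¹ = gxg⁻¹ for all x ∈ P. -/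
open Matrix

/-- The index of `GL_n` in `GL_{n+1}` is `q ^ n * (q ^ (n + 1) - 1)`. -/
lemma Matrix.card_GL_succ (F : Type*) [Field F] [Fintype F] (n : ℕ) :
    Nat.card (GL (Fin (n + 1)) F) =
      (Fintype.card F ^ (n + 1) - 1) * Fintype.card F ^ n * Nat.card (GL (Fin n) F) := by
  rw [Matrix.card_GL_field, Matrix.card_GL_field, Fin.prod_univ_succ]
  have h : ∀ i : Fin n, Fintype.card F ^ (n + 1) - Fintype.card F ^ (i.succ : ℕ) =
      Fintype.card F * (Fintype.card F ^ n - Fintype.card F ^ (i : ℕ)) := by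
    intro i
    rw [Nat.mul_sub, Fin.val_succ, pow_succ', pow_succ']
  simp only [h, Finset.prod_mul_distrib, Finset.prod_const, Finset.card_univ, Fintype.card_fin,
    Fin.val_zero, pow_zero, mul_assoc]

/-- Cancellation of a trivial summand: given two split trivial lines, spanned by `e` and `e'`,
with invariant functionals `l` and `l'`, some invertible operator commuting with every
transformation that fixes `e`, `e'`, `l` and `l'` carries the second splitting to the first. -/
lemma exists_commuting_GL_of_dotProduct_eq_one {m F : Type*} [Fintype m] [DecidableEq m] [Field F]
    (e l e' l' : m → F) (h : l ⬝ᵥ e = 1) (h' : l' ⬝ᵥ e' = 1) :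
    ∃ c : GL m F, (c : Matrix m m F) *ᵥ e' = e ∧ l ᵥ* (c : Matrix m m F) = l' ∧
      ∀ y : Matrix m m F, y *ᵥ e = e → y *ᵥ e' = e' → l ᵥ* y = l → l' ᵥ* y = l' →
        (c : Matrix m m F) * y = y * c := by
  obtain ⟨s, hs⟩ : ∃ s : F, s * (1 - (l ⬝ᵥ e') * (l' ⬝ᵥ e)) ≠ l' ⬝ᵥ e := by
    by_cases hb : l' ⬝ᵥ e = 0
    · exact ⟨1, by simp [hb]⟩
    · exact ⟨0, by simpa using Ne.symm hb⟩
  set a := l ⬝ᵥ e' with ha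
  set b := l' ⬝ᵥ e with hb
  set β : m → F := s • l + (-1 - s * a) • l' with hβ
  set C : Matrix m m F := 1 + vecMulVec e (l' - l) + vecMulVec (e' - a • e) β with hC
  have hmul (v : m → F) : C *ᵥ v = v + (l' ⬝ᵥ v - l ⬝ᵥ v) • e +
      (s * (l ⬝ᵥ v) + (-1 - s * a) * (l' ⬝ᵥ v)) • (e' - a • e) := by
    simp only [hC, hβ, add_mulVec, one_mulVec, vecMulVec_mulVec, sub_dotProduct, add_dotProduct,
      smul_dotProduct, smul_eq_mul, op_smul_eq_smul]
  have hlC : l ᵥ* C = l' := by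
    simp only [hC, vecMul_add, vecMul_one, vecMul_vecMulVec, dotProduct_sub, dotProduct_smul, h,
      ← ha, smul_eq_mul, mul_one, sub_self, zero_smul, one_smul]
    abel
  have hCe : C *ᵥ e' = e := by
    rw [hmul, h', ← ha]
    ext i
    simp only [Pi.add_apply, Pi.smul_apply, Pi.sub_apply, smul_eq_mul]
    ring
  have hinj : Function.Injective C.mulVec := by
    refine (injective_iff_map_eq_zero (Matrix.mulVecLin C)).2 fun v hv => ?_
    rw [mulVecLin_apply] at hv
    have hl'v : l' ⬝ᵥ v = 0 := by rw [← hlC, ← dotProduct_mulVec, hv, dotProduct_zero]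
    rw [hmul, hl'v] at hv
    have hlv : l ⬝ᵥ v = 0 := by
      have := congrArg (l' ⬝ᵥ ·) hv
      simp only [dotProduct_add, dotProduct_smul, dotProduct_sub, hl'v, h', ← hb, smul_eq_mul,
        dotProduct_zero] at this
      refine (mul_eq_zero.1 (?_ : (l ⬝ᵥ v) * (s * (1 - a * b) - b) = 0)).resolve_right
        (sub_ne_zero.2 hs)
      linear_combination this
    simpa [hlv] using hv
  obtain ⟨c, hc⟩ := Matrix.mulVec_injective_iff_isUnit.1 hinj
  refine ⟨c, by rw [hc, hCe], by rw [hc, hlC], fun y he he' hl hl' => ?_⟩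
  rw [hc, hC, hβ]
  simp only [add_mul, mul_add, one_mul, mul_one, vecMulVec_mul, mul_vecMulVec, mulVec_sub,
    mulVec_smul, sub_vecMul, add_vecMul, smul_vecMul, he, he', hl, hl']

/-- An invertible matrix that is block diagonal with lower right entry `1` comes from `GL_n`. -/
lemma exists_GL_eq_fromBlocks_one {F : Type*} [Field F] {n : ℕ} (h : GL (Fin (n + 1)) F)
    (he : (h : Matrix (Fin (n + 1)) (Fin (n + 1)) F) *ᵥ Pi.single (Fin.last n) 1 =
      Pi.single (Fin.last n) 1)
    (hl : Pi.single (Fin.last n) 1 ᵥ* (h : Matrix (Fin (n + 1)) (Fin (n + 1)) F) =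
      Pi.single (Fin.last n) 1) :
    ∃ M : GL (Fin n) F, (h : Matrix (Fin (n + 1)) (Fin (n + 1)) F) =
      Matrix.reindex finSumFinEquiv finSumFinEquiv
        (Matrix.fromBlocks (M : Matrix (Fin n) (Fin n) F) 0 0
          (1 : Matrix (Fin 1) (Fin 1) F)) := by
  set H : Matrix (Fin (n + 1)) (Fin (n + 1)) F := h.val
  have hcol (i) : H i (Fin.last n) = (Pi.single (Fin.last n) 1 : Fin (n + 1) → F) i := by
    rw [← he, mulVec_single_one, col_apply]
  have hrow (i) : H (Fin.last n) i = (Pi.single (Fin.last n) 1 : Fin (n + 1) → F) i := by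
    rw [← hl, single_one_vecMul, row_apply]
  have key : H = Matrix.reindex finSumFinEquiv finSumFinEquiv
      (Matrix.fromBlocks (H.submatrix Fin.castSucc Fin.castSucc) 0 0
        (1 : Matrix (Fin 1) (Fin 1) F)) := by
    ext i j
    refine Fin.lastCases ?_ (fun i => ?_) i
    · rw [hrow]
      refine Fin.lastCases ?_ (fun j => ?_) j <;> simp
    · refine Fin.lastCases ?_ (fun j => ?_) j
      · rw [hcol]
        simp
      · simp
  have hdet : IsUnit (H.submatrix Fin.castSucc Fin.castSucc) := by
    have hu := (Matrix.isUnit_iff_isUnit_det _).1 h.isUnit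
    change IsUnit H.det at hu
    rw [key, det_reindex_self, det_fromBlocks_zero₂₁, det_one, mul_one] at hu
    exact (Matrix.isUnit_iff_isUnit_det _).2 hu
  obtain ⟨M, hM⟩ := hdet
  exact ⟨M, by rw [hM]; exact key⟩

/-- The matrix `diag(M, 1)` fixes the last basis vector, both as a column and as a row. -/
lemma reindex_fromBlocks_one_fixes_last {F : Type*} [Field F] {n : ℕ}
    (M : Matrix (Fin n) (Fin n) F) :
    Matrix.reindex finSumFinEquiv finSumFinEquiv
        (Matrix.fromBlocks M 0 0 (1 : Matrix (Fin 1) (Fin 1) F)) *ᵥ Pi.single (Fin.last n) 1 =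
      Pi.single (Fin.last n) 1 ∧
    Pi.single (Fin.last n) 1 ᵥ* Matrix.reindex finSumFinEquiv finSumFinEquiv
        (Matrix.fromBlocks M 0 0 (1 : Matrix (Fin 1) (Fin 1) F)) =
      Pi.single (Fin.last n) 1 := by
  constructor
  · rw [mulVec_single_one]
    ext i
    refine Fin.lastCases ?_ (fun i => ?_) i <;> simp
  · rw [single_one_vecMul]
    ext i
    refine Fin.lastCases ?_ (fun i => ?_) i <;> simp

/-- For `p` an odd prime, `F` a finite field of cardinality `q` prime to `p`,
`n ≥ 2`, and `ord_p(q) ∤ n + 1`, the block-diagonal embedding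
`ι : GL_n(F) → GL_{n+1}(F)`, `M ↦ diag(M, 1)`, sends a Sylow `p`-subgroup `S` of `GL_n(F)`
to a Sylow `p`-subgroup of `GL_{n+1}(F)`, and every fusion in `GL_{n+1}(F)` between subgroups
of `ι(S)` is realized by an element of the image of `ι`. -/
theorem stmt1 (p : ℕ) (hp : p.Prime) (hodd : Odd p)
    (F : Type) [Field F] [Fintype F] (q : ℕ) (hq : Fintype.card F = q) (hpq : ¬ p ∣ q)
    (n : ℕ) (hn : 2 ≤ n) (hord : ¬ orderOf ((q : ZMod p)) ∣ (n + 1))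
    (ι : GL (Fin n) F →* GL (Fin (n + 1)) F)
    (hι : ∀ M : GL (Fin n) F, (ι M : Matrix (Fin (n + 1)) (Fin (n + 1)) F) =
      Matrix.reindex finSumFinEquiv finSumFinEquiv
        (Matrix.fromBlocks (M : Matrix (Fin n) (Fin n) F) 0 0 (1 : Matrix (Fin 1) (Fin 1) F)))
    (S : Sylow p (GL (Fin n) F)) :
    (∃ T : Sylow p (GL (Fin (n + 1)) F),
        (T : Subgroup (GL (Fin (n + 1)) F)) =
          Subgroup.map ι (S : Subgroup (GL (Fin n) F))) ∧
    (∀ P Q : Subgroup (GL (Fin (n + 1)) F),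
        P ≤ Subgroup.map ι (S : Subgroup (GL (Fin n) F)) →
        Q ≤ Subgroup.map ι (S : Subgroup (GL (Fin n) F)) →
        ∀ g : GL (Fin (n + 1)) F, (∀ x ∈ P, g * x * g⁻¹ ∈ Q) →
          ∃ h ∈ ι.range, ∀ x ∈ P, h * x * h⁻¹ = g * x * g⁻¹) := by
  subst hq
  have : Fact p.Prime := ⟨hp⟩
  refine ⟨?_, fun P Q hP hQ g hg => ?_⟩
  · have hinj : Function.Injective ι := by
      intro A B hAB
      have := hι A
      rw [hAB, hι B, EmbeddingLike.apply_eq_iff_eq, Matrix.fromBlocks_inj] at this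
      exact Units.ext this.1.symm
    refine ⟨Sylow.ofCard (Subgroup.map ι S) ?_, rfl⟩
    have h1 : ¬ p ∣ Fintype.card F ^ (n + 1) - 1 := by
      rw [← CharP.cast_eq_zero_iff (ZMod p), Nat.cast_sub (Nat.one_le_pow _ _ Fintype.card_pos)]
      rw [orderOf_dvd_iff_pow_eq_one] at hord
      simpa [sub_eq_zero] using hord
    have h2 : ¬ p ∣ (Fintype.card F ^ (n + 1) - 1) * Fintype.card F ^ n := by
      rw [hp.dvd_mul]
      exact not_or.2 ⟨h1, fun h => hpq (hp.dvd_of_dvd_pow h)⟩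
    rw [Matrix.card_GL_succ, Nat.factorization_mul (fun h => h2 (by rw [h]; exact dvd_zero p)) Nat.card_pos.ne',
      Finsupp.add_apply, Nat.factorization_eq_zero_of_not_dvd h2, zero_add,
      ← S.card_eq_multiplicity]
    exact Subgroup.card_map_of_injective hinj
  · set e : Fin (n + 1) → F := Pi.single (Fin.last n) 1 with he
    have hfix {x : GL (Fin (n + 1)) F} (hx : x ∈ Subgroup.map ι S) :
        (x : Matrix (Fin (n + 1)) (Fin (n + 1)) F) *ᵥ e = e ∧ e ᵥ* (x : Matrix (Fin (n + 1)) (Fin (n + 1)) F) = e := by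
      obtain ⟨M, -, rfl⟩ := hx
      rw [hι]
      exact reindex_fromBlocks_one_fixes_last _
    have hgg : ((g⁻¹ : GL (Fin (n + 1)) F) : Matrix (Fin (n + 1)) (Fin (n + 1)) F) * (g : Matrix (Fin (n + 1)) (Fin (n + 1)) F) = 1 := by
      rw [← Units.val_mul, inv_mul_cancel, Units.val_one]
    obtain ⟨c, hc, hc', hcomm⟩ := exists_commuting_GL_of_dotProduct_eq_one e e
      ((g : Matrix (Fin (n + 1)) (Fin (n + 1)) F) *ᵥ e) (e ᵥ* ((g⁻¹ : GL (Fin (n + 1)) F) : Matrix (Fin (n + 1)) (Fin (n + 1)) F))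
      (by simp [he]) (by rw [← dotProduct_mulVec, mulVec_mulVec, hgg, one_mulVec]; simp [he])
    obtain ⟨M, hM⟩ := exists_GL_eq_fromBlocks_one (c * g)
      (by rw [Units.val_mul, ← mulVec_mulVec, hc])
      (by rw [Units.val_mul, ← vecMul_vecMul, hc', vecMul_vecMul, hgg, vecMul_one])
    refine ⟨c * g, ⟨M, Units.ext ((hι M).trans hM.symm)⟩, fun x hx => ?_⟩
    obtain ⟨hx1, hx2⟩ := hfix (hP hx)
    obtain ⟨hy1, hy2⟩ := hfix (hQ (hg x hx))
    have hcy : c * (g * x * g⁻¹) = (g * x * g⁻¹) * c := by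
      refine Units.ext (hcomm _ hy1 ?_ hy2 ?_)
      · rw [mulVec_mulVec, ← Units.val_mul, inv_mul_cancel_right, Units.val_mul, ← mulVec_mulVec,
          hx1]
      · rw [vecMul_vecMul, ← Units.val_mul, mul_assoc, inv_mul_cancel_left, Units.val_mul,
          ← vecMul_vecMul, hx2]
    calc c * g * x * (c * g)⁻¹ = c * (g * x * g⁻¹) * c⁻¹ := by group
      _ = g * x * g⁻¹ := by rw [hcy, mul_inv_cancel_right]
end

section
/- Let p be an odd prime and F a finite field of cardinality q with p ∤ q, and assume that the multiplicative order of q modulo p is even. Fix n ≥ 1 and let Sp_{2n}(F) ≤ GL_{2n}(F) be the group of matrices M with Mᵀ J M = J, where J is the standard alternating 2n × 2n matrix. If S is a Sylow p-subgroup of Sp_{2n}(F), then S is a Sylow p-subgroup of GL_{2n}(F), and for all subgroups P, Q ≤ S and every g ∈ GL_{2n}(F) with gPg⁻¹ ≤ Q, there exists h ∈ Sp_{2n}(F) such that hxh⁻¹ = gxg⁻¹ for all x ∈ P. -/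
open Matrix

/-- Norm surjectivity for a nontrivial involution of a finite field. -/
theorem exists_mul_involution_eq_of_field {k : Type*} [Field k] [Finite k] (σ : k →+* k)
    (hσ : ∀ x, σ (σ x) = x) {x : k} (hx : σ x ≠ x) {a : k} (ha : a ≠ 0) (hσa : σ a = a) :
    ∃ b, b * σ b = a := by
  let s : kˣ →* kˣ := Units.map σ.toMonoidHom
  have hs : ∀ u, s (s u) = u := fun u => Units.ext (hσ u)
  let N : kˣ →* kˣ := MonoidHom.id _ * s
  let D : kˣ →* kˣ := MonoidHom.id _ / s
  have hN : ∀ u, N u = u * s u := fun u => rfl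
  have hD : ∀ u, D u = u / s u := fun u => rfl
  have hker : N.ker ≤ D.range := by
    intro u hu
    have hu1 : (u : k) * σ u = 1 := by
      have := congrArg Units.val (hN u ▸ (MonoidHom.mem_ker.mp hu))
      simpa [s] using this
    obtain ⟨y, hy⟩ : ∃ y : k, y + u * σ y ≠ 0 := by
      by_contra! h
      have h1 := h 1
      have h2 := h x
      rw [map_one, mul_one] at h1
      rw [eq_neg_of_add_eq_zero_right h1] at h2
      exact hx (by linear_combination -h2)
    refine ⟨Units.mk0 _ hy, ?_⟩
    rw [hD, div_eq_iff_eq_mul]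
    ext
    simp only [s, Units.val_mul, Units.coe_map, Units.val_mk0, RingHom.toMonoidHom_eq_coe,
      MonoidHom.coe_coe, map_add, map_mul, hσ]
    linear_combination (-y) * hu1
  have hrange : N.range ≤ D.ker := by
    rintro _ ⟨u, rfl⟩
    rw [MonoidHom.mem_ker, hD, hN, map_mul, hs, mul_comm, div_self']
  have h1 : Nat.card N.ker * Nat.card N.range = Nat.card kˣ := by
    rw [← Subgroup.card_mul_index N.ker, Subgroup.index_ker]
  have h2 : Nat.card D.ker * Nat.card D.range = Nat.card kˣ := by
    rw [← Subgroup.card_mul_index D.ker, Subgroup.index_ker]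
  have h3 : Nat.card N.ker ≤ Nat.card D.range :=
    Nat.card_le_card_of_injective _ (Subgroup.inclusion_injective hker)
  have h4 : Nat.card D.ker ≤ Nat.card N.range := by
    have : 0 < Nat.card D.range := Nat.card_pos
    by_contra! h
    have : Nat.card N.ker * Nat.card N.range < Nat.card D.ker * Nat.card D.range := by
      calc _ ≤ Nat.card D.range * Nat.card N.range := Nat.mul_le_mul_right _ h3
        _ < Nat.card D.range * Nat.card D.ker := Nat.mul_lt_mul_of_pos_left h this
        _ = _ := mul_comm _ _
    omega
  have h5 : N.range = D.ker := Subgroup.eq_of_le_of_card_ge hrange h4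
  have h6 : Units.mk0 a ha ∈ D.ker := by
    rw [MonoidHom.mem_ker, hD, div_eq_one]
    ext
    simp [s, hσa]
  rw [← h5] at h6
  obtain ⟨u, hu⟩ := h6
  exact ⟨u, by simpa [s] using congrArg Units.val ((hN u).symm.trans hu)⟩

section Involution

variable {R : Type*} [CommRing R] {σ : R →+* R}

/-- Newton step: a solution of `b * σ b = a` modulo `I` lifts modulo `I ^ 2`. -/
theorem exists_mul_involution_sub_mem_sq (hσ : ∀ x, σ (σ x) = x) {x : R} (hx : IsUnit (x - σ x))
    {a : R} (ha : IsUnit a) (hσa : σ a = a) {I : Ideal R}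
    (h : ∃ b, b * σ b - a ∈ I) : ∃ b, b * σ b - a ∈ I ^ 2 := by
  obtain ⟨b, hb⟩ := h
  obtain ⟨u, hu⟩ := hx.exists_right_inv
  obtain ⟨a', ha'⟩ := ha.exists_right_inv
  have hσu : σ u = -u := by
    have h1 : (σ x - x) * σ u = 1 := by
      have := congrArg σ hu
      simpa [hσ] using this
    calc σ u = σ u * ((x - σ x) * u) := by rw [hu, mul_one]
      _ = -((σ x - x) * σ u) * u := by ring
      _ = -u := by rw [h1]; ring
  have hσa' : σ a' = a' := by
    have h1 : a * σ a' = 1 := by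
      have := congrArg σ ha'
      simpa [hσa] using this
    calc σ a' = σ a' * (a * a') := by rw [ha', mul_one]
      _ = (a * σ a') * a' := by ring
      _ = a' := by rw [h1, one_mul]
  set i := b * σ b - a with hi
  have hσi : σ i = i := by rw [hi]; simp [hσ, hσa, mul_comm]
  refine ⟨b - i * (x * u) * b * a', ?_⟩
  have key : (b - i * (x * u) * b * a') * σ (b - i * (x * u) * b * a') - a =
      i * i * (- a' - (x * u) * (σ x * u) * a' * a' * (b * σ b)) := by
    simp only [map_sub, map_mul, hσi, hσu, hσa']
    have h1 : b * σ b = i + a := by rw [hi]; ring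
    have h2 : a * a' = 1 := ha'
    linear_combination (1 - i * a' * ((x - σ x) * u)) * h1 - (i * (i + a) * a') * hu
      - i * h2
  rw [key, pow_two]
  exact Ideal.mul_mem_right _ _ (Ideal.mul_mem_mul hb hb)

theorem exists_mul_involution_sub_mem_inf {a : R} {I K : Ideal R} (hI : ∀ i ∈ I, σ i ∈ I)
    (hK : ∀ i ∈ K, σ i ∈ K) (hIK : I ⊔ K = ⊤)
    (h : ∃ b, b * σ b - a ∈ I) (h' : ∃ b, b * σ b - a ∈ K) : ∃ b, b * σ b - a ∈ I ⊓ K := by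
  obtain ⟨b, hb⟩ := h
  obtain ⟨c, hc⟩ := h'
  obtain ⟨i, hi, k, hk, hik⟩ := Submodule.mem_sup.mp ((Ideal.eq_top_iff_one _).mp hIK)
  have aux : ∀ {L : Ideal R}, (∀ i ∈ L, σ i ∈ L) → ∀ {d e : R}, d - e ∈ L → e * σ e - a ∈ L →
      d * σ d - a ∈ L := by
    intro L hL d e hde he
    have : d * σ d - a = (d - e) * σ d + e * σ (d - e) + (e * σ e - a) := by
      rw [map_sub]; ring
    rw [this]
    exact L.add_mem (L.add_mem (L.mul_mem_right _ hde) (L.mul_mem_left _ (hL _ hde))) he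
  refine ⟨b * k + c * i, aux hI ?_ hb, aux hK ?_ hc⟩
  · have : b * k + c * i - b = i * (c - b) := by linear_combination b * hik
    rw [this]
    exact I.mul_mem_right _ hi
  · have : b * k + c * i - c = k * (b - c) := by linear_combination c * hik
    rw [this]
    exact K.mul_mem_right _ hk

theorem exists_mul_involution_sub_mem_maximal [Finite R] (hσ : ∀ x, σ (σ x) = x) {x : R}
    (hx : IsUnit (x - σ x)) {a : R} (ha : IsUnit a) (hσa : σ a = a) (m : Ideal R)
    [hm : m.IsMaximal] : ∃ b, b * σ b - a ∈ m ⊓ m.comap σ := by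
  by_cases h : m ≤ m.comap σ
  · have hmem : ∀ {y}, y ∉ m → Ideal.Quotient.mk m y ≠ 0 := fun hy h =>
      hy (Ideal.Quotient.eq_zero_iff_mem.mp h)
    have hunit : ∀ {y}, IsUnit y → y ∉ m := fun hy h =>
      hm.ne_top (Ideal.eq_top_of_isUnit_mem _ h hy)
    let _ := Ideal.Quotient.field m
    have : Finite (R ⧸ m) := Finite.of_surjective _ Ideal.Quotient.mk_surjective
    obtain ⟨b, hb⟩ := exists_mul_involution_eq_of_field (Ideal.quotientMap m σ h)
      (x := Ideal.Quotient.mk m x) (a := Ideal.Quotient.mk m a)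
      (fun y => by
        obtain ⟨y, rfl⟩ := Ideal.Quotient.mk_surjective y
        simp [hσ])
      (fun h => hmem (hunit hx) (by
        rw [map_sub, sub_eq_zero]
        simpa using h.symm)) (hmem (hunit ha)) (by simp [hσa])
    obtain ⟨b, rfl⟩ := Ideal.Quotient.mk_surjective b
    have : b * σ b - a ∈ m := by
      rw [← Ideal.Quotient.eq_zero_iff_mem, map_sub, map_mul, sub_eq_zero]
      simpa using hb
    exact ⟨b, this, h this⟩
  · have hmax : m ⊔ m.comap σ = ⊤ := by
      by_contra hne
      have h1 : m = m ⊔ m.comap σ := hm.eq_of_le hne le_sup_left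
      have h2 : m.comap σ ≤ m := sup_eq_left.mp h1.symm
      exact h fun y hy => h2 (by simpa [hσ] using hy)
    obtain ⟨i, hi, j, hj, hij⟩ := Submodule.mem_sup.mp ((Ideal.eq_top_iff_one _).mp hmax)
    have hσj : σ j ∈ m := hj
    have hij' : σ i + σ j = 1 := by rw [← map_add, hij, map_one]
    have hmem : (i + a * j) * σ (i + a * j) - a ∈ m := by
      have : (i + a * j) * σ (i + a * j) - a =
          i * (σ (i + a * j) - a) + σ j * (a * a * j - a * j) := by
        simp only [map_add, map_mul, hσa]
        linear_combination a * hij + a * j * hij'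
      rw [this]
      exact m.add_mem (m.mul_mem_right _ hi) (m.mul_mem_right _ hj)
    refine ⟨i + a * j, hmem, ?_⟩
    change σ _ ∈ m
    convert hmem using 1
    simp only [map_add, map_sub, map_mul, hσa, hσ]
    ring

/-- In a finite commutative ring with an involution `σ` such that some `x - σ x` is a unit, every
unit fixed by `σ` has the form `b * σ b`. -/
theorem exists_mul_involution_eq [Finite R] (hσ : ∀ x, σ (σ x) = x) {x : R}
    (hx : IsUnit (x - σ x)) {a : R} (ha : IsUnit a) (hσa : σ a = a) : ∃ b, b * σ b = a := by
  classical
  have hfin : ∀ T : Finset (Ideal R), (∀ m ∈ T, m.IsMaximal) →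
      ∃ I : Ideal R, (∀ i ∈ I, σ i ∈ I) ∧ (∃ b, b * σ b - a ∈ I) ∧ ∀ m ∈ T, I ≤ m := by
    intro T
    induction T using Finset.induction_on with
    | empty => exact fun _ => ⟨⊤, by simp, ⟨0, by simp⟩, by simp⟩
    | insert m T _ ih =>
      intro hT
      obtain ⟨I, hI, hIb, hIT⟩ := ih fun m hm => hT m (Finset.mem_insert_of_mem hm)
      have hm : m.IsMaximal := hT m (Finset.mem_insert_self _ _)
      by_cases hIm : I ≤ m
      · exact ⟨I, hI, hIb, by simpa [hIm] using hIT⟩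
      have hK : ∀ i ∈ m ⊓ m.comap σ, σ i ∈ m ⊓ m.comap σ := fun i hi =>
        ⟨hi.2, by simpa [hσ] using hi.1⟩
      have h1 : I ⊔ m = ⊤ := by
        by_contra hne
        exact hIm (sup_eq_right.mp (hm.eq_of_le hne le_sup_right).symm)
      have h2 : I ⊔ m.comap σ = ⊤ := by
        obtain ⟨i, hi, j, hj, hij⟩ := Submodule.mem_sup.mp ((Ideal.eq_top_iff_one _).mp h1)
        refine (Ideal.eq_top_iff_one _).mpr (Submodule.mem_sup.mpr
          ⟨σ i, hI i hi, σ j, ?_, by rw [← map_add, hij, map_one]⟩)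
        simpa [hσ] using hj
      have h3 : I ⊔ (m ⊓ m.comap σ) = ⊤ := by
        rw [eq_top_iff, ← Ideal.isCoprime_iff_sup_eq.mp ((Ideal.isCoprime_iff_sup_eq.mpr
          h1).mul_right (Ideal.isCoprime_iff_sup_eq.mpr h2))]
        exact sup_le_sup_left Ideal.mul_le_inf _
      refine ⟨I ⊓ (m ⊓ m.comap σ), fun i hi => ⟨hI i hi.1, hK i hi.2⟩,
        exists_mul_involution_sub_mem_inf hI hK h3 hIb
          (exists_mul_involution_sub_mem_maximal hσ hx ha hσa m), fun m' hm' => ?_⟩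
      rcases Finset.mem_insert.mp hm' with rfl | hm'
      · exact inf_le_right.trans inf_le_left
      · exact inf_le_left.trans (hIT m' hm')
  obtain ⟨I, -, hIb, hIm⟩ := hfin (Set.toFinite {m : Ideal R | m.IsMaximal}).toFinset (by simp)
  have hpow : ∀ k : ℕ, ∃ b, b * σ b - a ∈ I ^ 2 ^ k := by
    intro k
    induction k with
    | zero => simpa using hIb
    | succ k ih =>
      rw [pow_succ, pow_mul]
      exact exists_mul_involution_sub_mem_sq hσ hx ha hσa ih
  have hI : I ≤ (⊥ : Ideal R).jacobson := le_sInf fun m hm => hIm m (by simpa using hm.2)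
  obtain ⟨N, hN⟩ := IsArtinianRing.isNilpotent_jacobson_bot (R := R)
  obtain ⟨b, hb⟩ := hpow N
  have h0 : I ^ 2 ^ N ≤ ⊥ := by
    calc I ^ 2 ^ N ≤ I ^ N := Ideal.pow_le_pow_right Nat.lt_two_pow_self.le
      _ ≤ (⊥ : Ideal R).jacobson ^ N := Ideal.pow_right_mono hI N
      _ = ⊥ := hN
  exact ⟨b, sub_eq_zero.mp (by simpa using h0 hb)⟩

/-- The version of `exists_mul_involution_eq` for the corner of an idempotent `f`. -/
theorem exists_mul_involution_eq_mul_idempotent [Finite R] (hσ : ∀ x, σ (σ x) = x) {f : R}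
    (hf : f * f = f) (hσf : σ f = f) {x : R} (hx : ∃ u, (x - σ x) * u = f) {a : R} (ha : IsUnit a)
    (hσa : σ a = a) : ∃ b, b * σ b = a * f := by
  let I := Ideal.span {1 - f}
  have hI : I ≤ I.comap σ := by
    rw [Ideal.span_singleton_le_iff_mem, Ideal.mem_comap, map_sub, map_one, hσf]
    exact Ideal.mem_span_singleton_self _
  have hone : Ideal.Quotient.mk I f = 1 := by
    rw [← map_one (Ideal.Quotient.mk I), eq_comm, Ideal.Quotient.eq]
    exact Ideal.mem_span_singleton_self _
  have : Finite (R ⧸ I) := Finite.of_surjective _ Ideal.Quotient.mk_surjective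
  obtain ⟨u, hu⟩ := hx
  obtain ⟨b, hb⟩ := exists_mul_involution_eq (σ := Ideal.quotientMap I σ hI)
    (x := Ideal.Quotient.mk I x) (a := Ideal.Quotient.mk I a)
    (fun y => by
      obtain ⟨y, rfl⟩ := Ideal.Quotient.mk_surjective y
      simp [hσ])
    (.of_mul_eq_one (Ideal.Quotient.mk I u)
      (by simpa [hone] using congrArg (Ideal.Quotient.mk I) hu))
    (ha.map _) (by simp [hσa])
  obtain ⟨b, rfl⟩ := Ideal.Quotient.mk_surjective b
  rw [Ideal.quotientMap_mk, ← map_mul, Ideal.Quotient.eq, Ideal.mem_span_singleton'] at hb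
  obtain ⟨c, hc⟩ := hb
  refine ⟨f * b, ?_⟩
  rw [map_mul, hσf]
  linear_combination (b * σ b - c) * hf - f * hc

end Involution

/-- If `w` is a `σ`-unitary element of odd order `p` in the corner of an idempotent `f`, then `a`
is a norm on the complement in `f` of the projection `e` onto the fixed points of `w`. -/
theorem exists_idempotent_and_mul_involution_eq {R : Type*} [CommRing R] [Finite R] {σ : R →+* R}
    (hσ : ∀ x, σ (σ x) = x) {p : ℕ} (hodd : Odd p) (hp : IsUnit (p : R)) {f w a : R}
    (hf : f * f = f) (hσf : σ f = f) (hwf : w * f = w) (hw : w * σ w = f) (hwp : w ^ p = f)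
    (ha : IsUnit a) (hσa : σ a = a) :
    ∃ e b, e * e = e ∧ e * f = e ∧ σ e = e ∧ w * e = e ∧ b * (f - e) = b ∧
      b * σ b = a * (f - e) := by
  obtain ⟨c, hc⟩ := hp.exists_right_inv
  have hσc : σ c = c := by
    have h1 : (p : R) * σ c = 1 := by simpa using congrArg σ hc
    calc σ c = σ c * (p * c) := by rw [hc, mul_one]
      _ = (p * σ c) * c := by ring
      _ = c := by rw [h1, one_mul]
  set e := c * f * ∑ i ∈ Finset.range p, w ^ i with he
  have hef : e * f = e := by rw [he]; linear_combination (c * ∑ i ∈ Finset.range p, w ^ i) * hf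
  have hwe : w * e = e := by
    have h1 := Finset.sum_range_succ' (fun i => w ^ i) p
    rw [Finset.sum_range_succ, hwp] at h1
    simp only [pow_succ, ← Finset.sum_mul, pow_zero] at h1
    rw [he]
    linear_combination (-c * f) * h1 + c * hf
  have hpow : ∀ {v : R}, v * e = e → c * f * (∑ i ∈ Finset.range p, v ^ i) * e = e := by
    intro v hv
    have : ∀ i, v ^ i * e = e := fun i => by
      induction i with
      | zero => simp
      | succ i ih => rw [pow_succ, mul_assoc, hv, ih]
    rw [mul_assoc, Finset.sum_mul, Finset.sum_congr rfl fun i _ => this i]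
    simp only [Finset.sum_const, Finset.card_range, nsmul_eq_mul]
    linear_combination hef + (e * f) * hc
  have hee : e * e = e := hpow hwe
  have hσe : σ e = e := by
    have h1 : σ w * e = e := by
      calc σ w * e = w * σ w * e := by rw [mul_right_comm, mul_comm (w * e), hwe]
        _ = e := by rw [hw, mul_comm, hef]
    have h2 : σ e * e = e := by
      have h3 : σ e = c * f * ∑ i ∈ Finset.range p, σ w ^ i := by
        rw [he]
        simp only [map_mul, map_sum, map_pow, hσc, hσf]
      rw [h3]
      exact hpow h1
    have h3 : e * σ e = σ e := by simpa [hσ] using congrArg σ h2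
    rw [← h3, mul_comm, h2]
  have hg : (f - e) * (f - e) = f - e := by linear_combination hf - 2 * hef + hee
  have hu : ∃ u, (w * (f - e) - σ (w * (f - e))) * u = f - e := by
    have hww : w = (w ^ 2) ^ ((p + 1) / 2) := by
      rw [← pow_mul, Nat.mul_div_cancel' (hodd.add_odd odd_one).two_dvd, pow_succ, hwp, mul_comm,
        hwf]
    have hdvd : ∀ i, 1 - w ^ 2 ∣ 1 - w ^ i := fun i => by
      conv_rhs => rw [hww, ← pow_mul]
      simpa using sub_dvd_pow_sub_pow 1 (w ^ 2) ((p + 1) / 2 * i)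
    obtain ⟨G, hG⟩ : 1 - w ^ 2 ∣ ∑ i ∈ Finset.range p, (1 - w ^ i) :=
      Finset.dvd_sum fun i _ => hdvd i
    rw [Finset.sum_sub_distrib] at hG
    simp only [Finset.sum_const, Finset.card_range, nsmul_eq_mul, mul_one] at hG
    refine ⟨-w * G * c, ?_⟩
    simp only [map_mul, map_sub, hσf, hσe]
    have h0 : c * (∑ i ∈ Finset.range p, w ^ i) * (f - e) = 0 := by
      linear_combination (e - 1) * he - hee + (c * ∑ i ∈ Finset.range p, w ^ i) * hef
    have hfg : f * (f - e) = f - e := by linear_combination hf - hef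
    linear_combination ((f - e) * G * c) * hw + G * c * hfg - (f - e) * c * hG + (f - e) * hc - h0
  obtain ⟨b, hb⟩ := exists_mul_involution_eq_mul_idempotent hσ hg (by rw [map_sub, hσf, hσe]) hu
    ha hσa
  refine ⟨e, b * (f - e), hee, hef, hσe, hwe, by rw [mul_assoc, hg], ?_⟩
  rw [map_mul, map_sub, hσf, hσe]
  linear_combination (b * σ b) * hg + (f - e) * hb + a * hg

section StarRing

variable {E : Type*} [Ring E] [StarRing E] [Finite E]

/-- The noncommutative form of `exists_idempotent_and_mul_involution_eq`, obtained by working in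
the double centralizer of the given elements. -/
theorem exists_idempotent_and_star_mul_self_eq {p : ℕ} (hodd : Odd p) (hp : IsUnit (p : E))
    {f w a : E} (hf : f * f = f) (hσf : star f = f) (hwf : w * f = w) (hfw : f * w = w)
    (hw : w * star w = f) (hw' : star w * w = f) (hwp : w ^ p = f) (ha : IsUnit a)
    (hσa : star a = a) (hfa : Commute f a) (hwa : Commute w a) :
    ∃ e b, (∀ g, Commute g f → Commute g a → Commute g w → Commute g (star w) →
        Commute g e ∧ Commute g b) ∧
      e * e = e ∧ e * f = e ∧ star e = e ∧ w * e = e ∧ (f - e) * b = b ∧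
      b * (f - e) = b ∧ star b * b = a * (f - e) := by
  have hfw' : f * star w = star w := by simpa [hσf] using congrArg star hwf
  have hwf' : star w * f = star w := by simpa [hσf] using congrArg star hfw
  have hwa' : Commute (star w) a := by simpa [hσa] using hwa.star_star
  let S : Set E := {f, a, w, star w}
  have hcomm : ∀ x ∈ S, ∀ y ∈ S, y * x = x * y := by
    simp only [S, Set.mem_insert_iff, Set.mem_singleton_iff, forall_eq_or_imp, forall_eq]
    refine ⟨⟨trivial, hfa.eq.symm, by rw [hwf, hfw], by rw [hwf', hfw']⟩,
      ⟨hfa.eq, trivial, hwa.eq, hwa'.eq⟩,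
      ⟨by rw [hwf, hfw], hwa.eq.symm, trivial, by rw [hw, hw']⟩,
      ⟨by rw [hwf', hfw'], hwa'.eq.symm, by rw [hw, hw'], trivial⟩⟩
  have hSstar : ∀ x ∈ S, star x ∈ S := by
    simp [S, hσf, hσa]
  let R := Subring.centralizer (Subring.centralizer S : Set E)
  have hSC : S ⊆ Subring.centralizer S := fun x hx => Subring.mem_centralizer_iff.mpr
    fun y hy => hcomm x hx y hy
  have hSR : S ⊆ R := fun x hx => Subring.mem_centralizer_iff.mpr
    fun y hy => ((Subring.mem_centralizer_iff.mp hy) x hx).symm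
  have hRC : ∀ x ∈ R, x ∈ Subring.centralizer S := fun x hx => Subring.mem_centralizer_iff.mpr
    fun y hy => Subring.mem_centralizer_iff.mp hx y (hSC hy)
  have hCstar : ∀ x ∈ Subring.centralizer S, star x ∈ Subring.centralizer S := fun x hx =>
    Subring.mem_centralizer_iff.mpr fun y hy => by
      simpa using (congrArg star (Subring.mem_centralizer_iff.mp hx _ (hSstar y hy))).symm
  have hRstar : ∀ x ∈ R, star x ∈ R := fun x hx =>
    Subring.mem_centralizer_iff.mpr fun y hy => by
      simpa using (congrArg star (Subring.mem_centralizer_iff.mp hx _ (hCstar y hy))).symm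
  have hRcomm : ∀ x ∈ R, ∀ y ∈ R, x * y = y * x := fun x hx y hy =>
    Subring.mem_centralizer_iff.mp hy x (hRC x hx)
  have hRinv : ∀ x : R, IsUnit (x : E) → IsUnit x := by
    rintro ⟨x, hx⟩ ⟨u, hu⟩
    simp only at hu
    subst hu
    have hu' : (↑u⁻¹ : E) ∈ R := Subring.mem_centralizer_iff.mpr fun y hy =>
      (show Commute y u from Subring.mem_centralizer_iff.mp hx y hy).units_inv_right
    exact ⟨⟨⟨u, hx⟩, ⟨_, hu'⟩, Subtype.ext u.mul_inv, Subtype.ext u.inv_mul⟩, rfl⟩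
  let _ : CommRing R :=
    { (inferInstance : Ring R) with mul_comm := fun x y => Subtype.ext (hRcomm x x.2 y y.2) }
  let σ : R →+* R :=
    { toFun := fun x => ⟨star x, hRstar x x.2⟩
      map_one' := Subtype.ext (star_one E)
      map_zero' := Subtype.ext (star_zero E)
      map_add' := fun x y => Subtype.ext (star_add (x : E) y)
      map_mul' := fun x y => Subtype.ext <| by
        change star ((x : E) * y) = star (x : E) * star (y : E)
        rw [hRcomm x x.2 y y.2, star_mul] }
  obtain ⟨e, b, h1, h2, h3, h4, h5, h6⟩ := exists_idempotent_and_mul_involution_eq (σ := σ)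
    (fun x => Subtype.ext (star_star x.1)) hodd (hRinv (p : R) (by simpa using hp))
    (f := ⟨f, hSR (by simp [S])⟩) (w := ⟨w, hSR (by simp [S])⟩) (a := ⟨a, hSR (by simp [S])⟩)
    (Subtype.ext hf) (Subtype.ext hσf) (Subtype.ext hwf) (Subtype.ext hw) (Subtype.ext hwp)
    (hRinv _ ha) (Subtype.ext hσa)
  refine ⟨e, b, fun g hgf hga hgw hgw' => ?_, congrArg Subtype.val h1, congrArg Subtype.val h2,
    congrArg Subtype.val h3, congrArg Subtype.val h4,
    congrArg Subtype.val ((mul_comm _ _).trans h5),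
    congrArg Subtype.val h5, ?_⟩
  · have hg : g ∈ Subring.centralizer S := Subring.mem_centralizer_iff.mpr (by
      simp only [S, Set.mem_insert_iff, Set.mem_singleton_iff, forall_eq_or_imp, forall_eq]
      exact ⟨hgf.eq.symm, hga.eq.symm, hgw.eq.symm, hgw'.eq.symm⟩)
    exact ⟨Subring.mem_centralizer_iff.mp e.2 g hg, Subring.mem_centralizer_iff.mp b.2 g hg⟩
  · rw [hRcomm _ (hRstar b b.2) b b.2]
    exact congrArg Subtype.val h6

/-- A self-adjoint unit centralized by a unitary `p`-group `G` has the form `star B * B` with `B`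
centralized by `G`, provided this holds without the group in each self-adjoint corner. -/
theorem exists_star_mul_self_eq_of_isPGroup {p : ℕ} [Fact p.Prime] (hodd : Odd p)
    (hp : IsUnit (p : E)) {G : Subgroup Eˣ} (hG : IsPGroup p G)
    (hstar : ∀ g ∈ G, star (g : E) = ↑g⁻¹) {a : E} (ha : IsUnit a) (hσa : star a = a)
    (hGa : ∀ g ∈ G, Commute (g : E) a)
    (hbase : ∀ f : E, f * f = f → star f = f → Commute f a →
      ∃ b, f * b = b ∧ b * f = b ∧ star b * b = a * f) :
    ∃ b, (∀ g ∈ G, Commute (g : E) b) ∧ star b * b = a := by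
  let K : E → Subgroup G := fun f =>
    { carrier := {g | ((g : Eˣ) : E) * f = f}
      one_mem' := by simp
      mul_mem' := fun {x y} hx hy => by
        have hx : ((x : Eˣ) : E) * f = f := hx
        have hy : ((y : Eˣ) : E) * f = f := hy
        simp [mul_assoc, hx, hy]
      inv_mem' := fun {x} hx => by
        have hx : ((x : Eˣ) : E) * f = f := hx
        change ((x⁻¹ : Eˣ) : E) * f = f
        rw [Units.inv_mul_eq_iff_eq_mul, hx] }
  have hK : ∀ {f g}, g ∈ K f ↔ ((g : Eˣ) : E) * f = f := Iff.rfl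
  suffices hind : ∀ (N : ℕ) (f : E), (K f).index = N → f * f = f → star f = f → Commute f a →
      (∀ g ∈ G, Commute (g : E) f) → ∃ b, (∀ g ∈ G, Commute (g : E) b) ∧ f * b = b ∧ b * f = b ∧
        star b * b = a * f by
    obtain ⟨b, hb, -, -, hb'⟩ := hind _ 1 rfl (one_mul 1) (star_one E) (Commute.one_left a)
      fun g _ => Commute.one_right _
    exact ⟨b, hb, by rw [hb', mul_one]⟩
  intro N
  induction N using Nat.strong_induction_on with
  | _ N ih =>
  intro f hN hf hσf hfa hGf
  by_cases htop : K f = ⊤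
  · obtain ⟨b, h1, h2, h3⟩ := hbase f hf hσf hfa
    refine ⟨b, fun g hg => ?_, h1, h2, h3⟩
    have hgf : (g : E) * f = f := hK.mp (htop ▸ Subgroup.mem_top (⟨g, hg⟩ : G))
    have hfg : f * (g : E) = f := by rw [← (hGf g hg).eq, hgf]
    change (g : E) * b = b * g
    rw [← h1, ← mul_assoc, hgf, h1]
    conv_rhs => rw [← h2, mul_assoc, hfg, h2]
  have hnormal : (K f).Normal := ⟨fun k hk g => by
    have hk : ((k : Eˣ) : E) * f = f := hk
    have h : Commute (((g : Eˣ)⁻¹ : Eˣ) : E) f := hGf _ (G.inv_mem g.2)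
    rw [hK]
    push_cast
    rw [mul_assoc, h.eq, mul_assoc, ← mul_assoc ((k : Eˣ) : E), hk, ← h.eq,
      Units.mul_inv_cancel_left]⟩
  have hQ : IsPGroup p (G ⧸ K f) := hG.to_quotient _
  have hQnt : Nontrivial (G ⧸ K f) := by
    rw [QuotientGroup.nontrivial_iff]
    exact htop
  have hZ : IsPGroup p (Subgroup.center (G ⧸ K f)) := hQ.to_subgroup _
  have hZnt := hQ.center_nontrivial
  obtain ⟨y, hy⟩ := exists_prime_orderOf_dvd_card' (G := Subgroup.center (G ⧸ K f)) p (by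
    obtain ⟨n, hn, hcard⟩ := (hZ.nontrivial_iff_card).mp hZnt
    rw [hcard]
    exact dvd_pow_self p hn.ne')
  obtain ⟨z, hz⟩ := QuotientGroup.mk_surjective (y : G ⧸ K f)
  have hzK : z ∉ K f := by
    rw [← QuotientGroup.eq_one_iff, hz]
    intro h
    have : y = 1 := Subtype.ext h
    rw [this, orderOf_one] at hy
    exact (Fact.out : p.Prime).one_lt.ne hy
  have hzp : z ^ p ∈ K f := by
    rw [← QuotientGroup.eq_one_iff, QuotientGroup.mk_pow, hz, ← hy]
    exact congrArg Subtype.val (pow_orderOf_eq_one y)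
  have hzc : ∀ g : G, ((g : Eˣ) : E) * ((z : Eˣ) * f) = (z : Eˣ) * ((g : Eˣ) * f) := by
    intro g
    have h1 : (QuotientGroup.mk (z * g) : G ⧸ K f) = QuotientGroup.mk (g * z) := by
      rw [QuotientGroup.mk_mul, QuotientGroup.mk_mul, hz]
      exact (Subgroup.mem_center_iff.mp y.2 _).symm
    have h2 := hK.mp (QuotientGroup.eq.mp h1)
    push_cast at h2
    rw [mul_assoc, Units.inv_mul_eq_iff_eq_mul] at h2
    simpa [mul_assoc] using h2
  set Z : E := ((z : Eˣ) : E) with hZdef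
  have hZf : Commute Z f := hGf _ z.2
  have hσZ : star Z = ↑((z : Eˣ)⁻¹) := hstar _ z.2
  have hσw : star (Z * f) = ↑((z : Eˣ)⁻¹) * f := by
    rw [star_mul, hσf, hσZ]
    exact (hZf.units_inv_left).eq.symm
  have hZf' : Commute (↑((z : Eˣ)⁻¹) : E) f := hZf.units_inv_left
  have hGw : ∀ g ∈ G, Commute (g : E) (Z * f) := by
    intro g hg
    change (g : E) * (Z * f) = Z * f * g
    rw [hzc ⟨g, hg⟩, mul_assoc, (hGf g hg).eq]
  have hGw' : ∀ g ∈ G, Commute (g : E) (star (Z * f)) := by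
    intro g hg
    have := (hGw g⁻¹ (G.inv_mem hg)).star_star
    rwa [hstar _ (G.inv_mem hg), inv_inv] at this
  obtain ⟨e, b, h1, hee, hef, hσe, hwe, hfb, hbf, hbb⟩ := exists_idempotent_and_star_mul_self_eq
    (f := f) (w := Z * f) (a := a) hodd hp hf hσf (by rw [mul_assoc, hf])
    (by rw [← mul_assoc, ← hZf.eq, mul_assoc, hf])
    (by rw [hσw, mul_assoc, ← mul_assoc f, ← hZf'.eq, mul_assoc, hf, hZdef, Units.mul_inv_cancel_left])
    (by rw [hσw, mul_assoc, ← mul_assoc f, ← hZf.eq, mul_assoc, hf, hZdef, Units.inv_mul_cancel_left])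
    (by
      have h := hK.mp hzp
      push_cast at h
      have hfp : f ^ p = f := IsIdempotentElem.pow_eq hf (Fact.out : p.Prime).ne_zero
      rw [hZf.mul_pow, hfp, h])
    ha hσa hfa ((hGa _ z.2).mul_left hfa)
  have hGe : ∀ g ∈ G, Commute (g : E) e := fun g hg =>
    (h1 g (hGf g hg) (hGa g hg) (hGw g hg) (hGw' g hg)).1
  have hGb : ∀ g ∈ G, Commute (g : E) b := fun g hg =>
    (h1 g (hGf g hg) (hGa g hg) (hGw g hg) (hGw' g hg)).2
  have hfe : f * e = e := by simpa [hσf, hσe] using congrArg star hef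
  have hea : Commute a e := (h1 a hfa.symm (Commute.refl a) ((hGa _ z.2).mul_left hfa).symm (by
    simpa [hσa] using (((hGa _ z.2).mul_left hfa).symm).star_star)).1
  have hlt : K f < K e := by
    refine lt_of_le_of_ne (fun g hg => ?_) fun h => hzK (h ▸ ?_)
    · rw [hK] at hg ⊢
      rw [← hfe, ← mul_assoc, hg]
    · rw [hK, ← hZdef]
      rwa [mul_assoc, hfe] at hwe
  have : Finite G := inferInstance
  obtain ⟨b₁, hGb₁, h2, h3, h4⟩ := ih (K e).index
    (hN ▸ Subgroup.index_strictAnti hlt) e rfl hee hσe hea.symm hGe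
  have heb : star b₁ * b = 0 := by
    have h5 : star b₁ * e = star b₁ := by simpa [hσe] using congrArg star h2
    have h6 : e * (f - e) = 0 := by rw [mul_sub, hee, hef, sub_self]
    rw [← h5, ← hfb, mul_assoc, ← mul_assoc e, h6, zero_mul, mul_zero]
  have hbe : star b * b₁ = 0 := by simpa using congrArg star heb
  refine ⟨b₁ + b, fun g hg => (hGb₁ g hg).add_right (hGb g hg), ?_, ?_, ?_⟩
  · rw [mul_add]
    congr 1
    · rw [← h2, ← mul_assoc, hfe]
    · rw [← hfb, ← mul_assoc, mul_sub, hf, hfe]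
  · rw [add_mul]
    congr 1
    · rw [← h3, mul_assoc, hef]
    · rw [← hbf, mul_assoc, sub_mul, hf, hef]
  · rw [star_add, add_mul, mul_add, mul_add, heb, hbe, h4, hbb, add_zero, zero_add, ← mul_add,
      add_sub_cancel]

end StarRing

section SymplecticFamily

variable {F W : Type*} [Field F] [AddCommGroup W] [Module F W] {ω : LinearMap.BilinForm F W} {k : ℕ}

/-- A family of vectors whose Gram matrix with respect to `ω` is the standard alternating matrix. -/
def IsSymplecticFamily (ω : LinearMap.BilinForm F W) (s : Fin k ⊕ Fin k → W) : Prop :=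
  ∀ a b, ω (s a) (s b) = J (Fin k) F a b

/-- The orthogonal complement of the span of a family of vectors. -/
def familyOrthogonal (ω : LinearMap.BilinForm F W) (s : Fin k ⊕ Fin k → W) : Submodule F W :=
  LinearMap.ker (LinearMap.pi fun a => ω (s a))

theorem mem_familyOrthogonal {s : Fin k ⊕ Fin k → W} {v : W} :
    v ∈ familyOrthogonal ω s ↔ ∀ a, ω (s a) v = 0 := by
  simp [familyOrthogonal, funext_iff]

namespace IsSymplecticFamily

variable {s : Fin k ⊕ Fin k → W}

theorem exists_sum_eq (hs : IsSymplecticFamily ω s) (d : Fin k ⊕ Fin k → F) :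
    ∃ c : Fin k ⊕ Fin k → F, ∀ a, ω (s a) (∑ b, c b • s b) = d a := by
  refine ⟨(-J (Fin k) F) *ᵥ d, fun a => ?_⟩
  simp only [map_sum, map_smul, smul_eq_mul, hs a]
  have : (J (Fin k) F *ᵥ ((-J (Fin k) F) *ᵥ d)) a = d a := by
    rw [mulVec_mulVec, mul_neg, J_squared, neg_neg, one_mulVec]
  rw [← this]
  simp only [mulVec, dotProduct, mul_comm]

theorem linearIndependent (hs : IsSymplecticFamily ω s) : LinearIndependent F s := by
  rw [Fintype.linearIndependent_iff]
  intro c hc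
  have h : J (Fin k) F *ᵥ c = 0 := by
    ext a
    have := congrArg (ω (s a)) hc
    simp only [map_sum, map_smul, smul_eq_mul, hs a, map_zero] at this
    simpa [mulVec, dotProduct, mul_comm] using this
  have h' : (-J (Fin k) F) *ᵥ (J (Fin k) F *ᵥ c) = c := by
    rw [mulVec_mulVec, neg_mul, J_squared, neg_neg, one_mulVec]
  rw [h, mulVec_zero] at h'
  exact fun i => (congrFun h' i).symm

theorem two_mul_le_finrank [FiniteDimensional F W] (hs : IsSymplecticFamily ω s) :
    2 * k ≤ Module.finrank F W := by
  simpa [two_mul] using hs.linearIndependent.fintype_card_le_finrank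

theorem finrank_familyOrthogonal [FiniteDimensional F W] (hs : IsSymplecticFamily ω s) :
    Module.finrank F (familyOrthogonal ω s) + 2 * k = Module.finrank F W := by
  have hsurj : Function.Surjective (LinearMap.pi fun a => ω (s a)) := fun d => by
    obtain ⟨c, hc⟩ := hs.exists_sum_eq d
    exact ⟨_, funext hc⟩
  have := LinearMap.finrank_range_add_finrank_ker (LinearMap.pi fun a => ω (s a))
  rw [LinearMap.range_eq_top.mpr hsurj, finrank_top] at this
  simp only [Module.finrank_fintype_fun_eq_card, Fintype.card_sum, Fintype.card_fin] at this
  rw [familyOrthogonal, ← this]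
  ring

theorem exists_mem_familyOrthogonal_ne_zero (hω : ω.IsAlt) (hnd : ∀ v, (∀ w, ω v w = 0) → v = 0)
    (hs : IsSymplecticFamily ω s) {v : W} (hv : v ∈ familyOrthogonal ω s) (hv0 : v ≠ 0) :
    ∃ w ∈ familyOrthogonal ω s, ω v w ≠ 0 := by
  obtain ⟨w, hw⟩ : ∃ w, ω v w ≠ 0 := by
    by_contra! h
    exact hv0 (hnd v h)
  obtain ⟨c, hc⟩ := hs.exists_sum_eq fun a => ω (s a) w
  refine ⟨w - ∑ b, c b • s b, mem_familyOrthogonal.mpr fun a => by rw [map_sub, hc, sub_self], ?_⟩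
  have : ∀ b, ω v (s b) = 0 := fun b => by
    rw [← hω.neg_eq, mem_familyOrthogonal.mp hv, neg_zero]
  simpa [this] using hw

end IsSymplecticFamily

/-- Prepend a pair of vectors to a family. -/
def familyCons (v w : W) (s : Fin k ⊕ Fin k → W) : Fin (k + 1) ⊕ Fin (k + 1) → W :=
  Sum.elim (Fin.cons v (s ∘ Sum.inl)) (Fin.cons w (s ∘ Sum.inr))

theorem isSymplecticFamily_familyCons (hω : ω.IsAlt) {v w : W} {s : Fin k ⊕ Fin k → W} :
    IsSymplecticFamily ω (familyCons v w s) ↔ IsSymplecticFamily ω s ∧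
      v ∈ familyOrthogonal ω s ∧ w ∈ familyOrthogonal ω s ∧ ω v w = -1 := by
  have hswap : ∀ x y, ω x y = 0 ↔ ω y x = 0 := fun x y => by
    rw [← hω.neg_eq, neg_eq_zero]
  have hwv : ω v w = -1 ↔ ω w v = 1 := by rw [← hω.neg_eq, neg_inj]
  simp only [mem_familyOrthogonal, IsSymplecticFamily, Sum.forall, Fin.forall_fin_succ, familyCons,
    Sum.elim_inl, Sum.elim_inr, Fin.cons_zero, Fin.cons_succ, J, fromBlocks_apply₁₁,
    fromBlocks_apply₁₂, fromBlocks_apply₂₁, fromBlocks_apply₂₂, Matrix.zero_apply, hω.self_eq_zero,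
    Matrix.neg_apply, Matrix.one_apply, Fin.succ_inj, Function.comp_apply, Fin.succ_ne_zero,
    (Fin.succ_ne_zero _).symm, if_true, if_false, neg_zero, hwv, hswap v, hswap w, forall_and]
  tauto

theorem IsSymplecticFamily.exists_succ [FiniteDimensional F W] (hω : ω.IsAlt)
    (hnd : ∀ v, (∀ w, ω v w = 0) → v = 0) {s : Fin k ⊕ Fin k → W} (hs : IsSymplecticFamily ω s)
    (hk : 2 * k < Module.finrank F W) :
    ∃ t : Fin (k + 1) ⊕ Fin (k + 1) → W, IsSymplecticFamily ω t := by
  have hpos : 0 < Module.finrank F (familyOrthogonal ω s) := by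
    have := hs.finrank_familyOrthogonal
    omega
  have := Module.finrank_pos_iff.mp hpos
  obtain ⟨⟨v, hv⟩, hv0⟩ := exists_ne (0 : familyOrthogonal ω s)
  obtain ⟨w, hw, hvw⟩ := hs.exists_mem_familyOrthogonal_ne_zero hω hnd hv
    (fun h => hv0 (Subtype.ext h))
  refine ⟨familyCons v (-(ω v w)⁻¹ • w) s, (isSymplecticFamily_familyCons hω).mpr
    ⟨hs, hv, Submodule.smul_mem _ _ hw, ?_⟩⟩
  simp [hvw]

theorem exists_isSymplecticFamily_two_mul_eq_finrank [FiniteDimensional F W] (hω : ω.IsAlt)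
    (hnd : ∀ v, (∀ w, ω v w = 0) → v = 0) :
    ∃ (k : ℕ) (s : Fin k ⊕ Fin k → W), IsSymplecticFamily ω s ∧ 2 * k = Module.finrank F W := by
  have hex : ∀ k, 2 * k ≤ Module.finrank F W →
      ∃ s : Fin k ⊕ Fin k → W, IsSymplecticFamily ω s := by
    intro k
    induction k with
    | zero => exact fun _ => ⟨fun _ => 0, fun a => by rcases a with a | a <;> exact a.elim0⟩
    | succ k ih =>
      intro hk
      obtain ⟨s, hs⟩ := ih (by omega)
      exact hs.exists_succ hω hnd (by omega)
  obtain ⟨s, hs⟩ := hex (Module.finrank F W / 2) (by omega)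
  refine ⟨_, s, hs, ?_⟩
  by_contra hne
  obtain ⟨t, ht⟩ := hs.exists_succ hω hnd (by omega)
  have := ht.two_mul_le_finrank
  omega

/-- Any two nondegenerate alternating forms on a finite-dimensional space are isometric. -/
theorem exists_isometry_of_isAlt [FiniteDimensional F W] {ω' : LinearMap.BilinForm F W}
    (hω : ω.IsAlt) (hnd : ∀ v, (∀ w, ω v w = 0) → v = 0)
    (hω' : ω'.IsAlt) (hnd' : ∀ v, (∀ w, ω' v w = 0) → v = 0) :
    ∃ g : W ≃ₗ[F] W, ∀ x y, ω (g x) (g y) = ω' x y := by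
  obtain ⟨k, s, hs, hk⟩ := exists_isSymplecticFamily_two_mul_eq_finrank hω hnd
  obtain ⟨k', s', hs', hk'⟩ := exists_isSymplecticFamily_two_mul_eq_finrank hω' hnd'
  obtain rfl : k = k' := by omega
  by_cases hk0 : k = 0
  · subst hk0
    have : Subsingleton W := Module.finrank_zero_iff.mp hk.symm
    exact ⟨LinearEquiv.refl F W, fun x y => by simp [Subsingleton.elim x 0]⟩
  have : Nonempty (Fin k ⊕ Fin k) := ⟨Sum.inl ⟨0, by omega⟩⟩
  let b := basisOfLinearIndependentOfCardEqFinrank hs.linearIndependent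
    (by simp [← hk, two_mul])
  let b' := basisOfLinearIndependentOfCardEqFinrank hs'.linearIndependent
    (by simp [← hk, two_mul])
  have hb : ∀ i, b i = s i := fun i => by simp [b]
  have hb' : ∀ i, b' i = s' i := fun i => by simp [b']
  refine ⟨b'.equiv b (Equiv.refl _), fun x y => ?_⟩
  have : ω.compl₁₂ (b'.equiv b (Equiv.refl _)).toLinearMap (b'.equiv b (Equiv.refl _)).toLinearMap
      = ω' := b'.ext fun i => b'.ext fun j => by
    rw [LinearMap.compl₁₂_apply, LinearEquiv.coe_coe, Module.Basis.equiv_apply,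
      Module.Basis.equiv_apply, Equiv.refl_apply, Equiv.refl_apply, hb, hb, hb', hb', hs i j,
      hs' i j]
  rw [← this]
  rfl

theorem card_fiber_of_ne_zero [Fintype F] [Finite W] {φ : W →ₗ[F] F} (hφ : φ ≠ 0) (c : F) :
    Nat.card {w // φ w = c} = Fintype.card F ^ (Module.finrank F W - 1) := by
  obtain ⟨w₀, rfl⟩ := LinearMap.surjective hφ c
  have e : {w // φ w = φ w₀} ≃ LinearMap.ker φ := (Equiv.subRight w₀).subtypeEquiv fun w => by
    simp [sub_eq_zero]
  have hfin : Module.finrank F (LinearMap.ker φ) = Module.finrank F W - 1 := by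
    have := LinearMap.finrank_range_add_finrank_ker φ
    rw [LinearMap.range_eq_top.mpr (LinearMap.surjective hφ), finrank_top,
      Module.finrank_self] at this
    omega
  rw [Nat.card_congr e, Module.natCard_eq_pow_finrank (K := F), hfin, Nat.card_eq_fintype_card]

theorem IsSymplecticFamily.card_extensions [Fintype F] [Finite W] (hω : ω.IsAlt)
    (hnd : ∀ v, (∀ w, ω v w = 0) → v = 0) {s : Fin k ⊕ Fin k → W} (hs : IsSymplecticFamily ω s) :
    Nat.card {x : familyOrthogonal ω s × familyOrthogonal ω s // ω x.1 x.2 = -1} =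
      (Fintype.card F ^ (Module.finrank F W - 2 * k) - 1) *
        Fintype.card F ^ (Module.finrank F W - 2 * k - 1) := by
  classical
  let K := familyOrthogonal ω s
  have hK : Module.finrank F W - 2 * k = Module.finrank F K := by
    have : Module.finrank F K + 2 * k = Module.finrank F W := hs.finrank_familyOrthogonal
    omega
  have := Fintype.ofFinite K
  rw [Nat.card_congr (Equiv.subtypeProdEquivSigmaSubtype fun v w : K => ω v w = -1), Nat.card_sigma,
    ← Finset.add_sum_erase _ _ (Finset.mem_univ (0 : K)), hK]
  have h0 : Nat.card {w : K // ω (0 : K) w = -1} = 0 := by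
    rw [Nat.card_eq_zero]
    exact Or.inl ⟨fun w => by simpa using w.2⟩
  rw [h0, zero_add, Finset.sum_congr rfl fun v hv => (?_ : _ = Fintype.card F ^ (Module.finrank F K - 1))]
  · rw [Finset.sum_const, Finset.card_erase_of_mem (Finset.mem_univ _), Finset.card_univ,
      Module.card_eq_pow_finrank (K := F), smul_eq_mul]
  · obtain ⟨w, hw, hvw⟩ := hs.exists_mem_familyOrthogonal_ne_zero hω hnd v.2
      (fun h => (Finset.mem_erase.mp hv).1 (Subtype.ext h))
    exact card_fiber_of_ne_zero (φ := (ω v).comp K.subtype)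
      (fun h => hvw (LinearMap.congr_fun h ⟨w, hw⟩)) (-1)

theorem card_isSymplecticFamily_succ [Fintype F] [Finite W] (hω : ω.IsAlt)
    (hnd : ∀ v, (∀ w, ω v w = 0) → v = 0) :
    Nat.card {s : Fin (k + 1) ⊕ Fin (k + 1) → W // IsSymplecticFamily ω s} =
      Nat.card {s : Fin k ⊕ Fin k → W // IsSymplecticFamily ω s} *
      ((Fintype.card F ^ (Module.finrank F W - 2 * k) - 1) *
        Fintype.card F ^ (Module.finrank F W - 2 * k - 1)) := by
  have hcons : ∀ t : Fin (k + 1) ⊕ Fin (k + 1) → W,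
      familyCons (t (.inl 0)) (t (.inr 0)) (t ∘ Sum.map Fin.succ Fin.succ) = t := fun t => by
    ext (i | i) <;> cases i using Fin.cases <;> rfl
  have h := fun t : {t : Fin (k + 1) ⊕ Fin (k + 1) → W // IsSymplecticFamily ω t} =>
    (isSymplecticFamily_familyCons hω).mp ((hcons t.1).symm ▸ t.2)
  let g : (Σ s : {s : Fin k ⊕ Fin k → W // IsSymplecticFamily ω s},
        {x : familyOrthogonal ω s.1 × familyOrthogonal ω s.1 // ω x.1 x.2 = -1}) →
      {s : Fin (k + 1) ⊕ Fin (k + 1) → W // IsSymplecticFamily ω s} :=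
    fun x => ⟨familyCons x.2.1.1 x.2.1.2 x.1.1,
      (isSymplecticFamily_familyCons hω).mpr ⟨x.1.2, x.2.1.1.2, x.2.1.2.2, x.2.2⟩⟩
  have hg : Function.Bijective g := by
    refine ⟨?_, fun t => ⟨⟨⟨_, (h t).1⟩, ⟨⟨_, (h t).2.1⟩, ⟨_, (h t).2.2.1⟩⟩, (h t).2.2.2⟩,
      Subtype.ext (hcons t.1)⟩⟩
    rintro ⟨⟨s, hs⟩, ⟨⟨v, hv⟩, ⟨w, hw⟩⟩, hvw⟩ ⟨⟨s', hs'⟩, ⟨⟨v', hv'⟩, ⟨w', hw'⟩⟩, hvw'⟩ heq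
    have heq : familyCons v w s = familyCons v' w' s' := congrArg Subtype.val heq
    obtain rfl : s = s' := by
      ext (i | i)
      · exact congrFun heq (.inl i.succ)
      · exact congrFun heq (.inr i.succ)
    obtain rfl : v = v' := congrFun heq (.inl 0)
    obtain rfl : w = w' := congrFun heq (.inr 0)
    rfl
  have := Fintype.ofFinite {s : Fin k ⊕ Fin k → W // IsSymplecticFamily ω s}
  rw [← Nat.card_congr (Equiv.ofBijective g hg), Nat.card_sigma,
    Finset.sum_congr rfl fun s _ => s.2.card_extensions hω hnd,
    Finset.sum_const, Finset.card_univ, smul_eq_mul, Nat.card_eq_fintype_card]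

end SymplecticFamily

section Symplectic

variable (n : ℕ) (F : Type*) [Field F]

/-- The symplectic adjoint `M ↦ J⁻¹ * Mᵀ * J` as a star structure on matrices. -/
abbrev symplecticStarRing : StarRing (Matrix (Fin n ⊕ Fin n) (Fin n ⊕ Fin n) F) where
  star M := -(J (Fin n) F * Mᵀ * J (Fin n) F)
  star_involutive M := by
    have h := J_squared (Fin n) F
    simp only [transpose_neg, transpose_mul, J_transpose, transpose_transpose]
    calc _ = (J (Fin n) F * J (Fin n) F) * M * (J (Fin n) F * J (Fin n) F) := by noncomm_ring
      _ = M := by rw [h]; simp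
  star_mul M N := by
    have h := J_squared (Fin n) F
    simp only [transpose_mul]
    calc _ = J (Fin n) F * Nᵀ * (-1) * Mᵀ * J (Fin n) F := by noncomm_ring
      _ = _ := by rw [← h]; noncomm_ring
  star_add M N := by
    rw [transpose_add]
    noncomm_ring

/-- The standard alternating form. -/
noncomputable abbrev symplecticForm : LinearMap.BilinForm F (Fin n ⊕ Fin n → F) :=
  Matrix.toBilin' (J (Fin n) F)

variable {n F}

theorem symplecticForm_isAlt : (symplecticForm n F).IsAlt := by
  intro x
  rw [Matrix.toBilin'_apply', J, fromBlocks_mulVec, dotProduct, Fintype.sum_sum_type]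
  simp [mul_comm, Matrix.neg_mulVec]

theorem symplecticForm_nondegenerate (x : Fin n ⊕ Fin n → F)
    (h : ∀ y, symplecticForm n F x y = 0) : x = 0 := by
  have h1 : x ᵥ* J (Fin n) F = 0 := by
    refine dotProduct_eq_zero _ fun y => ?_
    rw [← dotProduct_mulVec, ← Matrix.toBilin'_apply']
    exact h y
  have h2 : (x ᵥ* J (Fin n) F) ᵥ* (-J (Fin n) F) = x := by
    rw [vecMul_vecMul, mul_neg, J_squared, neg_neg, vecMul_one]
  rw [← h2, h1, zero_vecMul]

theorem symplecticForm_mulVec_left (M : Matrix (Fin n ⊕ Fin n) (Fin n ⊕ Fin n) F)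
    (x y : Fin n ⊕ Fin n → F) : symplecticForm n F (M *ᵥ x) y =
      symplecticForm n F x ((symplecticStarRing n F).star M *ᵥ y) := by
  have h : Mᵀ * J (Fin n) F = J (Fin n) F * -(J (Fin n) F * Mᵀ * J (Fin n) F) := by
    calc _ = -((-1) * Mᵀ * J (Fin n) F) := by noncomm_ring
      _ = _ := by rw [← J_squared]; noncomm_ring
  rw [Matrix.toBilin'_apply', Matrix.toBilin'_apply', mulVec_mulVec]
  change _ = x ⬝ᵥ (J (Fin n) F * -(J (Fin n) F * Mᵀ * J (Fin n) F)) *ᵥ y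
  rw [← h, ← mulVec_mulVec, dotProduct_mulVec _ Mᵀ, vecMul_transpose]

theorem matrix_ext_symplecticForm {M N : Matrix (Fin n ⊕ Fin n) (Fin n ⊕ Fin n) F}
    (h : ∀ x y, symplecticForm n F x (M *ᵥ y) = symplecticForm n F x (N *ᵥ y)) : M = N := by
  refine ext_of_mulVec_single fun i => ?_
  rw [← sub_eq_zero]
  refine symplecticForm_nondegenerate _ fun x => ?_
  rw [← symplecticForm_isAlt.neg_eq, map_sub, h, sub_self, neg_zero]

theorem transpose_mul_J_mul_eq_J_iff {M : Matrix (Fin n ⊕ Fin n) (Fin n ⊕ Fin n) F} :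
    Mᵀ * J (Fin n) F * M = J (Fin n) F ↔ (symplecticStarRing n F).star M * M = 1 := by
  change _ ↔ -(J (Fin n) F * Mᵀ * J (Fin n) F) * M = 1
  have h := J_squared (Fin n) F
  constructor <;> intro hM
  · calc _ = -(J (Fin n) F * (Mᵀ * J (Fin n) F * M)) := by noncomm_ring
      _ = 1 := by rw [hM, h, neg_neg]
  · calc Mᵀ * J (Fin n) F * M = -((-1) * (Mᵀ * J (Fin n) F * M)) := by noncomm_ring
      _ = J (Fin n) F * (-(J (Fin n) F * Mᵀ * J (Fin n) F) * M) := by rw [← h]; noncomm_ring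
      _ = J (Fin n) F := by rw [hM, mul_one]

/-- On the image of a self-adjoint idempotent commuting with `star g * g`, the form pulled back
along `g` is isometric to the standard one. -/
theorem exists_symplectic_star_mul_self_eq_mul_idempotent
    (g : GL (Fin n ⊕ Fin n) F) : letI := symplecticStarRing n F
    ∀ f : Matrix (Fin n ⊕ Fin n) (Fin n ⊕ Fin n) F, f * f = f → star f = f →
      Commute f (star g.1 * g.1) →
      ∃ b, f * b = b ∧ b * f = b ∧ star b * b = star g.1 * g.1 * f := by
  let _ := symplecticStarRing n F
  intro f hf hσf hfa
  set ω := symplecticForm n F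
  have hadj : ∀ (M : Matrix (Fin n ⊕ Fin n) (Fin n ⊕ Fin n) F) x y,
    ω (M *ᵥ x) y = ω x (star M *ᵥ y) := symplecticForm_mulVec_left
  let W : Submodule F (Fin n ⊕ Fin n → F) := LinearMap.range f.mulVecLin
  have hW : ∀ x ∈ W, f *ᵥ x = x := by
    rintro _ ⟨y, rfl⟩
    simp [hf]
  have hfW : ∀ x, f *ᵥ x ∈ W := fun x => ⟨x, rfl⟩
  let ω₁ : LinearMap.BilinForm F W := ω.compl₁₂ W.subtype W.subtype
  let ω₂ : LinearMap.BilinForm F W :=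
    ω.compl₁₂ (g.1.mulVecLin ∘ₗ W.subtype) (g.1.mulVecLin ∘ₗ W.subtype)
  have hnd : ∀ x ∈ W, (∀ y, ω x (f *ᵥ y) = 0) → x = 0 := fun x hx h => by
    refine symplecticForm_nondegenerate _ fun y => ?_
    have := h y
    rw [← hσf, ← hadj, hW x hx] at this
    exact this
  obtain ⟨γ, hγ⟩ := exists_isometry_of_isAlt (ω := ω₁) (ω' := ω₂)
    (fun x => symplecticForm_isAlt _)
    (fun x h => Subtype.ext (hnd x x.2 fun y => h ⟨f *ᵥ y, hfW y⟩))
    (fun x => symplecticForm_isAlt _)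
    (fun x h => Subtype.ext (by
      have hsurj : ∀ y, ∃ u, y = (star g.1 * g.1) *ᵥ u := fun y =>
        ⟨(star g * g)⁻¹.1 *ᵥ y, by
          rw [mulVec_mulVec]
          change y = ((star g * g).1 * (star g * g)⁻¹.1) *ᵥ y
          rw [Units.mul_inv, one_mulVec]⟩
      refine hnd x x.2 fun y => ?_
      obtain ⟨u, rfl⟩ := hsurj y
      rw [mulVec_mulVec, hfa.eq, mul_assoc, ← mulVec_mulVec, ← hadj, ← mulVec_mulVec]
      exact h ⟨f *ᵥ u, hfW u⟩))
  let T : (Fin n ⊕ Fin n → F) →ₗ[F] (Fin n ⊕ Fin n → F) :=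
    W.subtype ∘ₗ γ.toLinearMap ∘ₗ f.mulVecLin.rangeRestrict
  have hT : ∀ x, LinearMap.toMatrix' T *ᵥ x = γ ⟨f *ᵥ x, hfW x⟩ := fun x => by
    rw [LinearMap.toMatrix'_mulVec]
    rfl
  refine ⟨LinearMap.toMatrix' T, ?_, ?_, ?_⟩
  · refine ext_of_mulVec_single fun i => ?_
    rw [← mulVec_mulVec, hT, hW _ (γ _).2]
  · refine ext_of_mulVec_single fun i => ?_
    rw [← mulVec_mulVec, hT, hT]
    simp only [mulVec_mulVec, hf]
  · refine matrix_ext_symplecticForm fun x y => ?_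
    change ω _ _ = ω _ _
    have h1 := hγ ⟨f *ᵥ x, hfW x⟩ ⟨f *ᵥ y, hfW y⟩
    change ω _ _ = ω (g.1 *ᵥ f *ᵥ x) (g.1 *ᵥ f *ᵥ y) at h1
    rw [← mulVec_mulVec, ← hadj, hT, hT]
    refine h1.trans ?_
    rw [hadj, hadj, hσf, mulVec_mulVec, mulVec_mulVec, mulVec_mulVec, mul_assoc f (star g.1),
      hfa.eq, mul_assoc _ f f, hf]

/-- Two symplectic `p`-subgroups that are conjugate by `g` in the general linear group are conjugate
in the same way by a symplectic matrix. -/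
theorem exists_symplectic_conj_eq [Finite F] {p : ℕ} [Fact p.Prime] (hodd : Odd p)
    (hp : (p : F) ≠ 0) {P : Subgroup (GL (Fin n ⊕ Fin n) F)} (hP : IsPGroup p P)
    (hPJ : ∀ x ∈ P, x.1ᵀ * J (Fin n) F * x.1 = J (Fin n) F) (g : GL (Fin n ⊕ Fin n) F)
    (hg : ∀ x ∈ P, (g * x * g⁻¹).1ᵀ * J (Fin n) F * (g * x * g⁻¹).1 = J (Fin n) F) :
    ∃ h : GL (Fin n ⊕ Fin n) F, h.1ᵀ * J (Fin n) F * h.1 = J (Fin n) F ∧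
      ∀ x ∈ P, h * x * h⁻¹ = g * x * g⁻¹ := by
  let _ := symplecticStarRing n F
  have hstar : ∀ {x : GL (Fin n ⊕ Fin n) F}, x.1ᵀ * J (Fin n) F * x.1 = J (Fin n) F ↔
      star x * x = 1 := by
    intro x
    rw [transpose_mul_J_mul_eq_J_iff, ← Units.val_inj]
    rfl
  have hsg : ∀ x ∈ P, Commute x (star g * g) := by
    intro x hx
    have h1 : star x = x⁻¹ := eq_inv_of_mul_eq_one_left (hstar.mp (hPJ x hx))
    have h2 : star (g * x * g⁻¹) = (g * x * g⁻¹)⁻¹ :=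
      eq_inv_of_mul_eq_one_left (hstar.mp (hg x hx))
    rw [star_mul, star_mul, h1, star_inv] at h2
    have h3 : x⁻¹ * (star g * g) = star g * g * x⁻¹ := by
      calc x⁻¹ * (star g * g) = star g * ((star g)⁻¹ * (x⁻¹ * star g)) * g := by group
        _ = star g * g * x⁻¹ := by rw [h2]; group
    exact (Commute.inv_left_iff (a := x)).mp h3
  obtain ⟨b, hb, hbb⟩ := exists_star_mul_self_eq_of_isPGroup (E := Matrix _ _ F) (G := P) hodd
    (by
      simpa using (IsUnit.mk0 (p : F) hp).map
        (algebraMap F (Matrix (Fin n ⊕ Fin n) (Fin n ⊕ Fin n) F))) hP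
    (fun x hx => congrArg Units.val (eq_inv_of_mul_eq_one_left (hstar.mp (hPJ x hx))))
    (a := star g.1 * g.1) (star g * g).isUnit (by simp)
    (fun x hx => congrArg Units.val (hsg x hx))
    (exists_symplectic_star_mul_self_eq_mul_idempotent g)
  obtain ⟨u, rfl⟩ : IsUnit b := by
    refine .of_mul_eq_one_right ((star g * g)⁻¹.1 * star b) ?_
    rw [mul_assoc, hbb]
    exact (star g * g).inv_mul
  have hu : star u * u = star g * g := Units.ext hbb
  refine ⟨g * u⁻¹, hstar.mpr ?_, fun x hx => ?_⟩
  · rw [star_mul, star_inv, mul_assoc, ← mul_assoc (star g), ← hu]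
    group
  · have h1 : x * u = u * x := Units.ext (hb x hx)
    have h2 : u⁻¹ * x * u = x := by rw [mul_assoc, h1, inv_mul_cancel_left]
    calc _ = g * (u⁻¹ * x * u) * g⁻¹ := by group
      _ = _ := by rw [h2]

/-- The order of the group of symplectic matrices over a finite field. -/
theorem card_subgroup_of_mem_iff_transpose_mul_J_mul [Fintype F]
    (H : Subgroup (GL (Fin n ⊕ Fin n) F))
    (hH : ∀ M : GL (Fin n ⊕ Fin n) F, M ∈ H ↔ M.1ᵀ * J (Fin n) F * M.1 = J (Fin n) F) :
    Nat.card H = ∏ i ∈ Finset.range n,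
      (Fintype.card F ^ (2 * i + 2) - 1) * Fintype.card F ^ (2 * i + 1) := by
  have hsymp : ∀ M : Matrix (Fin n ⊕ Fin n) (Fin n ⊕ Fin n) F,
      IsSymplecticFamily (symplecticForm n F) M.col ↔ Mᵀ * J (Fin n) F * M = J (Fin n) F := by
    intro M
    rw [← Matrix.ext_iff]
    refine forall₂_congr fun a b => ?_
    rw [Matrix.toBilin'_apply', dotProduct_mulVec]
    rfl
  let φ : H → {s : Fin n ⊕ Fin n → (Fin n ⊕ Fin n → F) //
      IsSymplecticFamily (symplecticForm n F) s} :=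
    fun M => ⟨M.1.1.col, (hsymp _).mpr ((hH _).mp M.2)⟩
  have hφ : Function.Bijective φ := by
    refine ⟨fun M N h => Subtype.ext (Units.ext (transpose_injective (congrArg Subtype.val h))), ?_⟩
    rintro ⟨s, hs⟩
    have hs' := (hsymp (of s)ᵀ).mp hs
    have hu : IsUnit (of s)ᵀ :=
      .of_mul_eq_one_right _ (transpose_mul_J_mul_eq_J_iff.mp hs')
    exact ⟨⟨hu.unit, (hH _).mpr hs'⟩, rfl⟩
  have hcard : ∀ k ≤ n, Nat.card {s : Fin k ⊕ Fin k → (Fin n ⊕ Fin n → F) //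
      IsSymplecticFamily (symplecticForm n F) s} = ∏ i ∈ Finset.range k,
        (Fintype.card F ^ (2 * n - 2 * i) - 1) * Fintype.card F ^ (2 * n - 2 * i - 1) := by
    intro k hk
    induction k with
    | zero =>
      rw [Finset.prod_range_zero, Nat.card_eq_one_iff_unique]
      exact ⟨⟨fun a b => Subtype.ext (Subsingleton.elim _ _)⟩,
        ⟨fun _ => 0, fun a => by rcases a with a | a <;> exact a.elim0⟩⟩
    | succ k ih =>
      rw [card_isSymplecticFamily_succ symplecticForm_isAlt symplecticForm_nondegenerate,
        ih (by omega), Finset.prod_range_succ]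
      simp [two_mul]
  rw [Nat.card_congr (Equiv.ofBijective φ hφ), hcard n le_rfl, ← Finset.prod_range_reflect]
  refine Finset.prod_congr rfl fun i hi => ?_
  have := Finset.mem_range.mp hi
  rw [show 2 * n - 2 * (n - 1 - i) = 2 * i + 2 by omega]
  rfl

theorem card_GL_eq_prod_range {m : Type*} [Fintype m] [DecidableEq m] [Fintype F] :
    Nat.card (GL m F) = ∏ i ∈ Finset.range (Fintype.card m),
      Fintype.card F ^ i * (Fintype.card F ^ (i + 1) - 1) := by
  have e : GL m F ≃* GL (Fin (Fintype.card m)) F :=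
    Units.mapEquiv (Matrix.reindexAlgEquiv F F (Fintype.equivFin m)).toMulEquiv
  rw [Nat.card_congr e.toEquiv, card_GL_field, Finset.prod_mul_distrib,
    ← Finset.prod_range_reflect (fun i => Fintype.card F ^ (i + 1) - 1), ← Finset.prod_mul_distrib,
    Finset.prod_range]
  refine Finset.prod_congr rfl fun i _ => ?_
  have := i.2
  rw [Nat.mul_sub, mul_one, ← pow_add]
  congr 2
  omega

theorem not_dvd_index_symplectic [Fintype F] {p : ℕ} [Fact p.Prime]
    (hpq : ¬ p ∣ Fintype.card F) (heven : Even (orderOf (Fintype.card F : ZMod p)))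
    (H : Subgroup (GL (Fin n ⊕ Fin n) F))
    (hH : ∀ M : GL (Fin n ⊕ Fin n) F, M ∈ H ↔ M.1ᵀ * J (Fin n) F * M.1 = J (Fin n) F) :
    ¬ p ∣ H.index := by
  set q := Fintype.card F with hq
  have hp : p.Prime := Fact.out
  have hsplit : ∀ k, ∏ i ∈ Finset.range (2 * k), q ^ i * (q ^ (i + 1) - 1) =
      (∏ i ∈ Finset.range k, q ^ (2 * i) * (q ^ (2 * i + 1) - 1)) *
        ∏ i ∈ Finset.range k, (q ^ (2 * i + 2) - 1) * q ^ (2 * i + 1) := by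
    intro k
    induction k with
    | zero => simp
    | succ k ih =>
      rw [show 2 * (k + 1) = 2 * k + 1 + 1 by ring, Finset.prod_range_succ, Finset.prod_range_succ,
        ih, Finset.prod_range_succ, Finset.prod_range_succ]
      ring
  have hindex : H.index = ∏ i ∈ Finset.range n, q ^ (2 * i) * (q ^ (2 * i + 1) - 1) := by
    have h1 := H.index_mul_card
    have hpos : 0 < Nat.card H := Nat.card_pos
    rw [card_GL_eq_prod_range, show Fintype.card (Fin n ⊕ Fin n) = 2 * n by simp [two_mul],
      ← hq, hsplit, hq, ← card_subgroup_of_mem_iff_transpose_mul_J_mul H hH] at h1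
    exact Nat.eq_of_mul_eq_mul_right hpos h1
  rw [hindex, hp.prime.dvd_finsetProd_iff]
  rintro ⟨i, -, hi⟩
  rcases hp.dvd_mul.mp hi with hi | hi
  · exact hpq (hp.dvd_of_dvd_pow hi)
  · have hpow : (q : ZMod p) ^ (2 * i + 1) = 1 := by
      rw [← ZMod.natCast_eq_zero_iff, Nat.cast_sub (Nat.one_le_pow _ _ Fintype.card_pos)] at hi
      simpa [sub_eq_zero] using hi
    have := heven.two_dvd.trans (orderOf_dvd_of_pow_eq_one hpow)
    omega

end Symplectic

/-- For `p` an odd prime and `F` a finite field of cardinality `q` prime to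
`p` with `ord_p(q)` even, a Sylow `p`-subgroup `S` of the symplectic group
`Sp_{2n}(F) = {M ∈ GL_{2n}(F) | MᵀJM = J}` is also a Sylow `p`-subgroup of `GL_{2n}(F)`,
and every fusion in `GL_{2n}(F)` between subgroups of `S` is realized by an element of
`Sp_{2n}(F)`. -/
theorem stmt2 (p : ℕ) (hp : p.Prime) (hodd : Odd p)
    (F : Type) [Field F] [Fintype F] (q : ℕ) (hq : Fintype.card F = q) (hpq : ¬ p ∣ q)
    (heven : Even (orderOf ((q : ZMod p))))
    (n : ℕ) (hn : 1 ≤ n)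
    (H : Subgroup (GL (Fin n ⊕ Fin n) F))
    (hH : ∀ M : GL (Fin n ⊕ Fin n) F, M ∈ H ↔
      (M : Matrix (Fin n ⊕ Fin n) (Fin n ⊕ Fin n) F)ᵀ * Matrix.J (Fin n) F *
        (M : Matrix (Fin n ⊕ Fin n) (Fin n ⊕ Fin n) F) = Matrix.J (Fin n) F)
    (S : Sylow p H) :
    (∃ T : Sylow p (GL (Fin n ⊕ Fin n) F),
        (T : Subgroup (GL (Fin n ⊕ Fin n) F)) =
          Subgroup.map H.subtype (S : Subgroup H)) ∧
    (∀ P Q : Subgroup (GL (Fin n ⊕ Fin n) F),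
        P ≤ Subgroup.map H.subtype (S : Subgroup H) →
        Q ≤ Subgroup.map H.subtype (S : Subgroup H) →
        ∀ g : GL (Fin n ⊕ Fin n) F, (∀ x ∈ P, g * x * g⁻¹ ∈ Q) →
          ∃ h ∈ H, ∀ x ∈ P, h * x * h⁻¹ = g * x * g⁻¹) := by
  subst hq
  have : Fact p.Prime := ⟨hp⟩
  have hS : IsPGroup p (Subgroup.map H.subtype (S : Subgroup H)) := S.isPGroup'.map _
  have hSH : Subgroup.map H.subtype (S : Subgroup H) ≤ H := Subgroup.map_subtype_le _
  refine ⟨⟨hS.toSylow ?_, rfl⟩, fun P Q hP hQ g hg => ?_⟩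
  · rw [Subgroup.index_map_subtype, hp.dvd_mul, not_or]
    exact ⟨S.not_dvd_index, not_dvd_index_symplectic hpq heven H hH⟩
  · have hpF : (p : F) ≠ 0 := fun h => hpq (by
      have : addOrderOf (1 : F) = p := addOrderOf_eq_prime (by simpa using h) one_ne_zero
      exact this ▸ addOrderOf_dvd_card)
    obtain ⟨h, hh, hconj⟩ := exists_symplectic_conj_eq hodd hpF (hS.to_le hP)
      (fun x hx => (hH x).mp (hSH (hP hx))) g fun x hx => (hH _).mp (hSH (hQ (hg x hx)))
    exact ⟨h, (hH h).mpr hh, hconj⟩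
end

section
/- Let p be an odd prime and F a finite field of odd cardinality q with p ∤ q, and assume that the multiplicative order of q modulo p is even. Fix n ≥ 1 and let SO_{2n+1}(F) ≤ GL_{2n+1}(F) be the group of matrices M with MᵀM = 1 and det M = 1. If S is a Sylow p-subgroup of SO_{2n+1}(F), then S is a Sylow p-subgroup of GL_{2n+1}(F), and for all subgroups P, Q ≤ S and every g ∈ GL_{2n+1}(F) with gPg⁻¹ ≤ Q, there exists h ∈ SO_{2n+1}(F) such that hxh⁻¹ = gxg⁻¹ for all x ∈ P. -/
open Matrix

theorem exists_sq_sub_mul_sq_eq {R : Type*} [CommRing R] [Finite R] (h2 : IsUnit (2 : R))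
    {a d : R} (ha : IsUnit a) (hd : IsUnit d) : ∃ x y : R, x ^ 2 - d * y ^ 2 = a := by
  let Q := R ⧸ nilradical R
  let π : R →+* Q := Ideal.Quotient.mk _
  have hπ : Function.Surjective π := Ideal.Quotient.mk_surjective
  have : IsReduced Q := (Ideal.isRadical_iff_quotient_reduced _).1 (Ideal.radical_isRadical _)
  have : Finite Q := Finite.of_surjective π hπ
  have : IsArtinianRing Q := inferInstance
  let E := IsArtinianRing.equivPi Q
  have key : ∃ x y : Q, x ^ 2 - π d * y ^ 2 = π a := by
    have h : ∀ m : MaximalSpectrum Q, ∃ x y : Q ⧸ m.asIdeal,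
        x ^ 2 - E (π d) m * y ^ 2 = E (π a) m := by
      intro m
      have := m.isMaximal
      let _ : Field (Q ⧸ m.asIdeal) := Ideal.Quotient.field _
      have : Finite (Q ⧸ m.asIdeal) := Finite.of_surjective _ Ideal.Quotient.mk_surjective
      let _ : Fintype (Q ⧸ m.asIdeal) := Fintype.ofFinite _
      let φ : R →+* Q ⧸ m.asIdeal := (Pi.evalRingHom _ m).comp (E.toRingHom.comp π)
      have hφ : ∀ r, φ r = E (π r) m := fun _ => rfl
      have hd0 : φ d ≠ 0 := (hd.map φ).ne_zero
      have h20 : (2 : Q ⧸ m.asIdeal) ≠ 0 := by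
        have := (h2.map φ).ne_zero
        rwa [map_ofNat] at this
      have hc : ringChar (Q ⧸ m.asIdeal) ≠ 2 := by
        intro h
        apply h20
        have := ringChar.Nat.cast_ringChar (R := Q ⧸ m.asIdeal)
        rw [h] at this
        exact_mod_cast this
      have hodd : Fintype.card (Q ⧸ m.asIdeal) % 2 = 1 := FiniteField.odd_card_of_char_ne_two hc
      obtain ⟨x, y, hxy⟩ := FiniteField.exists_root_sum_quadratic
        (f := Polynomial.X ^ 2) (g := - Polynomial.C (φ d) * Polynomial.X ^ 2 - Polynomial.C (φ a))
        (by simp) (by compute_degree!) hodd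
      refine ⟨x, y, ?_⟩
      simp only [Polynomial.eval_pow, Polynomial.eval_X, Polynomial.eval_sub, Polynomial.eval_mul,
        Polynomial.eval_neg, Polynomial.eval_C] at hxy
      rw [← hφ, ← hφ]
      linear_combination hxy
    choose x y h using h
    refine ⟨E.symm x, E.symm y, E.injective ?_⟩
    ext m
    simpa using h m
  obtain ⟨x', y', hxy⟩ := key
  obtain ⟨x, rfl⟩ := hπ x'
  obtain ⟨y, rfl⟩ := hπ y'
  have hn : IsNilpotent (x ^ 2 - d * y ^ 2 - a) := by
    rw [← mem_nilradical, ← Ideal.Quotient.eq_zero_iff_mem]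
    change π _ = 0
    simp [hxy]
  have hu : IsUnit (x ^ 2 - d * y ^ 2) := by
    have := hn.isUnit_add_right_of_commute ha (Commute.all _ _)
    simpa using this
  obtain ⟨b, hb⟩ := hu.exists_right_inv
  let f : Polynomial R := Polynomial.X ^ 2 - Polynomial.C (a * b)
  have h1 : IsNilpotent (Polynomial.aeval (1 : R) f) := by
    have : Polynomial.aeval (1 : R) f = (x ^ 2 - d * y ^ 2 - a) * b := by
      simp [f]; linear_combination -hb
    rw [this]
    exact (Commute.all _ _).isNilpotent_mul_right hn
  have h2' : IsUnit (Polynomial.aeval (1 : R) (Polynomial.derivative f)) := by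
    simpa [f, one_add_one_eq_two] using h2
  obtain ⟨r, ⟨-, hr⟩, -⟩ := Polynomial.existsUnique_nilpotent_sub_and_aeval_eq_zero h1 h2'
  have hr : r ^ 2 = a * b := by
    simpa [f, sub_eq_zero] using hr
  refine ⟨r * x, r * y, ?_⟩
  linear_combination (x ^ 2 - d * y ^ 2) * hr + a * hb

section Witt

variable {F ι : Type*} [Field F] [Fintype ι] [DecidableEq ι]

theorem dotProduct_mulVec_of_transpose_mul_eq_one {h : Matrix ι ι F} (hh : hᵀ * h = 1)
    (v w : ι → F) : (h *ᵥ v) ⬝ᵥ (h *ᵥ w) = v ⬝ᵥ w := by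
  rw [dotProduct_mulVec, vecMul_mulVec, hh, vecMul_one]

/-- The reflection in the hyperplane orthogonal to `v`. -/
def reflectionMatrix (v : ι → F) : Matrix ι ι F :=
  1 - (2 / (v ⬝ᵥ v)) • vecMulVec v v

theorem reflectionMatrix_mulVec (v w : ι → F) :
    reflectionMatrix v *ᵥ w = w - (2 / (v ⬝ᵥ v) * (v ⬝ᵥ w)) • v := by
  rw [reflectionMatrix, sub_mulVec, one_mulVec, smul_mulVec, vecMulVec_mulVec, mul_smul]
  simp

theorem transpose_reflectionMatrix_mul_self {v : ι → F} (hv : v ⬝ᵥ v ≠ 0) :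
    (reflectionMatrix v)ᵀ * reflectionMatrix v = 1 := by
  have h : (reflectionMatrix v)ᵀ = reflectionMatrix v := by
    simp [reflectionMatrix, transpose_vecMulVec]
  rw [h]
  refine Matrix.ext_of_mulVec_single fun i => ?_
  rw [← mulVec_mulVec, one_mulVec, reflectionMatrix_mulVec v (Pi.single i 1),
    reflectionMatrix_mulVec]
  simp only [dotProduct_sub, dotProduct_smul, smul_eq_mul]
  rw [sub_sub, ← add_smul, sub_eq_self]
  have : (2 / (v ⬝ᵥ v) * (v ⬝ᵥ Pi.single i 1) + 2 / (v ⬝ᵥ v) *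
      (v ⬝ᵥ Pi.single i 1 - 2 / (v ⬝ᵥ v) * (v ⬝ᵥ Pi.single i 1) * (v ⬝ᵥ v))) = 0 := by
    field_simp
    ring
  rw [this, zero_smul]

/-- Two vectors of the same non-zero norm are exchanged by an orthogonal matrix fixing every vector
orthogonal to both. -/
theorem exists_orthogonal_mulVec_eq (h2 : (2 : F) ≠ 0) {v w : ι → F} (hvw : v ⬝ᵥ v = w ⬝ᵥ w)
    (hw : w ⬝ᵥ w ≠ 0) :
    ∃ h : Matrix ι ι F, hᵀ * h = 1 ∧ h *ᵥ v = w ∧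
      ∀ u, v ⬝ᵥ u = 0 → w ⬝ᵥ u = 0 → h *ᵥ u = u := by
  have hc : w ⬝ᵥ v = v ⬝ᵥ w := dotProduct_comm _ _
  by_cases hs : (v - w) ⬝ᵥ (v - w) = 0
  · have hs' : (v + w) ⬝ᵥ (v + w) = 4 * (w ⬝ᵥ w) := by
      simp only [sub_dotProduct, dotProduct_sub, add_dotProduct, dotProduct_add] at hs ⊢
      linear_combination 2 * hvw - hs
    have h4 : (v + w) ⬝ᵥ (v + w) ≠ 0 := by
      rw [hs']
      have : (4 : F) = 2 * 2 := by norm_num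
      rw [this]
      exact mul_ne_zero (mul_ne_zero h2 h2) hw
    refine ⟨reflectionMatrix w * reflectionMatrix (v + w), ?_, ?_, fun u hu hu' => ?_⟩
    · rw [transpose_mul, Matrix.mul_assoc, ← Matrix.mul_assoc (reflectionMatrix w)ᵀ,
        transpose_reflectionMatrix_mul_self hw, Matrix.one_mul,
        transpose_reflectionMatrix_mul_self h4]
    · have e1 : reflectionMatrix (v + w) *ᵥ v = -w := by
        rw [reflectionMatrix_mulVec]
        have : 2 / ((v + w) ⬝ᵥ (v + w)) * ((v + w) ⬝ᵥ v) = 1 := by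
          rw [div_mul_eq_mul_div, div_eq_one_iff_eq h4]
          simp only [add_dotProduct, dotProduct_add]
          linear_combination hvw + hc
        rw [this]
        simp
      rw [← mulVec_mulVec, e1, reflectionMatrix_mulVec]
      have : 2 / (w ⬝ᵥ w) * (w ⬝ᵥ -w) = -2 := by
        rw [dotProduct_neg]
        field_simp
      rw [this]
      module
    · rw [← mulVec_mulVec, reflectionMatrix_mulVec (v + w), add_dotProduct v w u, hu, hu']
      simp [reflectionMatrix_mulVec, hu']
  · refine ⟨reflectionMatrix (v - w), transpose_reflectionMatrix_mul_self hs, ?_,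
      fun u hu hu' => ?_⟩
    · rw [reflectionMatrix_mulVec]
      have : 2 / ((v - w) ⬝ᵥ (v - w)) * ((v - w) ⬝ᵥ v) = 1 := by
        rw [div_mul_eq_mul_div, div_eq_one_iff_eq hs]
        simp only [sub_dotProduct, dotProduct_sub]
        linear_combination hvw - hc
      rw [this]
      simp
    · rw [reflectionMatrix_mulVec, sub_dotProduct v w u, hu, hu']
      simp

theorem exists_orthogonal_mulVec_family_eq (h2 : (2 : F) ≠ 0) {k : ℕ} (v w : Fin k → ι → F)
    (hvw : ∀ i j, v i ⬝ᵥ v j = w i ⬝ᵥ w j) (ho : ∀ i j, i ≠ j → w i ⬝ᵥ w j = 0)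
    (hw : ∀ i, w i ⬝ᵥ w i ≠ 0) :
    ∃ h : Matrix ι ι F, hᵀ * h = 1 ∧ ∀ i, h *ᵥ v i = w i := by
  induction k with
  | zero => exact ⟨1, by simp, fun i => i.elim0⟩
  | succ k ih =>
    obtain ⟨h, hh, he⟩ := ih (fun i => v i.castSucc) (fun i => w i.castSucc)
      (fun i j => hvw _ _) (fun i j hij => ho _ _ fun h => hij (Fin.castSucc_injective _ h))
      (fun i => hw _)
    obtain ⟨r, hr, hre, hrf⟩ := exists_orthogonal_mulVec_eq h2 (v := h *ᵥ v (Fin.last k))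
      (w := w (Fin.last k))
      (by rw [dotProduct_mulVec_of_transpose_mul_eq_one hh, hvw]) (hw _)
    refine ⟨r * h, ?_, fun i => ?_⟩
    · rw [transpose_mul, Matrix.mul_assoc, ← Matrix.mul_assoc rᵀ, hr, Matrix.one_mul, hh]
    · rw [← mulVec_mulVec]
      induction i using Fin.lastCases with
      | last => exact hre
      | cast i =>
        have hi : w (Fin.last k) ⬝ᵥ w i.castSucc = 0 := ho _ _ (Fin.castSucc_lt_last i).ne'
        rw [he]
        refine hrf _ ?_ hi
        rw [← he i, dotProduct_mulVec_of_transpose_mul_eq_one hh, hvw, hi]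

/-- A form of Witt's extension theorem. -/
theorem exists_orthogonal_mulVec_eq_on (h2 : (2 : F) ≠ 0) (W : Submodule F (ι → F))
    (a b : Matrix ι ι F)
    (hab : ∀ v ∈ W, ∀ w ∈ W, (a *ᵥ v) ⬝ᵥ (a *ᵥ w) = (b *ᵥ v) ⬝ᵥ (b *ᵥ w))
    (hW : ∀ v ∈ W, (∀ w ∈ W, (b *ᵥ v) ⬝ᵥ (b *ᵥ w) = 0) → v = 0) :
    ∃ h : Matrix ι ι F, hᵀ * h = 1 ∧ ∀ v ∈ W, h *ᵥ (a *ᵥ v) = b *ᵥ v := by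
  let f : W →ₗ[F] (ι → F) := b.mulVecLin.comp W.subtype
  let B : LinearMap.BilinForm F W := (dotProductBilin F F).compl₁₂ f f
  have hB : ∀ v w : W, B v w = (b *ᵥ v.1) ⬝ᵥ (b *ᵥ w.1) := fun v w => rfl
  have hs : LinearMap.IsSymm B := ⟨fun v w => by simp [hB, dotProduct_comm]⟩
  have : Invertible (2 : F) := invertibleOfNonzero h2
  obtain ⟨e, he⟩ := LinearMap.BilinForm.exists_orthogonal_basis hs
  have hsep : LinearMap.SeparatingLeft B := fun v hv =>
    Subtype.ext (hW v v.2 fun w hw => hv ⟨w, hw⟩)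
  have hne := he.not_isOrtho_basis_self_of_separatingLeft hsep
  obtain ⟨h, hh, heq⟩ := exists_orthogonal_mulVec_family_eq h2
    (fun i => a *ᵥ (e i).1) (fun i => b *ᵥ (e i).1) (fun i j => hab _ (e i).2 _ (e j).2)
    (fun i j hij => he hij) hne
  refine ⟨h, hh, fun v hv => ?_⟩
  have : (h * a).mulVecLin.comp W.subtype = f := e.ext fun i => by
    simpa [f, mulVec_mulVec] using heq i
  simpa [f, mulVec_mulVec] using LinearMap.congr_fun this ⟨v, hv⟩

end Witt

section Counting

variable {F : Type*} [Field F]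

section
variable [Fintype F]

theorem sum_comp_dotProduct_self_succ (m : ℕ) (f : F → ℤ) :
    ∑ v : Fin (m + 1) → F, f (v ⬝ᵥ v) = ∑ a : F, ∑ v : Fin m → F, f (a ^ 2 + v ⬝ᵥ v) := by
  rw [← (Fin.consEquiv fun _ : Fin (m + 1) => F).sum_comp, Fintype.sum_prod_type]
  refine Finset.sum_congr rfl fun a _ => Finset.sum_congr rfl fun v _ => ?_
  simp [dotProduct, Fin.sum_univ_succ, pow_two]

theorem ringChar_ne_two_of_odd_card (hF : Odd (Fintype.card F)) : ringChar F ≠ 2 := by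
  intro h
  have := FiniteField.even_card_of_char_two h
  rw [Nat.odd_iff] at hF
  omega

variable [DecidableEq F]

theorem sum_comp_sq (hF : ringChar F ≠ 2) (f : F → ℤ) :
    ∑ a : F, f (a ^ 2) = ∑ c : F, (1 + quadraticChar F c) * f c := by
  have h : ∀ c : F, (1 + quadraticChar F c) * f c = ∑ a : F with a ^ 2 = c, f (a ^ 2) := by
    intro c
    rw [Finset.sum_congr rfl (g := fun _ => f c)
      (fun a ha => by rw [(Finset.mem_filter.1 ha).2]), Finset.sum_const, add_comm,
      ← quadraticChar_card_sqrts hF c, nsmul_eq_mul]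
    congr 3
    ext a
    simp
  simp_rw [h]
  exact (Finset.sum_fiberwise _ _ _).symm

theorem sum_quadraticChar_mul_sub (hF : ringChar F ≠ 2) (t : F) :
    ∑ c : F, quadraticChar F c * quadraticChar F (t - c) =
      quadraticChar F (-1) * ((if t = 0 then (Fintype.card F : ℤ) else 0) - 1) := by
  split_ifs with ht
  · subst ht
    have h : ∀ c : F, quadraticChar F c * quadraticChar F (0 - c) =
        quadraticChar F (-1) * (1 - if c = 0 then 1 else 0) := by
      intro c
      split_ifs with hc
      · simp [hc]
      · have := quadraticChar_sq_one hc
        rw [zero_sub, ← neg_one_mul, map_mul]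
        linear_combination quadraticChar F (-1) * this
    rw [Finset.sum_congr rfl fun c _ => h c, ← Finset.mul_sum]
    simp
  · rw [← Equiv.sum_comp (Equiv.mulLeft₀ t ht)
      (fun c => quadraticChar F c * quadraticChar F (t - c))]
    have h := jacobiSum_nontrivial_inv (quadraticChar_ne_one hF)
    rw [(quadraticChar_isQuadratic F).inv, jacobiSum] at h
    rw [zero_sub, mul_neg, mul_one, ← h]
    refine Finset.sum_congr rfl fun c _ => ?_
    have := quadraticChar_sq_one ht
    rw [Equiv.mulLeft₀_apply, show t - t * c = t * (1 - c) by ring, map_mul, map_mul]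
    linear_combination quadraticChar F c * quadraticChar F (1 - c) * this

theorem sum_comp_sq_add_sq (hF : ringChar F ≠ 2) (f : F → ℤ) :
    ∑ a : F, ∑ b : F, f (a ^ 2 + b ^ 2) =
      ((Fintype.card F : ℤ) - quadraticChar F (-1)) * ∑ t, f t
        + Fintype.card F * quadraticChar F (-1) * f 0 := by
  have hs : ∑ c : F, quadraticChar F c = 0 := quadraticChar_sum_zero hF
  have hs' : ∀ t : F, ∑ c : F, quadraticChar F (t - c) = 0 := fun t => by
    rw [← hs]
    exact (Equiv.subLeft t).sum_comp (fun c => quadraticChar F c)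
  have h : ∀ t : F, ∑ c : F, (1 + quadraticChar F c) * (1 + quadraticChar F (t - c)) =
      Fintype.card F +
        quadraticChar F (-1) * ((if t = 0 then (Fintype.card F : ℤ) else 0) - 1) := by
    intro t
    rw [← sum_quadraticChar_mul_sub hF t]
    calc _ = ∑ c : F, ((1 : ℤ) + quadraticChar F c + quadraticChar F (t - c)
          + quadraticChar F c * quadraticChar F (t - c)) :=
          Finset.sum_congr rfl fun c _ => by ring
      _ = _ := by
          rw [Finset.sum_add_distrib, Finset.sum_add_distrib, Finset.sum_add_distrib, hs, hs']
          simp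
  calc ∑ a : F, ∑ b : F, f (a ^ 2 + b ^ 2)
      = ∑ a : F, ∑ d : F, (1 + quadraticChar F d) * f (a ^ 2 + d) :=
        Finset.sum_congr rfl fun a _ => sum_comp_sq hF fun d => f (a ^ 2 + d)
    _ = ∑ c : F, (1 + quadraticChar F c) * ∑ d : F, (1 + quadraticChar F d) * f (c + d) :=
        sum_comp_sq hF fun c => ∑ d : F, (1 + quadraticChar F d) * f (c + d)
    _ = ∑ c : F, ∑ t : F, (1 + quadraticChar F c) * (1 + quadraticChar F (t - c)) * f t := by
        refine Finset.sum_congr rfl fun c _ => ?_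
        rw [Finset.mul_sum, ← (Equiv.subRight c).sum_comp]
        refine Finset.sum_congr rfl fun t _ => ?_
        simp [mul_assoc]
    _ = ∑ t : F, (Fintype.card F +
          quadraticChar F (-1) * ((if t = 0 then (Fintype.card F : ℤ) else 0) - 1)) * f t := by
        rw [Finset.sum_comm]
        refine Finset.sum_congr rfl fun t _ => ?_
        rw [← Finset.sum_mul, h]
    _ = ∑ t : F, (((Fintype.card F : ℤ) - quadraticChar F (-1)) * f t +
          if t = 0 then Fintype.card F * quadraticChar F (-1) * f t else 0) := by
        refine Finset.sum_congr rfl fun t _ => ?_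
        split_ifs <;> ring
    _ = _ := by simp [Finset.sum_add_distrib, Finset.mul_sum]

theorem sum_comp_dotProduct_self_add_two (hF : ringChar F ≠ 2) (m : ℕ) (f : F → ℤ) :
    ∑ v : Fin (m + 2) → F, f (v ⬝ᵥ v) =
      ((Fintype.card F : ℤ) - quadraticChar F (-1)) * (Fintype.card F ^ m * ∑ t, f t)
        + Fintype.card F * quadraticChar F (-1) * ∑ v : Fin m → F, f (v ⬝ᵥ v) := by
  have h : ∀ t : F, ∑ s, f (s + t) = ∑ s, f s := fun t => Equiv.sum_comp (Equiv.addRight t) f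
  calc _ = ∑ a : F, ∑ b : F, ∑ v : Fin m → F, f (a ^ 2 + (b ^ 2 + v ⬝ᵥ v)) := by
        rw [sum_comp_dotProduct_self_succ]
        exact Finset.sum_congr rfl fun a _ =>
          sum_comp_dotProduct_self_succ m (fun t => f (a ^ 2 + t))
    _ = ∑ v : Fin m → F, ∑ a : F, ∑ b : F, f (a ^ 2 + b ^ 2 + v ⬝ᵥ v) := by
        rw [Finset.sum_comm]
        refine Eq.trans (Finset.sum_congr rfl fun b _ => Finset.sum_comm) ?_
        rw [Finset.sum_comm]
        refine Finset.sum_congr rfl fun v _ => ?_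
        rw [Finset.sum_comm]
        simp_rw [add_assoc]
    _ = _ := by
        simp_rw [fun v : Fin m → F => sum_comp_sq_add_sq hF (fun t => f (t + v ⬝ᵥ v)), h]
        rw [Finset.sum_add_distrib, Finset.sum_const, ← Finset.mul_sum]
        simp
        ring

/-- The number of vectors of norm one in `F ^ m`. -/
def sphereCard (F : Type*) [Field F] [Fintype F] [DecidableEq F] (m : ℕ) : ℤ :=
  ∑ v : Fin m → F, if v ⬝ᵥ v = 1 then 1 else 0

theorem sphereCard_add_two (hF : ringChar F ≠ 2) (m : ℕ) :
    sphereCard F (m + 2) = ((Fintype.card F : ℤ) - quadraticChar F (-1)) * Fintype.card F ^ m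
        + Fintype.card F * quadraticChar F (-1) * sphereCard F m := by
  have := sum_comp_dotProduct_self_add_two hF m (fun t => if t = 1 then 1 else 0)
  simpa [sphereCard] using this

theorem sphereCard_one (hF : ringChar F ≠ 2) : sphereCard F 1 = 2 := by
  have := sum_comp_dotProduct_self_succ (F := F) 0 (fun t => if t = 1 then 1 else 0)
  rw [sphereCard, this]
  simp only [dotProduct_of_isEmpty, add_zero, Finset.univ_unique, Finset.sum_singleton]
  rw [sum_comp_sq hF (fun t => if t = 1 then 1 else 0)]
  simp

theorem sphereCard_even (hF : ringChar F ≠ 2) (k : ℕ) :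
    sphereCard F (2 * k + 2) =
      Fintype.card F ^ (2 * k + 1) - quadraticChar F (-1) ^ (k + 1) * Fintype.card F ^ k := by
  induction k with
  | zero =>
    rw [sphereCard_add_two hF]
    simp [sphereCard]
  | succ k ih =>
    rw [sphereCard_add_two hF, mul_add, mul_one, ih]
    ring

theorem sphereCard_odd (hF : ringChar F ≠ 2) (k : ℕ) :
    sphereCard F (2 * k + 1) =
      Fintype.card F ^ (2 * k) + quadraticChar F (-1) ^ k * Fintype.card F ^ k := by
  induction k with
  | zero =>
    rw [sphereCard_one hF]
    norm_num
  | succ k ih =>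
    rw [show 2 * (k + 1) + 1 = 2 * k + 1 + 2 by ring, sphereCard_add_two hF, ih]
    ring

theorem sphereCard_mul_sphereCard (hF : ringChar F ≠ 2) (k : ℕ) :
    sphereCard F (2 * k + 3) * sphereCard F (2 * k + 2) =
      Fintype.card F ^ (2 * k + 1) * ((Fintype.card F : ℤ) ^ (2 * (k + 1)) - 1) := by
  have h : (quadraticChar F (-1)) ^ 2 = 1 := quadraticChar_sq_one (neg_ne_zero.2 one_ne_zero)
  have h' : ((quadraticChar F (-1)) ^ (k + 1)) ^ 2 = 1 := by rw [← pow_mul', pow_mul, h, one_pow]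
  rw [show 2 * k + 3 = 2 * (k + 1) + 1 by ring, sphereCard_odd hF, sphereCard_even hF]
  linear_combination (-(Fintype.card F : ℤ) ^ (2 * k + 1)) * h'

end

/-- The matrices preserving the standard symmetric bilinear form. -/
abbrev OrthogonalMatrix (ι F : Type*) [Field F] [Fintype ι] [DecidableEq ι] :=
  {M : Matrix ι ι F // Mᵀ * M = 1}

/-- The block matrix with blocks `1` and `M`. -/
def oneBlock {m : ℕ} (M : Matrix (Fin m) (Fin m) F) : Matrix (Fin (m + 1)) (Fin (m + 1)) F :=
  Matrix.of (Fin.cons (Fin.cons 1 0) fun i => Fin.cons 0 (M i))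

theorem oneBlock_transpose_mul_self {m : ℕ} {M : Matrix (Fin m) (Fin m) F} (hM : Mᵀ * M = 1) :
    (oneBlock M)ᵀ * oneBlock M = 1 := by
  ext i j
  have h := fun i j => congrFun (congrFun hM i) j
  simp only [mul_apply, transpose_apply] at h
  refine Fin.cases ?_ (fun i => ?_) i <;> refine Fin.cases ?_ (fun j => ?_) j <;>
    simp [mul_apply, oneBlock, Fin.sum_univ_succ, h, one_apply, Fin.succ_ne_zero,
      (Fin.succ_ne_zero _).symm]

theorem oneBlock_mulVec_single {m : ℕ} (M : Matrix (Fin m) (Fin m) F) :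
    oneBlock M *ᵥ Pi.single 0 1 = Pi.single 0 1 := by
  ext i
  refine Fin.cases ?_ (fun i => ?_) i <;> simp [oneBlock]

theorem exists_oneBlock_eq {m : ℕ} {X : Matrix (Fin (m + 1)) (Fin (m + 1)) F} (hX : Xᵀ * X = 1)
    (h : X *ᵥ Pi.single 0 1 = Pi.single 0 1) :
    ∃ M : Matrix (Fin m) (Fin m) F, Mᵀ * M = 1 ∧ oneBlock M = X := by
  have hc : ∀ i, X i 0 = (Pi.single 0 1 : Fin (m + 1) → F) i := fun i => by
    simpa using congrFun h i
  have h' : Xᵀ *ᵥ Pi.single 0 1 = Pi.single 0 1 := by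
    conv_lhs => rw [← h]
    rw [mulVec_mulVec, hX, one_mulVec]
  have hr : ∀ j, X 0 j = (Pi.single 0 1 : Fin (m + 1) → F) j := fun j => by
    simpa using congrFun h' j
  refine ⟨X.submatrix Fin.succ Fin.succ, ?_, ?_⟩
  · ext i j
    have := congrFun (congrFun hX i.succ) j.succ
    simpa [mul_apply, Fin.sum_univ_succ, hr, one_apply] using this
  · ext i j
    refine Fin.cases ?_ (fun i => ?_) i <;> refine Fin.cases ?_ (fun j => ?_) j <;>
      simp [oneBlock, hr, hc]

theorem oneBlock_injective {m : ℕ} :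
    Function.Injective (oneBlock : Matrix (Fin m) (Fin m) F → _) := fun M N h => by
  ext i j
  simpa [oneBlock] using congrFun (congrFun h i.succ) j.succ

variable [Fintype F]

theorem card_orthogonalMatrix_succ [DecidableEq F] (hF : ringChar F ≠ 2) (m : ℕ) :
    (Nat.card (OrthogonalMatrix (Fin (m + 1)) F) : ℤ) =
      sphereCard F (m + 1) * Nat.card (OrthogonalMatrix (Fin m) F) := by
  have h2 : (2 : F) ≠ 0 := Ring.two_ne_zero hF
  have key : ∀ u : {v : Fin (m + 1) → F // v ⬝ᵥ v = 1},
      ∃ h : Matrix (Fin (m + 1)) (Fin (m + 1)) F, hᵀ * h = 1 ∧ h *ᵥ Pi.single 0 1 = u.1 := by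
    rintro ⟨u, hu⟩
    obtain ⟨h, hh, he, -⟩ := exists_orthogonal_mulVec_eq h2 (v := Pi.single 0 1) (w := u)
      (by simp [hu]) (by simp [hu])
    exact ⟨h, hh, he⟩
  choose h hh he using key
  let f : {v : Fin (m + 1) → F // v ⬝ᵥ v = 1} × OrthogonalMatrix (Fin m) F →
      OrthogonalMatrix (Fin (m + 1)) F := fun x => ⟨h x.1 * oneBlock x.2.1, by
    rw [transpose_mul, Matrix.mul_assoc, ← Matrix.mul_assoc (h x.1)ᵀ, hh, Matrix.one_mul,
      oneBlock_transpose_mul_self x.2.2]⟩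
  have hfe : ∀ x, (f x).1 *ᵥ Pi.single 0 1 = x.1.1 := fun x => by
    rw [← mulVec_mulVec, oneBlock_mulVec_single, he]
  have hf : Function.Bijective f := by
    constructor
    · rintro ⟨u, M⟩ ⟨v, N⟩ hx
      have huv : u = v := Subtype.ext (by rw [← hfe (u, M), hx, hfe])
      subst huv
      have hMN := congrArg (fun X => (h u)ᵀ * X) (congrArg Subtype.val hx)
      simp only [f, ← Matrix.mul_assoc, hh, Matrix.one_mul] at hMN
      rw [Subtype.ext (oneBlock_injective hMN)]
    · rintro ⟨X, hX⟩
      let u : {v : Fin (m + 1) → F // v ⬝ᵥ v = 1} := ⟨X *ᵥ Pi.single 0 1, by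
        rw [dotProduct_mulVec_of_transpose_mul_eq_one hX]; simp⟩
      have hh' : h u * (h u)ᵀ = 1 := mul_eq_one_comm.1 (hh u)
      obtain ⟨M, hM, hMX⟩ := exists_oneBlock_eq (X := (h u)ᵀ * X)
        (by rw [transpose_mul, transpose_transpose, Matrix.mul_assoc, ← Matrix.mul_assoc (h u), hh',
            Matrix.one_mul, hX])
        (by rw [← mulVec_mulVec, show X *ᵥ Pi.single 0 1 = u.1 from rfl, ← he, mulVec_mulVec, hh,
            one_mulVec])
      refine ⟨(u, ⟨M, hM⟩), Subtype.ext ?_⟩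
      simp only [f]
      rw [hMX, ← Matrix.mul_assoc, hh', Matrix.one_mul]
  rw [← Nat.card_eq_of_bijective f hf, Nat.card_prod, Nat.cast_mul, sphereCard,
    Nat.card_eq_fintype_card, Fintype.card_subtype, Finset.sum_boole]

theorem card_orthogonalMatrix_odd (hF : ringChar F ≠ 2) (n : ℕ) :
    Nat.card (OrthogonalMatrix (Fin (2 * n + 1)) F) =
      2 * Fintype.card F ^ (n ^ 2) *
        ∏ k ∈ Finset.range n, (Fintype.card F ^ (2 * (k + 1)) - 1) := by
  classical
  have h : (Nat.card (OrthogonalMatrix (Fin (2 * n + 1)) F) : ℤ) =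
      2 * Fintype.card F ^ (n ^ 2) *
        ∏ k ∈ Finset.range n, ((Fintype.card F : ℤ) ^ (2 * (k + 1)) - 1) := by
    induction n with
    | zero =>
      have : Nat.card (OrthogonalMatrix (Fin 0) F) = 1 :=
        Nat.card_eq_one_iff_unique.2 ⟨inferInstance, ⟨⟨1, by simp⟩⟩⟩
      rw [card_orthogonalMatrix_succ hF, this, mul_zero, zero_add, sphereCard_one hF]
      simp
    | succ n ih =>
      rw [show 2 * (n + 1) + 1 = 2 * n + 2 + 1 by ring, card_orthogonalMatrix_succ hF,
        card_orthogonalMatrix_succ hF, ih, Finset.prod_range_succ, ← mul_assoc,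
        sphereCard_mul_sphereCard hF]
      ring
  have hk : ∀ k, ((Fintype.card F ^ (2 * (k + 1)) - 1 : ℕ) : ℤ) =
      (Fintype.card F : ℤ) ^ (2 * (k + 1)) - 1 := fun k => by
    rw [Nat.cast_sub (Nat.one_le_pow _ _ Fintype.card_pos)]
    simp
  zify
  simp_rw [hk]
  exact h

theorem card_GL_odd (n : ℕ) :
    ∃ a, Nat.card (GL (Fin (2 * n + 1)) F) =
      (Fintype.card F ^ a * ∏ k ∈ Finset.range (n + 1), (Fintype.card F ^ (2 * k + 1) - 1)) *
        ∏ k ∈ Finset.range n, (Fintype.card F ^ (2 * (k + 1)) - 1) := by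
  set q := Fintype.card F
  have h1 : ∀ m, ∃ a, ∏ i ∈ Finset.range m, (q ^ m - q ^ i) =
      q ^ a * ∏ i ∈ Finset.range m, (q ^ (i + 1) - 1) := by
    intro m
    refine ⟨∑ i ∈ Finset.range m, i, ?_⟩
    rw [← Finset.prod_pow_eq_pow_sum, ← Finset.prod_range_reflect (fun i => q ^ (i + 1) - 1),
      ← Finset.prod_mul_distrib]
    refine Finset.prod_congr rfl fun i hi => ?_
    have := Finset.mem_range.1 hi
    rw [Nat.mul_sub, ← pow_add, mul_one]
    congr 2
    omega
  have h2 : ∏ i ∈ Finset.range (2 * n + 1), (q ^ (i + 1) - 1) =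
      (∏ k ∈ Finset.range (n + 1), (q ^ (2 * k + 1) - 1)) *
        ∏ k ∈ Finset.range n, (q ^ (2 * (k + 1)) - 1) := by
    clear_value q
    induction n with
    | zero => simp
    | succ n ih =>
      rw [show 2 * (n + 1) + 1 = 2 * n + 1 + 1 + 1 by ring, Finset.prod_range_succ,
        Finset.prod_range_succ, ih, Finset.prod_range_succ _ (n + 1),
        Finset.prod_range_succ (fun k => q ^ (2 * (k + 1)) - 1) n,
        show 2 * (n + 1) = 2 * n + 1 + 1 by ring]
      ring
  obtain ⟨a, ha⟩ := h1 (2 * n + 1)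
  refine ⟨a, ?_⟩
  rw [card_GL_field, Fin.prod_univ_eq_prod_range (fun i => q ^ (2 * n + 1) - q ^ i), ha, h2]
  ring

end Counting

section Average

theorem Subgroup.natCast_card_ne_zero {F G : Type*} [Field F] [Group G] {N : Subgroup G}
    (hG : (Nat.card G : F) ≠ 0) : (Nat.card N : F) ≠ 0 := by
  intro h
  apply hG
  obtain ⟨k, hk⟩ := N.card_subgroup_dvd_card
  rw [hk, Nat.cast_mul, h, zero_mul]

variable {F ι G : Type*} [Field F] [Fintype ι] [DecidableEq ι] [Group G] [Fintype G]

open scoped Classical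

/-- The projection onto the vectors fixed by `N`. -/
noncomputable def subgroupAverage (ρ : G →* Matrix ι ι F) (N : Subgroup G) : Matrix ι ι F :=
  (Nat.card N : F)⁻¹ • ∑ x : N, ρ x

variable (ρ : G →* Matrix ι ι F) (N : Subgroup G)

theorem mul_subgroupAverage {x : G} (hx : x ∈ N) :
    ρ x * subgroupAverage ρ N = subgroupAverage ρ N := by
  rw [subgroupAverage, Matrix.mul_smul, Finset.mul_sum,
    ← Equiv.sum_comp (Equiv.mulLeft (⟨x, hx⟩ : N)) (fun y : N => ρ y)]
  simp

theorem subgroupAverage_mul {x : G} (hx : x ∈ N) :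
    subgroupAverage ρ N * ρ x = subgroupAverage ρ N := by
  rw [subgroupAverage, Matrix.smul_mul, Finset.sum_mul,
    ← Equiv.sum_comp (Equiv.mulRight (⟨x, hx⟩ : N)) (fun y : N => ρ y)]
  simp

theorem commute_subgroupAverage {A : Matrix ι ι F} (hA : ∀ x ∈ N, Commute A (ρ x)) :
    Commute A (subgroupAverage ρ N) :=
  (Commute.sum_right _ _ _ fun (x : N) _ => hA x x.2).smul_right _

theorem map_commute_subgroupAverage [N.Normal] (g : G) : Commute (ρ g) (subgroupAverage ρ N) := by
  refine Commute.smul_right ?_ _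
  rw [commute_iff_eq, Finset.mul_sum, Finset.sum_mul,
    ← Equiv.sum_comp (MulAut.conjNormal g).toEquiv (fun y : N => ρ y * ρ g)]
  refine Finset.sum_congr rfl fun x _ => ?_
  simp [← map_mul]

theorem transpose_subgroupAverage (hρ : ∀ x, (ρ x)ᵀ = ρ x⁻¹) :
    (subgroupAverage ρ N)ᵀ = subgroupAverage ρ N := by
  rw [subgroupAverage, transpose_smul, transpose_sum,
    ← Equiv.sum_comp (Equiv.inv N) (fun y : N => ρ y)]
  simp [hρ]

theorem map_mul_subgroupAverage_eq {x y : G} [N.Normal] (h : (x : G ⧸ N) = y) :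
    ρ x * subgroupAverage ρ N = ρ y * subgroupAverage ρ N := by
  conv_lhs => rw [← mul_subgroupAverage ρ N (QuotientGroup.eq.1 h), ← Matrix.mul_assoc, ← map_mul,
    mul_inv_cancel_left]

theorem subgroupAverage_bot : subgroupAverage ρ ⊥ = 1 := by
  simp only [subgroupAverage, Subgroup.card_bot, Nat.cast_one, inv_one, one_smul,
    Finset.univ_unique, Finset.sum_singleton]
  exact map_one ρ

theorem subgroupAverage_mulVec_eq_self (hG : (Nat.card G : F) ≠ 0) {v : ι → F}
    (hv : ∀ x ∈ N, ρ x *ᵥ v = v) :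
    subgroupAverage ρ N *ᵥ v = v := by
  have h := Subgroup.natCast_card_ne_zero (N := N) hG
  rw [subgroupAverage, smul_mulVec, sum_mulVec, Finset.sum_congr rfl fun x _ => hv x.1 x.2,
    Finset.sum_const, Finset.card_univ, ← Nat.card_eq_fintype_card, ← Nat.cast_smul_eq_nsmul F,
    smul_smul, inv_mul_cancel₀ h, one_smul]

theorem subgroupAverage_mul_eq_self (hG : (Nat.card G : F) ≠ 0) {B : Matrix ι ι F}
    (hB : ∀ x ∈ N, ρ x * B = B) :
    subgroupAverage ρ N * B = B := by
  refine Matrix.ext_of_mulVec_single fun i => ?_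
  rw [← mulVec_mulVec]
  refine subgroupAverage_mulVec_eq_self ρ N hG fun x hx => ?_
  rw [mulVec_mulVec, hB x hx]

theorem subgroupAverage_mul_subgroupAverage (hG : (Nat.card G : F) ≠ 0) {N N' : Subgroup G}
    (h : N ≤ N') :
    subgroupAverage ρ N * subgroupAverage ρ N' = subgroupAverage ρ N' :=
  subgroupAverage_mul_eq_self ρ N hG fun _ hx => mul_subgroupAverage ρ N' (h hx)

theorem subgroupAverage_mul_subgroupAverage' (hG : (Nat.card G : F) ≠ 0)
    (hρ : ∀ x, (ρ x)ᵀ = ρ x⁻¹) {N N' : Subgroup G} (h : N ≤ N') :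
    subgroupAverage ρ N' * subgroupAverage ρ N = subgroupAverage ρ N' := by
  have := congrArg transpose (subgroupAverage_mul_subgroupAverage ρ hG h)
  rwa [transpose_mul, transpose_subgroupAverage ρ _ hρ, transpose_subgroupAverage ρ _ hρ] at this

end Average

section HermitianSquare

variable {F ι : Type*} [Field F] [Finite F] [Fintype ι] [DecidableEq ι]

/-- In the algebra generated by a symmetric matrix `A`, a symmetric idempotent `f` and an
antisymmetric matrix `s` invertible on the image of `f`, all commuting, the matrix `A` is a
hermitian square on the image of `f`. -/
theorem exists_transpose_mul_self_eq_mul (h2 : (2 : F) ≠ 0) {A f s : Matrix ι ι F} (hA : Aᵀ = A)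
    (hAu : IsUnit A) (hf : fᵀ = f) (hff : f * f = f) (hs : sᵀ = -s) (hsf : s * f = s)
    (hAf : Commute A f) (hAs : Commute A s) (hfs : Commute f s)
    (hinj : ∀ v, s *ᵥ v = 0 → f *ᵥ v = v → v = 0) :
    ∃ c ∈ Algebra.adjoin F {A, f, s}, cᵀ * c = A * f ∧ c * f = c := by
  let R := Algebra.adjoin F ({A, f, s} : Set (Matrix ι ι F))
  have hgen : ∀ a ∈ ({A, f, s} : Set (Matrix ι ι F)), ∀ b ∈ ({A, f, s} : Set (Matrix ι ι F)),
      a * b = b * a := by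
    rintro a (rfl | rfl | rfl) b (rfl | rfl | rfl) <;>
      first | rfl | assumption | (apply Commute.symm; assumption)
  have := Algebra.isMulCommutative_adjoin F hgen
  let _ : CommRing R :=
    { (inferInstance : Ring R) with mul_comm := this.is_comm.comm }
  have hcomm : ∀ a ∈ R, ∀ b ∈ R, a * b = b * a := fun a ha b hb =>
    congrArg Subtype.val (mul_comm (⟨a, ha⟩ : R) ⟨b, hb⟩)
  have hAR : A ∈ R := Algebra.subset_adjoin (by simp)
  have hfR : f ∈ R := Algebra.subset_adjoin (by simp)
  have hsR : s ∈ R := Algebra.subset_adjoin (by simp)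
  let R₀ : Subring (Matrix ι ι F) :=
    { carrier := {r | r ∈ R ∧ rᵀ = r}
      mul_mem' := fun {a b} ha hb => ⟨mul_mem ha.1 hb.1, by
        rw [transpose_mul, ha.2, hb.2, hcomm _ hb.1 _ ha.1]⟩
      one_mem' := ⟨one_mem _, transpose_one⟩
      add_mem' := fun {a b} ha hb => ⟨add_mem ha.1 hb.1, by rw [transpose_add, ha.2, hb.2]⟩
      zero_mem' := ⟨zero_mem _, transpose_zero⟩
      neg_mem' := fun {a} ha => ⟨neg_mem ha.1, by rw [transpose_neg, ha.2]⟩ }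
  let _ : CommRing R₀ :=
    { (inferInstance : Ring R₀) with
      mul_comm := fun a b => Subtype.ext (hcomm _ a.2.1 _ b.2.1) }
  have hunit : ∀ a : R₀, IsUnit a.1 → IsUnit a := fun a ha => by
    obtain ⟨u, hu⟩ := ha
    obtain ⟨k, hk, hk'⟩ := isOfFinOrder_iff_pow_eq_one.1 (isOfFinOrder_of_finite u)
    refine IsUnit.of_pow_eq_one (Subtype.ext ?_) hk.ne'
    change a.1 ^ k = 1
    rw [← hu, ← Units.val_pow_eq_pow_val, hk', Units.val_one]
  let δ : Matrix ι ι F := s * s + (1 - f)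
  have hδR : δ ∈ R := add_mem (mul_mem hsR hsR) (sub_mem (one_mem _) hfR)
  have hδT : δᵀ = δ := by simp [δ, hs, hf]
  have hδu : IsUnit δ := by
    rw [← mulVec_injective_iff_isUnit, ← coe_mulVecLin, ← LinearMap.ker_eq_bot,
      LinearMap.ker_eq_bot']
    intro v hv
    rw [mulVecLin_apply] at hv
    have hfs' : f * s = s := by rw [hfs.eq, hsf]
    have h1 : (1 - f) *ᵥ v = 0 := by
      have : (1 - f) * δ = 1 - f := by
        simp only [δ, mul_add, sub_mul, mul_sub, one_mul, mul_one, hff, ← mul_assoc, hfs']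
        abel
      rw [← this, ← mulVec_mulVec, hv, mulVec_zero]
    have h2 : s *ᵥ (s *ᵥ v) = 0 := by
      have : f * δ = s * s := by
        simp only [δ, mul_add, mul_sub, mul_one, hff, ← mul_assoc, hfs']
        abel
      rw [mulVec_mulVec, ← this, ← mulVec_mulVec, hv, mulVec_zero]
    refine hinj v (hinj _ h2 ?_) ?_
    · rw [mulVec_mulVec, hfs']
    · rw [sub_mulVec, one_mulVec, sub_eq_zero] at h1
      exact h1.symm
  have h2u : IsUnit (2 : R₀) := hunit 2 <| by
    have : ((2 : R₀) : Matrix ι ι F) = algebraMap F _ 2 := by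
      rw [map_ofNat]; rfl
    rw [this]
    exact (isUnit_iff_ne_zero.2 h2).map _
  obtain ⟨⟨x, hxR, hx⟩, ⟨y, hyR, hy⟩, hxy⟩ := exists_sq_sub_mul_sq_eq h2u
    (a := ⟨A, hAR, hA⟩) (d := ⟨δ, hδR, hδT⟩) (hunit _ hAu) (hunit _ hδu)
  have hxy' : (⟨x, hxR⟩ : R) ^ 2 - ⟨δ, hδR⟩ * (⟨y, hyR⟩ : R) ^ 2 = ⟨A, hAR⟩ :=
    Subtype.ext (congrArg (fun r : R₀ => r.1) hxy)
  have hδ' : (⟨δ, hδR⟩ : R) = ⟨s, hsR⟩ * ⟨s, hsR⟩ + (1 - ⟨f, hfR⟩) := rfl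
  have hff' : (⟨f, hfR⟩ : R) * ⟨f, hfR⟩ = ⟨f, hfR⟩ := Subtype.ext hff
  have hT : ((x + s * y) * f)ᵀ = f * (x - s * y) := by
    rw [transpose_mul, transpose_add, transpose_mul, hf, hx, hy, hs, hcomm s hsR y hyR, mul_neg,
      sub_eq_add_neg]
  refine ⟨(x + s * y) * f, mul_mem (add_mem hxR (mul_mem hsR hyR)) hfR, ?_, by
    rw [mul_assoc, hff]⟩
  rw [hT]
  refine congrArg Subtype.val (?_ : (⟨f, hfR⟩ * (⟨x, hxR⟩ - ⟨s, hsR⟩ * ⟨y, hyR⟩)) *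
    ((⟨x, hxR⟩ + ⟨s, hsR⟩ * ⟨y, hyR⟩) * ⟨f, hfR⟩) = (⟨A, hAR⟩ : R) * ⟨f, hfR⟩)
  rw [hδ'] at hxy'
  generalize (⟨f, hfR⟩ : R) = f at *
  generalize (⟨x, hxR⟩ : R) = x at *
  generalize (⟨y, hyR⟩ : R) = y at *
  generalize (⟨s, hsR⟩ : R) = s at *
  generalize (⟨A, hAR⟩ : R) = A at *
  linear_combination f * hxy' + (x ^ 2 - s ^ 2 * y ^ 2 - y ^ 2) * hff'

end HermitianSquare

section PGroup

variable {F ι G : Type*} [Field F] [Finite F] [Fintype ι] [DecidableEq ι] [Group G] [Fintype G]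

theorem exists_transpose_mul_self_eq_mul_sub (h2 : (2 : F) ≠ 0) (hG : (Nat.card G : F) ≠ 0)
    (hodd : Odd (Nat.card G)) (ρ : G →* Matrix ι ι F) (hρ : ∀ x, (ρ x)ᵀ = ρ x⁻¹)
    {A : Matrix ι ι F} (hA : Aᵀ = A) (hAu : IsUnit A) (hAρ : ∀ x, Commute A (ρ x))
    {N N' : Subgroup G} [N.Normal] [N'.Normal] (hN : N ≤ N') {z : G}
    (hz : (z : G ⧸ N) ∈ Subgroup.center (G ⧸ N))
    (hN' : ∀ x ∈ N', ∃ k : ℤ, (z ^ k)⁻¹ * x ∈ N) :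
    ∃ c, (∀ x, Commute c (ρ x)) ∧
      cᵀ * c = A * (subgroupAverage ρ N - subgroupAverage ρ N') ∧
      c * (subgroupAverage ρ N - subgroupAverage ρ N') = c := by
  set e := subgroupAverage ρ N with he
  set e' := subgroupAverage ρ N' with he'
  have hee : e * e = e := subgroupAverage_mul_subgroupAverage ρ hG le_rfl
  have hee' : e * e' = e' := subgroupAverage_mul_subgroupAverage ρ hG hN
  have he'e : e' * e = e' := subgroupAverage_mul_subgroupAverage' ρ hG hρ hN
  have he'e' : e' * e' = e' := subgroupAverage_mul_subgroupAverage ρ hG le_rfl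
  have hef : e * (e - e') = e - e' := by rw [mul_sub, hee, hee']
  have hff : (e - e') * (e - e') = e - e' := by
    rw [sub_mul, hef, mul_sub, he'e, he'e', sub_self, sub_zero]
  have hfρ : ∀ g, Commute (ρ g) (e - e') := fun g =>
    (map_commute_subgroupAverage ρ N g).sub_right (map_commute_subgroupAverage ρ N' g)
  have hAf : Commute A (e - e') :=
    (commute_subgroupAverage ρ N fun x _ => hAρ x).sub_right
      (commute_subgroupAverage ρ N' fun x _ => hAρ x)
  have hft : (e - e')ᵀ = e - e' := by
    rw [transpose_sub, transpose_subgroupAverage ρ _ hρ, transpose_subgroupAverage ρ _ hρ]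
  have hcentral : ∀ w : G, (w : G ⧸ N) ∈ Subgroup.center (G ⧸ N) → ∀ g,
      Commute (ρ w * (e - e')) (ρ g) := fun w hw g => by
    have h := map_mul_subgroupAverage_eq ρ N (x := w * g) (y := g * w)
      (by rw [QuotientGroup.mk_mul, QuotientGroup.mk_mul, Subgroup.mem_center_iff.1 hw])
    have h' := congrArg (fun X => X * (e - e')) h
    simp only [mul_assoc, ← he, hef, map_mul] at h'
    rw [commute_iff_eq, mul_assoc, ← (hfρ g).eq, h']
  have hz' : ((z⁻¹ : G) : G ⧸ N) ∈ Subgroup.center (G ⧸ N) := inv_mem hz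
  set f := e - e' with hf
  have hinj : ∀ v, ((ρ z - ρ z⁻¹) * f) *ᵥ v = 0 → f *ᵥ v = v → v = 0 := fun v hv hfv => by
    rw [← mulVec_mulVec, hfv, sub_mulVec, sub_eq_zero] at hv
    have hsq : ρ (z ^ 2) *ᵥ v = v := by
      rw [pow_two, map_mul, ← mulVec_mulVec, hv, mulVec_mulVec, ← map_mul]
      simp
    have hpow : ∀ (g : G), ρ g *ᵥ v = v → ∀ k : ℕ, ρ (g ^ k) *ᵥ v = v := fun g hg k => by
      induction k with
      | zero => simp
      | succ k ih => rw [pow_succ, map_mul, ← mulVec_mulVec, hg, ih]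
    have hinv : ∀ g : G, ρ g *ᵥ v = v → ρ g⁻¹ *ᵥ v = v := fun g hg => by
      conv_lhs => rw [← hg]
      rw [mulVec_mulVec, ← map_mul]
      simp
    have hz1 : ρ z *ᵥ v = v := by
      obtain ⟨k, hk⟩ := hodd
      have : z = ((z ^ 2) ^ k)⁻¹ := by
        rw [eq_inv_iff_mul_eq_one, ← pow_mul, ← pow_succ', ← hk, pow_card_eq_one']
      rw [this]
      exact hinv _ (hpow _ hsq k)
    have hzk : ∀ k : ℤ, ρ (z ^ k) *ᵥ v = v := fun k => by
      obtain ⟨m, rfl | rfl⟩ := k.eq_nat_or_neg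
      · rw [zpow_natCast]
        exact hpow z hz1 m
      · rw [_root_.zpow_neg, zpow_natCast]
        exact hinv _ (hpow z hz1 m)
    have hev : e *ᵥ v = v := by rw [← hfv, mulVec_mulVec, hef]
    have hNv : ∀ x ∈ N, ρ x *ᵥ v = v := fun x hx => by
      conv_lhs => rw [← hev, mulVec_mulVec, mul_subgroupAverage ρ N hx, ← he, hev]
    have he'v : e' *ᵥ v = v := subgroupAverage_mulVec_eq_self ρ N' hG fun x hx => by
      obtain ⟨k, hk⟩ := hN' x hx
      have : x = z ^ k * ((z ^ k)⁻¹ * x) := by simp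
      rw [this, map_mul, ← mulVec_mulVec, hNv _ hk, hzk]
    rw [← hfv, hf, sub_mulVec, hev, he'v, sub_self]
  have hAz : Commute A (ρ z - ρ z⁻¹) := (hAρ z).sub_right (hAρ z⁻¹)
  have hfz : Commute f (ρ z - ρ z⁻¹) := ((hfρ z).sub_left (hfρ z⁻¹)).symm
  obtain ⟨c, hc, hcc, hcf⟩ := exists_transpose_mul_self_eq_mul h2 (f := f)
    (s := (ρ z - ρ z⁻¹) * f) hA hAu hft hff
    (by rw [transpose_mul, hft, transpose_sub, hρ, hρ, inv_inv, ← neg_sub, mul_neg, hfz.eq])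
    (by rw [mul_assoc, hff]) hAf (hAz.mul_right hAf) (hfz.mul_right (Commute.refl f)) hinj
  refine ⟨c, fun g => ?_, hcc, hcf⟩
  have hle : Algebra.adjoin F {A, f, (ρ z - ρ z⁻¹) * f} ≤ Subalgebra.centralizer F {ρ g} := by
    rw [Algebra.adjoin_le_iff]
    rintro a (rfl | rfl | rfl) b rfl
    · exact (hAρ g).symm
    · exact hfρ g
    · rw [sub_mul]
      exact ((hcentral z hz g).sub_left (hcentral _ hz' g)).symm
  exact (hle hc (ρ g) rfl).symm

/-- For a representation of an odd `p`-group by orthogonal matrices, a symmetric invertible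
commuting matrix is a hermitian square off the fixed vectors. -/
theorem IsPGroup.exists_transpose_mul_self_eq {p : ℕ} [Fact p.Prime] (hp : IsPGroup p G)
    (h2 : (2 : F) ≠ 0) (hG : (Nat.card G : F) ≠ 0)
    (hodd : Odd (Nat.card G)) (ρ : G →* Matrix ι ι F) (hρ : ∀ x, (ρ x)ᵀ = ρ x⁻¹)
    {A : Matrix ι ι F} (hA : Aᵀ = A) (hAu : IsUnit A) (hAρ : ∀ x, Commute A (ρ x)) :
    ∃ c, (∀ x, Commute c (ρ x)) ∧ cᵀ * c = A * (1 - subgroupAverage ρ ⊤) ∧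
      c * subgroupAverage ρ ⊤ = 0 := by
  suffices h : ∀ N : Subgroup G, N.Normal → (∃ c, (∀ x, Commute c (ρ x)) ∧
      cᵀ * c = A * (1 - subgroupAverage ρ N) ∧ c * subgroupAverage ρ N = 0) →
      ∃ c, (∀ x, Commute c (ρ x)) ∧ cᵀ * c = A * (1 - subgroupAverage ρ ⊤) ∧
        c * subgroupAverage ρ ⊤ = 0 from
    h ⊥ inferInstance ⟨0, by simp, by simp [subgroupAverage_bot], by simp⟩
  intro N
  induction N using WellFoundedGT.induction with
  | ind N ih =>
    intro hN hc
    by_cases htop : N = ⊤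
    · rwa [← htop]
    have : Nontrivial (G ⧸ N) := QuotientGroup.nontrivial_iff.2 htop
    have := (hp.to_quotient N).center_nontrivial
    obtain ⟨⟨zb, hzb⟩, hne⟩ := exists_ne (1 : Subgroup.center (G ⧸ N))
    obtain ⟨z, rfl⟩ := QuotientGroup.mk_surjective zb
    have hzN : z ∉ N := fun h => hne (Subtype.ext ((QuotientGroup.eq_one_iff z).2 h))
    let N' : Subgroup G := (Subgroup.zpowers (z : G ⧸ N)).comap (QuotientGroup.mk' N)
    have hzn : (Subgroup.zpowers (z : G ⧸ N)).Normal :=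
      ⟨fun x hx g => by
        rwa [Subgroup.mem_center_iff.1 (Subgroup.zpowers_le.2 hzb hx) g, mul_inv_cancel_right]⟩
    have hN'n : N'.Normal := hzn.comap _
    have hzN' : z ∈ N' := Subgroup.mem_zpowers (z : G ⧸ N)
    have hNN' : N ≤ N' := fun x hx => by
      change (x : G ⧸ N) ∈ Subgroup.zpowers (z : G ⧸ N)
      rw [(QuotientGroup.eq_one_iff x).2 hx]
      exact one_mem _
    obtain ⟨c, hcρ, hcc, hce⟩ := hc
    obtain ⟨d, hdρ, hdd, hde⟩ := exists_transpose_mul_self_eq_mul_sub h2 hG hodd ρ hρ hA hAu hAρ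
      hNN' hzb (by
        rintro x ⟨k, hk⟩
        exact ⟨k, QuotientGroup.eq.1 (by simpa using hk)⟩)
    have hee : subgroupAverage ρ N * subgroupAverage ρ N = subgroupAverage ρ N :=
      subgroupAverage_mul_subgroupAverage ρ hG le_rfl
    have hee' : subgroupAverage ρ N * subgroupAverage ρ N' = subgroupAverage ρ N' :=
      subgroupAverage_mul_subgroupAverage ρ hG hNN'
    have he'e : subgroupAverage ρ N' * subgroupAverage ρ N = subgroupAverage ρ N' :=
      subgroupAverage_mul_subgroupAverage' ρ hG hρ hNN'
    have he'e' : subgroupAverage ρ N' * subgroupAverage ρ N' = subgroupAverage ρ N' :=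
      subgroupAverage_mul_subgroupAverage ρ hG le_rfl
    have hec : subgroupAverage ρ N * c = c * subgroupAverage ρ N :=
      (commute_subgroupAverage ρ N fun x _ => hcρ x).symm.eq
    have hed : subgroupAverage ρ N * d = d := by
      rw [← (commute_subgroupAverage ρ N fun x _ => hdρ x).eq]
      conv_lhs => rw [← hde, mul_assoc, sub_mul, hee, he'e, hde]
    refine ih N' (lt_of_le_of_ne hNN' fun h => hzN (h ▸ hzN')) hN'n
      ⟨c + d, fun x => (hcρ x).add_left (hdρ x), ?_, ?_⟩
    · have hcd : cᵀ * d = 0 := by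
        rw [← hed, ← mul_assoc, ← transpose_subgroupAverage ρ N hρ, ← transpose_mul, hec, hce,
          transpose_zero, zero_mul]
      have hdc : dᵀ * c = 0 := by
        rw [← transpose_transpose c, ← transpose_mul, hcd, transpose_zero]
      rw [transpose_add, add_mul, mul_add, mul_add, hcc, hdd, hcd, hdc, add_zero, zero_add,
        ← mul_add, sub_add_sub_cancel]
    · conv_lhs => rw [add_mul, ← hee', ← mul_assoc, hce, zero_mul, zero_add, hee', ← hde,
        mul_assoc, sub_mul, hee', he'e', sub_self, mul_zero]

end PGroup

section Fusion

variable {F ι : Type*} [Field F] [Finite F] [Fintype ι] [DecidableEq ι]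

/-- Two orthogonal representations of an odd `p`-group that are equivalent over a finite field
are equivalent by an orthogonal matrix. -/
theorem IsPGroup.exists_orthogonal_intertwiner {G : Type*} [Group G] [Finite G] {p : ℕ}
    [Fact p.Prime] (hp : IsPGroup p G) (h2 : (2 : F) ≠ 0) (hG : (Nat.card G : F) ≠ 0)
    (hodd : Odd (Nat.card G)) {ρ σ : G →* Matrix ι ι F} (hρ : ∀ x, (ρ x)ᵀ = ρ x⁻¹)
    (hσ : ∀ x, (σ x)ᵀ = σ x⁻¹) {g g' : Matrix ι ι F} (hgg' : g * g' = 1)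
    (hg : ∀ x, σ x * g = g * ρ x) :
    ∃ h : Matrix ι ι F, hᵀ * h = 1 ∧ ∀ x, h * ρ x = σ x * h := by
  have := Fintype.ofFinite G
  have hg'g : g' * g = 1 := mul_eq_one_comm.1 hgg'
  have hdot : ∀ (X Y : Matrix ι ι F) (v w : ι → F),
      (X *ᵥ v) ⬝ᵥ (Y *ᵥ w) = v ⬝ᵥ ((Xᵀ * Y) *ᵥ w) := fun X Y v w => by
    rw [dotProduct_mulVec, vecMul_mulVec, ← dotProduct_mulVec]
  set A := gᵀ * g with hA
  have hAinv : g' * g'ᵀ * A = 1 := by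
    rw [hA, mul_assoc, ← mul_assoc g'ᵀ, ← transpose_mul, hgg', transpose_one, one_mul, hg'g]
  have hAT : Aᵀ = A := by rw [hA, transpose_mul, transpose_transpose]
  have hAu : IsUnit A := IsUnit.of_mul_eq_one_right _ hAinv
  have hAρ : ∀ x, Commute A (ρ x) := fun x => by
    have h1 : gᵀ * σ x = ρ x * gᵀ := by
      have := congrArg transpose (hg x⁻¹)
      simpa only [transpose_mul, hσ, hρ, inv_inv] using this
    rw [commute_iff_eq, hA, mul_assoc, ← hg, ← mul_assoc, h1, mul_assoc]
  obtain ⟨c, hcρ, hcc, hce⟩ :=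
    IsPGroup.exists_transpose_mul_self_eq hp h2 hG hodd ρ hρ hAT hAu hAρ
  set e := subgroupAverage ρ ⊤ with he
  have heT : eᵀ = e := transpose_subgroupAverage ρ ⊤ hρ
  have hee : e * e = e := subgroupAverage_mul_subgroupAverage ρ hG le_rfl
  have hec : e * c = 0 := by rw [← (commute_subgroupAverage ρ ⊤ fun x _ => hcρ x).eq, hce]
  have hAe : A * e = e * A := (commute_subgroupAverage ρ ⊤ fun x _ => hAρ x).eq
  have heρ : ∀ x, e * ρ x = e := fun x => subgroupAverage_mul ρ ⊤ trivial
  have hρe : ∀ x, ρ x * e = e := fun x => mul_subgroupAverage ρ ⊤ trivial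
  obtain ⟨h, hh, hhc⟩ := exists_orthogonal_mulVec_eq_on h2 (LinearMap.ker e.mulVecLin) c g
    (fun v _ w hw => by
      rw [LinearMap.mem_ker, mulVecLin_apply] at hw
      rw [hdot, hdot, hcc, ← mulVec_mulVec, sub_mulVec, hw, one_mulVec, sub_zero])
    (fun v hv hv' => by
      rw [LinearMap.mem_ker, mulVecLin_apply] at hv
      have h1 : A *ᵥ v = 0 := by
        refine dotProduct_eq_zero _ fun y => ?_
        have h3 := hv' ((1 - e) *ᵥ y) (by
          rw [LinearMap.mem_ker, mulVecLin_apply, mulVec_mulVec, mul_sub, hee, mul_one, sub_self,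
            zero_mulVec])
        rw [dotProduct_comm, mulVec_mulVec, hdot, transpose_mul, transpose_sub, heT, transpose_one,
          mul_assoc, ← hA, sub_mul, ← hAe, one_mul, sub_mulVec, ← mulVec_mulVec v A e, hv,
          mulVec_zero, sub_zero] at h3
        rw [dotProduct_comm, h3]
      rw [← one_mulVec v, ← hAinv, ← mulVec_mulVec, h1, mulVec_zero])
  have hhc' : h * c = g * (1 - e) := by
    refine Matrix.ext_of_mulVec_single fun i => ?_
    have h1 : c = c * (1 - e) := by rw [mul_sub, hce, mul_one, sub_zero]
    rw [h1, ← mulVec_mulVec, ← mulVec_mulVec, ← mulVec_mulVec]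
    refine hhc _ ?_
    rw [LinearMap.mem_ker, mulVecLin_apply, mulVec_mulVec, mul_sub, hee, mul_one, sub_self,
      zero_mulVec]
  have hfix : g * e * g' * (h * e) = h * e := by
    have hT : (g * e * g')ᵀ = g * e * g' := by
      have h1 : gᵀ * (g * e * g') = e * gᵀ := by
        rw [← mul_assoc, ← mul_assoc, ← hA, hAe, hA, mul_assoc, mul_assoc, hgg', mul_one]
      have h2 : g'ᵀ * gᵀ = 1 := by rw [← transpose_mul, hgg', transpose_one]
      rw [transpose_mul, transpose_mul, heT, ← h1, ← mul_assoc, h2, one_mul]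
    have h1 : 1 - g * e * g' = h * c * g' := by
      rw [hhc', mul_sub, sub_mul, mul_one, hgg']
    have h3 : e * hᵀ * (1 - g * e * g') = 0 := by
      rw [h1, mul_assoc, ← mul_assoc hᵀ, ← mul_assoc hᵀ, hh, one_mul, ← mul_assoc, hec, zero_mul]
    have h4 : (1 - g * e * g') * (h * e) = 0 := by
      have := congrArg transpose h3
      rwa [transpose_mul, transpose_mul, transpose_sub, hT, heT, transpose_one,
        transpose_transpose, transpose_zero] at this
    rw [sub_mul, one_mul, sub_eq_zero] at h4
    exact h4.symm
  have hk : (g' * g'ᵀ * cᵀ + e) * (c + e) = 1 := by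
    have h1 : cᵀ * e = 0 := by
      rw [← transpose_transpose (cᵀ * e), transpose_mul, transpose_transpose, heT, hec,
        transpose_zero]
    rw [add_mul, mul_add, mul_add, mul_assoc, hcc, ← mul_assoc, hAinv, one_mul, mul_assoc, h1,
      mul_zero, hec, hee]
    abel
  have hk' := mul_eq_one_comm.1 hk
  refine ⟨h, hh, fun x => ?_⟩
  have hkx : h * ρ x * (c + e) = σ x * h * (c + e) := by
    have h1 : σ x * (h * e) = h * e := by
      calc σ x * (h * e) = σ x * (g * e * g' * (h * e)) := by rw [hfix]
        _ = σ x * g * e * g' * (h * e) := by simp only [mul_assoc]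
        _ = h * e := by rw [hg, mul_assoc g, hρe, hfix]
    calc h * ρ x * (c + e) = h * c * ρ x + h * e := by
          rw [mul_add, mul_assoc, ← (hcρ x).eq, mul_assoc, hρe, mul_assoc]
      _ = g * ρ x * (1 - e) + h * e := by
          have h3 : (1 - e) * ρ x = ρ x * (1 - e) := by
            rw [sub_mul, mul_sub, heρ, hρe, one_mul, mul_one]
          rw [hhc', mul_assoc, h3, ← mul_assoc]
      _ = σ x * h * (c + e) := by
          rw [← hg, mul_assoc, ← hhc', mul_add, mul_assoc, mul_assoc, h1]
  rw [← mul_one (h * ρ x), ← hk', ← mul_assoc, hkx, mul_assoc, hk', mul_one]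

end Fusion

section SpecialOrthogonal

variable {F : Type*} [Field F] [Fintype F]

theorem two_mul_card_eq_card_orthogonalMatrix (hF : ringChar F ≠ 2) {n : ℕ}
    {H : Subgroup (GL (Fin (2 * n + 1)) F)}
    (hH : ∀ M : GL (Fin (2 * n + 1)) F, M ∈ H ↔
      (M : Matrix (Fin (2 * n + 1)) (Fin (2 * n + 1)) F)ᵀ *
        (M : Matrix (Fin (2 * n + 1)) (Fin (2 * n + 1)) F) = 1 ∧
      (M : Matrix (Fin (2 * n + 1)) (Fin (2 * n + 1)) F).det = 1) :
    2 * Nat.card H = Nat.card (OrthogonalMatrix (Fin (2 * n + 1)) F) := by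
  have hdet : ∀ M : Matrix (Fin (2 * n + 1)) (Fin (2 * n + 1)) F, (-M).det = -M.det := fun M => by
    rw [det_neg, Fintype.card_fin, pow_succ, pow_mul]
    simp
  have h1 : (-1 : F) ≠ 1 := Ring.neg_one_ne_one_of_char_ne_two hF
  let f : H ⊕ H → OrthogonalMatrix (Fin (2 * n + 1)) F :=
    Sum.elim (fun M => ⟨M.1.1, ((hH _).1 M.2).1⟩)
      (fun M => ⟨-M.1.1, by simpa using ((hH _).1 M.2).1⟩)
  have hf : Function.Bijective f := by
    constructor
    · refine Function.Injective.sumElim (fun M N h => ?_) (fun M N h => ?_) fun M N h => ?_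
      · exact Subtype.ext (Units.ext (congrArg Subtype.val h))
      · exact Subtype.ext (Units.ext (neg_injective (congrArg Subtype.val h)))
      · have := congrArg (fun X => X.1.det) h
        simp only [hdet, ((hH _).1 M.2).2, ((hH _).1 N.2).2] at this
        exact h1 this.symm
    · rintro ⟨M, hM⟩
      have hd : M.det * M.det = 1 := by
        rw [← det_one (n := Fin (2 * n + 1)) (R := F), ← hM, det_mul, det_transpose]
      have hM' := mul_eq_one_comm.1 hM
      rcases mul_self_eq_one_iff.1 hd with hd | hd
      · exact ⟨Sum.inl ⟨⟨M, Mᵀ, hM', hM⟩, (hH _).2 ⟨hM, hd⟩⟩, rfl⟩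
      · refine ⟨Sum.inr ⟨⟨-M, -Mᵀ, by simpa using hM', by simpa using hM⟩,
          (hH _).2 ⟨by simpa using hM, ?_⟩⟩, Subtype.ext (neg_neg M)⟩
        change (-M).det = 1
        rw [hdet, hd, neg_neg]
  rw [← Nat.card_eq_of_bijective f hf, Nat.card_sum, two_mul]

theorem factorization_card_eq_of_even_orderOf {p : ℕ} (hp : p.Prime) (hodd : Odd p)
    (hF : Odd (Fintype.card F)) (hpF : ¬ p ∣ Fintype.card F)
    (heven : Even (orderOf (Fintype.card F : ZMod p))) {n : ℕ}
    {H : Subgroup (GL (Fin (2 * n + 1)) F)}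
    (hH : ∀ M : GL (Fin (2 * n + 1)) F, M ∈ H ↔
      (M : Matrix (Fin (2 * n + 1)) (Fin (2 * n + 1)) F)ᵀ *
        (M : Matrix (Fin (2 * n + 1)) (Fin (2 * n + 1)) F) = 1 ∧
      (M : Matrix (Fin (2 * n + 1)) (Fin (2 * n + 1)) F).det = 1) :
    (Nat.card H).factorization p = (Nat.card (GL (Fin (2 * n + 1)) F)).factorization p := by
  have hF' := ringChar_ne_two_of_odd_card hF
  refine le_antisymm ?_ ?_
  · exact (Nat.factorization_le_iff_dvd Nat.card_pos.ne' Nat.card_pos.ne').2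
      H.card_subgroup_dvd_card p
  rw [← hp.pow_dvd_iff_le_factorization Nat.card_pos.ne']
  obtain ⟨a, ha⟩ := card_GL_odd (F := F) n
  have hdvd := Nat.ordProj_dvd (Nat.card (GL (Fin (2 * n + 1)) F)) p
  have hcop : p.Coprime (Fintype.card F ^ a *
      ∏ k ∈ Finset.range (n + 1), (Fintype.card F ^ (2 * k + 1) - 1)) := by
    refine Nat.Coprime.mul_right (Nat.Coprime.pow_right _ ((hp.coprime_iff_not_dvd).2 hpF))
      (Nat.Coprime.prod_right fun k _ => (hp.coprime_iff_not_dvd).2 fun h => ?_)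
    have h1 : (Fintype.card F : ZMod p) ^ (2 * k + 1) = 1 := by
      rw [← ZMod.natCast_eq_zero_iff, Nat.cast_sub (Nat.one_le_pow _ _ Fintype.card_pos)] at h
      simpa [sub_eq_zero] using h
    have h2 := heven.two_dvd.trans (orderOf_dvd_of_pow_eq_one h1)
    omega
  have h1 : p ^ (Nat.card (GL (Fin (2 * n + 1)) F)).factorization p ∣ 2 * Nat.card H := by
    rw [two_mul_card_eq_card_orthogonalMatrix hF' hH, card_orthogonalMatrix_odd hF']
    refine Dvd.dvd.mul_left ?_ _
    refine (Nat.Coprime.pow_left _ hcop).dvd_of_dvd_mul_left ?_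
    exact hdvd.trans (dvd_of_eq ha)
  refine (Nat.Coprime.pow_left _ ?_).dvd_of_dvd_mul_left h1
  exact (Nat.coprime_primes hp Nat.prime_two).2 fun h => by
    rw [h] at hodd
    exact absurd hodd (by decide)

end SpecialOrthogonal

/-- For `p` an odd prime and `F` a finite field of odd cardinality `q` prime
to `p` with `ord_p(q)` even, a Sylow `p`-subgroup `S` of the special orthogonal group
`SO_{2n+1}(F) = {M ∈ GL_{2n+1}(F) | MᵀM = 1, det M = 1}` is also a Sylow `p`-subgroup of
`GL_{2n+1}(F)`, and every fusion in `GL_{2n+1}(F)` between subgroups of `S` is realized by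
an element of `SO_{2n+1}(F)`. -/
theorem stmt3 (p : ℕ) (hp : p.Prime) (hodd : Odd p)
    (F : Type) [Field F] [Fintype F] (q : ℕ) (hq : Fintype.card F = q)
    (hqodd : Odd q) (hpq : ¬ p ∣ q)
    (heven : Even (orderOf ((q : ZMod p))))
    (n : ℕ) (hn : 1 ≤ n)
    (H : Subgroup (GL (Fin (2 * n + 1)) F))
    (hH : ∀ M : GL (Fin (2 * n + 1)) F, M ∈ H ↔
      (M : Matrix (Fin (2 * n + 1)) (Fin (2 * n + 1)) F)ᵀ *
        (M : Matrix (Fin (2 * n + 1)) (Fin (2 * n + 1)) F) = 1 ∧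
      (M : Matrix (Fin (2 * n + 1)) (Fin (2 * n + 1)) F).det = 1)
    (S : Sylow p H) :
    (∃ T : Sylow p (GL (Fin (2 * n + 1)) F),
        (T : Subgroup (GL (Fin (2 * n + 1)) F)) =
          Subgroup.map H.subtype (S : Subgroup H)) ∧
    (∀ P Q : Subgroup (GL (Fin (2 * n + 1)) F),
        P ≤ Subgroup.map H.subtype (S : Subgroup H) →
        Q ≤ Subgroup.map H.subtype (S : Subgroup H) →
        ∀ g : GL (Fin (2 * n + 1)) F, (∀ x ∈ P, g * x * g⁻¹ ∈ Q) →
          ∃ h ∈ H, ∀ x ∈ P, h * x * h⁻¹ = g * x * g⁻¹) := by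
  subst hq
  have := Fact.mk hp
  have hF := ringChar_ne_two_of_odd_card hqodd
  have h2 : (2 : F) ≠ 0 := Ring.two_ne_zero hF
  have hpF : (p : F) ≠ 0 := fun h => by
    obtain ⟨k, hr, hk⟩ := FiniteField.card F (ringChar F)
    have h1 := (ringChar.spec F p).1 h
    rw [Nat.prime_dvd_prime_iff_eq hr hp] at h1
    rw [hk, h1] at hpq
    exact hpq (dvd_pow_self p k.ne_zero)
  refine ⟨⟨Sylow.ofCard (Subgroup.map H.subtype (S : Subgroup H)) ?_, rfl⟩,
    fun P Q hP hQ g hg => ?_⟩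
  · rw [Subgroup.card_subtype, S.card_eq_multiplicity,
      factorization_card_eq_of_even_orderOf hp hodd hqodd hpq heven hH]
  have hSH : Subgroup.map H.subtype (S : Subgroup H) ≤ H := Subgroup.map_subtype_le _
  have hPp : IsPGroup p P := (S.isPGroup'.map H.subtype).to_le hP
  obtain ⟨k, hk⟩ := IsPGroup.iff_card.1 hPp
  have horth : ∀ M ∈ H, (M : Matrix (Fin (2 * n + 1)) (Fin (2 * n + 1)) F)ᵀ = (M⁻¹).1 :=
    fun M hM => by
      have := ((hH M).1 hM).1
      rw [← mul_one (M.1ᵀ), ← Units.mul_inv M, ← mul_assoc, this, one_mul]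
  let ρ : P →* Matrix (Fin (2 * n + 1)) (Fin (2 * n + 1)) F := (Units.coeHom _).comp P.subtype
  let σ : P →* Matrix (Fin (2 * n + 1)) (Fin (2 * n + 1)) F :=
    (Units.coeHom _).comp ((MulAut.conj g).toMonoidHom.comp P.subtype)
  have hρ : ∀ x, (ρ x)ᵀ = ρ x⁻¹ := fun x => horth _ (hSH (hP x.2))
  have hσ : ∀ x, (σ x)ᵀ = σ x⁻¹ := fun x => by
    refine (horth _ (hSH (hQ (hg x x.2)))).trans ?_
    simp [σ, mul_assoc]
  obtain ⟨h, hh, hhx⟩ := IsPGroup.exists_orthogonal_intertwiner hPp h2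
    (by rw [hk, Nat.cast_pow]; exact pow_ne_zero _ hpF) (by rw [hk]; exact hodd.pow) hρ hσ
    (Units.mul_inv g) (fun x => by simp [ρ, σ, mul_assoc])
  have hd : h.det * h.det = 1 := by
    rw [← det_one (n := Fin (2 * n + 1)) (R := F), ← hh, det_mul, det_transpose]
  obtain ⟨r, hr, hrd, hrx⟩ : ∃ r : Matrix (Fin (2 * n + 1)) (Fin (2 * n + 1)) F,
      rᵀ * r = 1 ∧ r.det = 1 ∧ ∀ x, r * ρ x = σ x * r := by
    rcases mul_self_eq_one_iff.1 hd with hd | hd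
    · exact ⟨h, hh, hd, hhx⟩
    · refine ⟨-h, by simpa using hh, ?_, fun x => by rw [neg_mul, mul_neg, hhx]⟩
      rw [det_neg, hd, Fintype.card_fin, pow_succ, pow_mul]
      simp
  refine ⟨⟨r, rᵀ, mul_eq_one_comm.1 hr, hr⟩, (hH _).2 ⟨hr, hrd⟩, fun x hx => ?_⟩
  rw [mul_inv_eq_iff_eq_mul]
  exact Units.ext (hrx ⟨x, hx⟩)
end

section
/- Let p be an odd prime and F a finite field of cardinality q with p ∤ q. Let m be the multiplicative order of q modulo p, let ℓ be the p-adic valuation of q^m − 1, let n ≥ 1, and set κ = ⌊n/m⌋. Then the p-adic valuation of |GL_n(F)| equals κ·ℓ + v_p(κ!), where v_p(κ!) is the p-adic valuation of κ factorial. -/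
open Matrix

theorem padicValNat_finset_prod {ι : Type*} (p : ℕ) [Fact p.Prime] (s : Finset ι) (f : ι → ℕ)
    (hf : ∀ i ∈ s, f i ≠ 0) : padicValNat p (∏ i ∈ s, f i) = ∑ i ∈ s, padicValNat p (f i) := by
  classical
  induction s using Finset.induction_on with
  | empty => simp
  | insert a s ha ih =>
    rw [Finset.prod_insert ha, Finset.sum_insert ha, padicValNat.mul (hf a (by simp))
      (Finset.prod_ne_zero_iff.mpr fun i hi => hf i (Finset.mem_insert_of_mem hi)),
      ih fun i hi => hf i (Finset.mem_insert_of_mem hi)]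

theorem dvd_pow_sub_one_iff_orderOf_dvd {p q : ℕ} (hq : 0 < q) (j : ℕ) :
    p ∣ q ^ j - 1 ↔ orderOf (q : ZMod p) ∣ j := by
  rw [orderOf_dvd_iff_pow_eq_one, ← CharP.cast_eq_zero_iff (ZMod p) p,
    Nat.cast_sub (Nat.one_le_pow _ _ hq), sub_eq_zero]
  simp

theorem padicValNat_pow_mul_sub_one {p q m k : ℕ} [Fact p.Prime] (hodd : Odd p) (hq : 1 < q)
    (hpq : ¬ p ∣ q) (hm : m ≠ 0) (hpm : p ∣ q ^ m - 1) (hk : k ≠ 0) :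
    padicValNat p (q ^ (m * k) - 1) = padicValNat p (q ^ m - 1) + padicValNat p k := by
  have h := padicValNat.pow_sub_pow (p := p) (x := q ^ m) (y := 1) hodd
    (Nat.one_lt_pow hm hq) hpm (fun h => hpq ((Fact.out : p.Prime).dvd_of_dvd_pow h)) hk
  rwa [one_pow, ← pow_mul] at h

theorem sum_padicValNat_pow_sub_one {p q : ℕ} [Fact p.Prime] (hodd : Odd p) (hq : 1 < q)
    (hpq : ¬ p ∣ q) (n : ℕ) :
    ∑ i ∈ Finset.range n, padicValNat p (q ^ (i + 1) - 1) =
      n / orderOf (q : ZMod p) * padicValNat p (q ^ orderOf (q : ZMod p) - 1) +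
        padicValNat p (n / orderOf (q : ZMod p)).factorial := by
  have hm : orderOf (q : ZMod p) ≠ 0 := by
    have hq0 : (q : ZMod p) ≠ 0 := by rwa [Ne, CharP.cast_eq_zero_iff (ZMod p) p]
    rw [← Units.val_mk0 hq0, orderOf_units]
    exact (orderOf_pos _).ne'
  have hdvd := dvd_pow_sub_one_iff_orderOf_dvd (p := p) (zero_lt_one.trans hq)
  generalize orderOf (q : ZMod p) = m at hm hdvd ⊢
  induction n with
  | zero => simp
  | succ n ih =>
    rw [Finset.sum_range_succ, ih, Nat.succ_div]
    split_ifs with h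
    · have hn : n + 1 = m * (n / m + 1) := by
        rw [← Nat.succ_div_of_dvd h, Nat.mul_div_cancel' h]
      rw [hn, padicValNat_pow_mul_sub_one hodd hq hpq hm ((hdvd m).mpr dvd_rfl) (by lia),
        Nat.factorial_succ, padicValNat.mul (by lia) (Nat.factorial_ne_zero _)]
      ring
    · rw [padicValNat.eq_zero_of_not_dvd ((hdvd _).not.mpr h)]
      simp

/-- For an odd prime `p` and finite field `F` of cardinality `q` prime to
`p`, with `m = ord_p(q)`, `ℓ = v_p(q^m - 1)` and `κ = ⌊n/m⌋`, one has
`v_p(|GL_n(F)|) = κ·ℓ + v_p(κ!)`. -/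
theorem stmt5 (p : ℕ) (hp : p.Prime) (hodd : Odd p)
    (F : Type) [Field F] [Fintype F] (q : ℕ) (hq : Fintype.card F = q) (hpq : ¬ p ∣ q)
    (m ℓ n κ : ℕ) (hm : m = orderOf ((q : ZMod p)))
    (hℓ : ℓ = padicValNat p (q ^ m - 1)) (hn : 1 ≤ n) (hκ : κ = n / m) :
    padicValNat p (Nat.card (GL (Fin n) F)) = κ * ℓ + padicValNat p (Nat.factorial κ) := by
  have : Fact p.Prime := ⟨hp⟩
  have hq1 : 1 < q := hq ▸ Fintype.one_lt_card
  subst hκ hℓ hm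
  rw [← sum_padicValNat_pow_sub_one hodd hq1 hpq n, Matrix.card_GL_field, hq,
    Fin.prod_univ_eq_prod_range (fun i => q ^ n - q ^ i), padicValNat_finset_prod,
    ← Finset.sum_range_reflect]
  · refine Finset.sum_congr rfl fun i hi => ?_
    have hin := Finset.mem_range.mp hi
    have hsplit : q ^ n - q ^ (n - 1 - i) = q ^ (n - 1 - i) * (q ^ (i + 1) - 1) := by
      rw [Nat.mul_sub, ← pow_add, mul_one]
      congr 2
      lia
    rw [hsplit, padicValNat.mul (by positivity)
      (Nat.sub_pos_of_lt (Nat.one_lt_pow (by lia) hq1)).ne',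
      padicValNat.eq_zero_of_not_dvd fun h => hpq (hp.dvd_of_dvd_pow h), zero_add]
  · intro i hi
    exact (Nat.sub_pos_of_lt (Nat.pow_lt_pow_right hq1 (Finset.mem_range.mp hi))).ne'
end

section
/- Let F be a finite field, E/F a field extension of finite degree m ≥ 2, and ζ ∈ E an element with F(ζ) = E. Let V be a finite-dimensional E-vector space and W a finite-dimensional F-vector space, and regard U = V × W as an F-vector space. Let z ∈ GL_F(U) be the F-linear automorphism z(v, w) = (ζ • v, w). Then the centralizer of z in GL_F(U) is isomorphic, as a group, to GL_E(V) × GL_F(W). -/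
/-- The block-diagonal embedding `End_E(V) × End_F(W) → End_F(V × W)`. -/
def blockDiagonalEnd (F E V W : Type*) [Field F] [Field E] [Algebra F E]
    [AddCommGroup V] [Module E V] [Module F V] [IsScalarTower F E V]
    [AddCommGroup W] [Module F W] :
    Module.End E V × Module.End F W →* Module.End F (V × W) where
  toFun p := (p.1.restrictScalars F).prodMap p.2
  map_one' := rfl
  map_mul' _ _ := rfl

section BlockDiagonal

variable {F E V W : Type*} [Field F] [Field E] [Algebra F E]
  [AddCommGroup V] [Module E V] [Module F V] [IsScalarTower F E V]
  [AddCommGroup W] [Module F W]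

theorem blockDiagonalEnd_apply (p : Module.End E V × Module.End F W) (v : V) (w : W) :
    blockDiagonalEnd F E V W p (v, w) = (p.1 v, p.2 w) := rfl

theorem blockDiagonalEnd_injective : Function.Injective (blockDiagonalEnd F E V W) := by
  intro p q h
  refine Prod.ext (LinearMap.ext fun v => ?_) (LinearMap.ext fun w => ?_)
  · exact congrArg Prod.fst (LinearMap.congr_fun h (v, 0))
  · exact congrArg Prod.snd (LinearMap.congr_fun h (0, w))

/-- An `F`-linear map commuting with a generator of `E/F` is `E`-linear. -/
theorem LinearMap.map_smul_of_adjoin_eq_top {ζ : E}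
    (hζ : IntermediateField.adjoin F {ζ} = ⊤) (T : V →ₗ[F] V)
    (hT : ∀ v, T (ζ • v) = ζ • T v) (e : E) (v : V) : T (e • v) = e • T v := by
  have he : e ∈ IntermediateField.adjoin F {ζ} := hζ ▸ IntermediateField.mem_top
  induction he using IntermediateField.adjoin_induction generalizing v with
  | mem x hx => rw [Set.mem_singleton_iff.1 hx, hT]
  | algebraMap x => simp only [algebraMap_smul, map_smul]
  | add x y _ _ hx hy => rw [add_smul, map_add, hx, hy, add_smul]
  | inv x _ hx =>
    rcases eq_or_ne x 0 with rfl | h0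
    · simp
    · rw [eq_inv_smul_iff₀ h0, ← hx, smul_inv_smul₀ h0]
  | mul x y _ _ hx hy => rw [mul_smul, hx, hy, mul_smul]

/-- An endomorphism of `V × W` commuting with `(v, w) ↦ (ζ • v, w)` is block diagonal. -/
theorem exists_blockDiagonalEnd_eq {ζ : E} (hζ : IntermediateField.adjoin F {ζ} = ⊤)
    (hζ1 : ζ ≠ 1) (g : Module.End F (V × W))
    (hg : ∀ (v : V) (w : W), g (ζ • v, w) = (ζ • (g (v, w)).1, (g (v, w)).2)) :
    ∃ p, blockDiagonalEnd F E V W p = g := by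
  have hsub : ζ - 1 ≠ 0 := sub_ne_zero.2 hζ1
  have hV (v : V) : (g (v, 0)).2 = 0 := by
    have h := congrArg Prod.snd (hg ((ζ - 1)⁻¹ • v) 0)
    have hv : ((v, 0) : V × W) = (ζ • (ζ - 1)⁻¹ • v, 0) - ((ζ - 1)⁻¹ • v, 0) := by
      have hsmul := sub_smul ζ 1 ((ζ - 1)⁻¹ • v)
      rw [smul_inv_smul₀ hsub, one_smul] at hsmul
      rw [Prod.mk_sub_mk, sub_zero, ← hsmul]
    rw [hv, map_sub, Prod.snd_sub, h, sub_self]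
  have hW (w : W) : (g (0, w)).1 = 0 := by
    have h := congrArg Prod.fst (hg 0 w)
    rw [smul_zero] at h
    refine (smul_eq_zero.1 ?_).resolve_left hsub
    rw [sub_smul, one_smul]
    exact sub_eq_zero.2 h.symm
  let T : V →ₗ[F] V := LinearMap.fst F V W ∘ₗ g ∘ₗ LinearMap.inl F V W
  have hT : ∀ v, T (ζ • v) = ζ • T v := fun v => congrArg Prod.fst (hg v 0)
  refine ⟨({ toFun := T
             map_add' := T.map_add
             map_smul' := T.map_smul_of_adjoin_eq_top hζ hT },
    LinearMap.snd F V W ∘ₗ g ∘ₗ LinearMap.inr F V W), LinearMap.ext fun ⟨v, w⟩ => ?_⟩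
  have hvw : g (v, w) = g (v, 0) + g (0, w) := by
    rw [← map_add, Prod.mk_add_mk, add_zero, zero_add]
  rw [blockDiagonalEnd_apply, hvw]
  refine Prod.ext ?_ ?_
  · rw [Prod.fst_add, hW, add_zero]
    rfl
  · rw [Prod.snd_add, hV, zero_add]
    rfl

/-- The centralizer of `(v, w) ↦ (ζ • v, w)` is the group of block-diagonal automorphisms. -/
theorem range_units_map_blockDiagonalEnd {ζ : E}
    (hζ : IntermediateField.adjoin F {ζ} = ⊤) (hζ1 : ζ ≠ 1)
    (z : LinearMap.GeneralLinearGroup F (V × W))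
    (hz : ∀ (v : V) (w : W), (z : (V × W) →ₗ[F] (V × W)) (v, w) = (ζ • v, w)) :
    (Units.map (blockDiagonalEnd F E V W)).range = Subgroup.centralizer {z} := by
  ext g
  rw [Subgroup.mem_centralizer_singleton_iff]
  constructor
  · rintro ⟨p, rfl⟩
    refine Units.ext (LinearMap.ext fun ⟨v, w⟩ => ?_)
    simp only [Units.val_mul, Units.coe_map, Module.End.mul_apply, hz,
      blockDiagonalEnd_apply, map_smul]
  · intro hg
    have exists_eq (k : LinearMap.GeneralLinearGroup F (V × W)) (hk : Commute k z) :
        ∃ p, blockDiagonalEnd F E V W p = (k : Module.End F (V × W)) :=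
      exists_blockDiagonalEnd_eq hζ hζ1 _ fun v w => by
        have h := LinearMap.congr_fun (congrArg Units.val hk.eq) (v, w)
        rw [Units.val_mul, Units.val_mul, Module.End.mul_apply, Module.End.mul_apply, hz] at h
        rw [h, ← hz]
    obtain ⟨p, hp⟩ := exists_eq g hg
    obtain ⟨q, hq⟩ := exists_eq g⁻¹ (Commute.inv_left hg)
    refine ⟨⟨p, q, blockDiagonalEnd_injective (F := F) ?_,
      blockDiagonalEnd_injective (F := F) ?_⟩, Units.ext hp⟩
    · rw [map_mul, hp, hq, map_one, Units.mul_inv]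
    · rw [map_mul, hp, hq, map_one, Units.inv_mul]

end BlockDiagonal

/-- Let `E/F` be a degree-`m ≥ 2` extension of a finite field `F`, with
`F(ζ) = E`, let `V` be a finite-dimensional `E`-vector space and `W` a finite-dimensional
`F`-vector space, and let `z ∈ GL_F(V × W)` be given by `z(v, w) = (ζ • v, w)`. Then the
centralizer of `z` in `GL_F(V × W)` is isomorphic, as a group, to `GL_E(V) × GL_F(W)`. -/
theorem stmt7 (F E : Type) [Field F] [Fintype F] [Field E] [Algebra F E]
    (m : ℕ) (hm : 2 ≤ m) (hdeg : Module.finrank F E = m)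
    (ζ : E) (hζ : IntermediateField.adjoin F {ζ} = ⊤)
    (V : Type) [AddCommGroup V] [Module E V] [Module F V] [IsScalarTower F E V]
    [FiniteDimensional E V]
    (W : Type) [AddCommGroup W] [Module F W] [FiniteDimensional F W]
    (z : LinearMap.GeneralLinearGroup F (V × W))
    (hz : ∀ (v : V) (w : W), (z : (V × W) →ₗ[F] (V × W)) (v, w) = (ζ • v, w)) :
    Nonempty
      ((Subgroup.centralizer {z} : Subgroup (LinearMap.GeneralLinearGroup F (V × W))) ≃*
        (LinearMap.GeneralLinearGroup E V × LinearMap.GeneralLinearGroup F W)) := by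
  have hζ1 : ζ ≠ 1 := by
    rintro rfl
    rw [IntermediateField.adjoin_one] at hζ
    have h : Module.finrank F (⊥ : IntermediateField F E) = Module.finrank F E := by
      rw [hζ, IntermediateField.finrank_top']
    rw [IntermediateField.finrank_bot] at h
    omega
  exact ⟨(MulEquiv.subgroupCongr (range_units_map_blockDiagonalEnd hζ hζ1 z hz).symm).trans
    ((MonoidHom.ofInjective (Units.map_injective blockDiagonalEnd_injective)).symm.trans
      MulEquiv.prodUnits)⟩
end

section
/- Let F ⊆ K ⊆ L be a chain of finite fields with [L : K] = 2, and set Q = |K|. Define q₀ : L → F by q₀(x) = Tr_{K/F}(x^{Q+1}), where Tr_{K/F} is the field trace (note x^{Q+1} = x · x^Q = N_{L/K}(x) ∈ K). Then for every u ∈ L: q₀(u·x) = q₀(x) holds for all x ∈ L if and only if u^{Q+1} = 1. -/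
/-- Let `F ⊆ K ⊆ L` be finite fields with `[L : K] = 2` and `Q = |K|`, and
let `q₀(x) = Tr_{K/F}(x^{Q+1})`, where `x^{Q+1} = N_{L/K}(x) ∈ K` is recorded by the function
`f : L → K` with `algebraMap K L (f x) = x^(Q+1)`. Then for every `u ∈ L`,
`q₀(u·x) = q₀(x)` for all `x ∈ L` if and only if `u^(Q+1) = 1`. -/
theorem stmt8 (F K L : Type) [Field F] [Field K] [Field L]
    [Fintype F] [Fintype K] [Fintype L]
    [Algebra F K] [Algebra K L] [Algebra F L] [IsScalarTower F K L]
    (hdeg : Module.finrank K L = 2)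
    (f : L → K) (hf : ∀ x : L, algebraMap K L (f x) = x ^ (Fintype.card K + 1)) :
    ∀ u : L, (∀ x : L, Algebra.trace F K (f (u * x)) = Algebra.trace F K (f x)) ↔
      u ^ (Fintype.card K + 1) = 1 := by
  have norm_eq (x : L) : f x = Algebra.norm K x := by
    apply (algebraMap K L).injective
    rw [hf, FiniteField.algebraMap_norm_eq_pow, Module.natCard_eq_pow_finrank (K := K), hdeg,
      Nat.card_eq_fintype_card]
    congr 1
    have : Fintype.card K - 1 ≠ 0 := Nat.sub_ne_zero_of_lt Fintype.one_lt_card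
    symm
    apply Nat.div_eq_of_eq_mul_left (Nat.pos_of_ne_zero this)
    rw [← Nat.sq_sub_sq, one_pow]
  intro u
  rw [← hf, ← map_one (algebraMap K L), (algebraMap K L).injective.eq_iff]
  simp only [norm_eq, map_mul]
  refine ⟨fun h => ?_, fun h x => by rw [h, one_mul]⟩
  rw [← sub_eq_zero]
  refine (traceForm_nondegenerate F K).1 _ fun c => ?_
  obtain ⟨x, rfl⟩ := FiniteField.norm_surjective K L c
  rw [Algebra.traceForm_apply, sub_mul, one_mul, map_sub, h, sub_self]
end

section
/- Let F ⊆ K ⊆ L be a chain of finite fields with [L : K] = 2, set Q = |K|, and define q₀ : L → F by q₀(x) = Tr_{K/F}(x^{Q+1}). Then: (i) for all x, y ∈ L, q₀(x + y) − q₀(x) − q₀(y) = Tr_{L/F}(x · y^Q), and the pairing (x, y) ↦ Tr_{L/F}(x · y^Q) is F-bilinear; (ii) this pairing is nondegenerate, i.e., if x ∈ L satisfies Tr_{L/F}(x · y^Q) = 0 for all y ∈ L, then x = 0. -/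
/-- Let `F ⊆ K ⊆ L` be finite fields with `[L : K] = 2` and `Q = |K|`, and
let `q₀(x) = Tr_{K/F}(x^{Q+1})`, where `x^{Q+1} = N_{L/K}(x) ∈ K` is recorded by the function
`f : L → K` with `algebraMap K L (f x) = x^(Q+1)`. Then (i) the polarization of `q₀` is the
pairing `(x, y) ↦ Tr_{L/F}(x·y^Q)`, which is `F`-bilinear, and (ii) this pairing is
nondegenerate. -/
theorem stmt9 (F K L : Type) [Field F] [Field K] [Field L]
    [Fintype F] [Fintype K] [Fintype L]
    [Algebra F K] [Algebra K L] [Algebra F L] [IsScalarTower F K L]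
    (hdeg : Module.finrank K L = 2)
    (f : L → K) (hf : ∀ x : L, algebraMap K L (f x) = x ^ (Fintype.card K + 1)) :
    (∀ x y : L,
      Algebra.trace F K (f (x + y)) - Algebra.trace F K (f x) - Algebra.trace F K (f y) =
        Algebra.trace F L (x * y ^ Fintype.card K)) ∧
    (∃ B : L →ₗ[F] L →ₗ[F] F,
      ∀ x y : L, B x y = Algebra.trace F L (x * y ^ Fintype.card K)) ∧
    (∀ x : L, (∀ y : L, Algebra.trace F L (x * y ^ Fintype.card K) = 0) → x = 0) := by
  set φ := FiniteField.frobeniusAlgEquivOfAlgebraic K L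
  have hφ (y : L) : φ y = y ^ Fintype.card K := rfl
  have hcard : Fintype.card L = Fintype.card K ^ 2 := hdeg ▸ Module.card_eq_pow_finrank
  have hφφ (y : L) : φ (φ y) = y := by
    rw [hφ, hφ, ← pow_mul, ← sq, ← hcard, FiniteField.pow_card]
  simp only [← hφ]
  refine ⟨fun x y ↦ ?_, ?_, fun x hx ↦ ?_⟩
  · rw [← Algebra.trace_trace (S := K) (T := L), ← map_sub, ← map_sub]
    congr 1
    apply (algebraMap K L).injective
    rw [FiniteField.algebraMap_trace_eq_sum_pow, hdeg, Finset.sum_range_succ,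
      Finset.sum_range_one, Nat.card_eq_fintype_card, pow_zero, pow_one, pow_one, ← hφ]
    simp only [map_sub, hf, pow_succ, ← hφ, map_add, map_mul, hφφ]
    ring
  · exact ⟨(Algebra.traceForm F L).compl₂ (φ.toLinearMap.restrictScalars F), fun _ _ ↦ rfl⟩
  · refine (traceForm_nondegenerate F L).1 x fun y ↦ ?_
    simpa [Algebra.traceForm_apply, hφφ] using hx (φ y)
end

section
/- Let K be a finite field and L/K a field extension of finite degree m ≥ 1. Then the determinant of the K-linear endomorphism of L given by x ↦ x^{|K|} (the |K|-power Frobenius) equals (−1)^{m−1}. -/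
open Polynomial in
/-- The characteristic polynomial of the Frobenius of an extension of finite fields coincides with
its minimal polynomial. -/
theorem FiniteField.charpoly_frobeniusAlgHom (K L : Type*) [Field K] [Fintype K] [Field L]
    [Algebra K L] [FiniteDimensional K L] :
    (FiniteField.frobeniusAlgHom K L).toLinearMap.charpoly = X ^ Module.finrank K L - 1 := by
  have : Finite L := Module.finite_of_finite K
  have hmin := FiniteField.minpoly_frobeniusAlgHom K L
  have hdvd := LinearMap.minpoly_dvd_charpoly (FiniteField.frobeniusAlgHom K L).toLinearMap
  rw [hmin] at hdvd
  have hmonic : (X ^ Module.finrank K L - 1 : K[X]).Monic :=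
    monic_X_pow_sub_C 1 Module.finrank_pos.ne'
  refine eq_of_monic_of_dvd_of_natDegree_le hmonic (LinearMap.charpoly_monic _) hdvd ?_
  rw [LinearMap.charpoly_natDegree, ← C_1, natDegree_X_pow_sub_C]

/-- Let `K` be a finite field and `L/K` an extension of finite degree
`m ≥ 1`. Then the determinant of the `K`-linear endomorphism `x ↦ x^|K|` of `L` (the
`|K|`-power Frobenius) equals `(-1)^(m-1)`. -/
theorem stmt10 (K L : Type) [Field K] [Fintype K] [Field L] [Algebra K L]
    (m : ℕ) (hm : 1 ≤ m) (hdeg : Module.finrank K L = m)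
    (φ : L →ₗ[K] L) (hφ : ∀ x : L, φ x = x ^ Fintype.card K) :
    LinearMap.det φ = (-1 : K) ^ (m - 1) := by
  have : FiniteDimensional K L := Module.finite_of_finrank_pos (by omega)
  obtain rfl : φ = (FiniteField.frobeniusAlgHom K L).toLinearMap :=
    LinearMap.ext fun x ↦ by simp [hφ]
  rw [LinearMap.det_eq_sign_charpoly_coeff, FiniteField.charpoly_frobeniusAlgHom, hdeg]
  obtain ⟨n, rfl⟩ := Nat.exists_eq_add_of_le' hm
  simp [pow_succ]
end

section
/- Let p be a prime, Ḡ a finite group, and G ⊴ Ḡ a normal subgroup with index [Ḡ : G] coprime to p. Let S be a Sylow p-subgroup of G, and let A ⊴ S be a normal subgroup of S such that: (i) C_S(A) ≤ A; (ii) for every g ∈ G with gAg⁻¹ ≤ S one has gAg⁻¹ = A; and (iii) Ḡ = G · C_Ḡ(A). Then for all subgroups P, Q ≤ S and every ḡ ∈ Ḡ with ḡPḡ⁻¹ ≤ Q, there exists g ∈ G such that gxg⁻¹ = ḡxḡ⁻¹ for all x ∈ P. -/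
open Subgroup in
/-- A form of the Frattini argument: if conjugation by `c` maps a Sylow subgroup `T` of a normal
subgroup `G` into `T ⊔ K`, where `T` normalizes `K`, then a translate of `c` by an element of `K`
maps `T` to itself. -/
theorem Sylow.exists_mul_conj_mem_of_conj_mem_sup {p : ℕ} [Fact p.Prime] {Γ : Type*} [Group Γ]
    [Finite Γ] {G : Subgroup Γ} [G.Normal] (T : Sylow p G) (K : Subgroup G)
    (hK : (T : Subgroup G) ≤ normalizer K) (c : Γ)
    (hc : ∀ t ∈ T, MulAut.conjNormal c t ∈ (T : Subgroup G) ⊔ K) :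
    ∃ k ∈ K, ∀ t ∈ T, MulAut.conjNormal ((k : Γ) * c) t ∈ T := by
  have hcT : (((MulAut.conjNormal c : MulAut G) • T : Sylow p G) : Subgroup G) ≤
      (T : Subgroup G) ⊔ K := by
    rintro _ ⟨t, ht, rfl⟩
    exact hc t ht
  have hT : (T : Subgroup G) ≤ (T : Subgroup G) ⊔ K := le_sup_left
  obtain ⟨h, hh⟩ := MulAction.exists_smul_eq (↥((T : Subgroup G) ⊔ K))
    (Sylow.subtype _ hcT) (T.subtype hT)
  rw [Sylow.smul_subtype] at hh
  have hh' : (h : G) • (MulAut.conjNormal c : MulAut G) • T = T := Sylow.subtype_injective hh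
  have hmem : (h : G) ∈ (((T : Subgroup G) ⊔ K : Subgroup G) : Set G) := h.2
  rw [coe_mul_of_left_le_normalizer_right _ _ hK] at hmem
  obtain ⟨t, ht, k, hk, htk⟩ := hmem
  refine ⟨k, hk, fun x hx => ?_⟩
  have hx' : (h : G) * MulAut.conjNormal c x * (h : G)⁻¹ ∈ T :=
    (SetLike.ext_iff.1 hh' _).1 ⟨_, ⟨x, hx, rfl⟩, rfl⟩
  have ht' : t ∈ T := ht
  have heq : MulAut.conjNormal ((k : Γ) * c) x =
      t⁻¹ * ((h : G) * MulAut.conjNormal c x * (h : G)⁻¹) * t := by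
    apply Subtype.ext
    simp [← htk, mul_assoc]
  rw [heq]
  exact mul_mem (mul_mem (inv_mem ht') hx') ht'

/-- If conjugation by `c` multiplies `s` by an element `z` commuting with `c`, then conjugation by
`c ^ n` multiplies `s` by `z ^ n`. -/
theorem conj_pow_eq_mul_pow {Γ : Type*} [Group Γ] {c s z : Γ} (hz : Commute c z)
    (h : c * s * c⁻¹ = s * z) (n : ℕ) : c ^ n * s * (c ^ n)⁻¹ = s * z ^ n := by
  induction n with
  | zero => simp
  | succ n ih =>
    calc c ^ (n + 1) * s * (c ^ (n + 1))⁻¹ = c * (c ^ n * s * (c ^ n)⁻¹) * c⁻¹ := by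
          rw [pow_succ']; group
      _ = c * s * z ^ n * c⁻¹ := by rw [ih, ← mul_assoc c]
      _ = c * s * c⁻¹ * z ^ n := by
          rw [mul_assoc, ((hz.pow_right n).inv_left).eq.symm, ← mul_assoc]
      _ = s * z ^ (n + 1) := by rw [h, pow_succ', mul_assoc]

/-- If `c ^ m` lies in `G` and `c ^ n` in `D` with `m`, `n` coprime, then `c` lies in `G * D`. -/
theorem Subgroup.exists_mul_eq_of_pow_mem {Γ : Type*} [Group Γ] {G D : Subgroup Γ} {c : Γ}
    {m n : ℕ} (hmn : m.Coprime n) (hm : c ^ m ∈ G) (hn : c ^ n ∈ D) :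
    ∃ g ∈ G, ∃ d ∈ D, c = g * d := by
  refine ⟨(c ^ m) ^ m.gcdA n, G.zpow_mem hm _, (c ^ n) ^ m.gcdB n, D.zpow_mem hn _, ?_⟩
  rw [← zpow_natCast, ← zpow_natCast, ← zpow_mul, ← zpow_mul, ← zpow_add, ← Nat.gcd_eq_gcd_ab,
    hmn.gcd_eq_one]
  simp

/-- Let `p` be a prime, `Ḡ` a finite group, `G ⊴ Ḡ` of index prime to `p`,
`S` a Sylow `p`-subgroup of `G`, and `A ⊴ S` with `C_S(A) ≤ A`, `A` weakly closed
(`gAg⁻¹ ≤ S ⟹ gAg⁻¹ = A` for `g ∈ G`) and `Ḡ = G·C_Ḡ(A)`. Then every fusion in `Ḡ`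
between subgroups of `S` is realized by an element of `G`. -/
theorem stmt11 (p : ℕ) (hp : p.Prime) (Gbar : Type) [Group Gbar] [Finite Gbar]
    (G : Subgroup Gbar) [G.Normal] (hindex : Nat.Coprime G.index p)
    (S : Subgroup Gbar) (hSG : S ≤ G)
    (hSyl : ∃ T : Sylow p G, Subgroup.map G.subtype (T : Subgroup G) = S)
    (A : Subgroup Gbar) (hAS : A ≤ S)
    (hAnorm : ∀ s ∈ S, ∀ a ∈ A, s * a * s⁻¹ ∈ A)
    (hcentric : S ⊓ Subgroup.centralizer (A : Set Gbar) ≤ A)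
    (hwc : ∀ g ∈ G, Subgroup.map (MulAut.conj g).toMonoidHom A ≤ S →
      Subgroup.map (MulAut.conj g).toMonoidHom A = A)
    (hfact : ∀ x : Gbar, ∃ g ∈ G, ∃ c ∈ Subgroup.centralizer (A : Set Gbar), x = g * c) :
    ∀ P Q : Subgroup Gbar, P ≤ S → Q ≤ S →
      ∀ gb : Gbar, (∀ x ∈ P, gb * x * gb⁻¹ ∈ Q) →
        ∃ g ∈ G, ∀ x ∈ P, g * x * g⁻¹ = gb * x * gb⁻¹ := by
  have : Fact p.Prime := ⟨hp⟩
  obtain ⟨T, hT⟩ := hSyl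
  have memS (x : G) : (x : Gbar) ∈ S ↔ x ∈ T := by
    rw [← hT]
    exact Subgroup.mem_map_iff_mem G.subtype_injective
  have hcommutator {s c : Gbar} (hs : s ∈ S) (hc : c ∈ Subgroup.centralizer (A : Set Gbar)) :
      s * c * s⁻¹ ∈ Subgroup.centralizer (A : Set Gbar) := by
    rw [Subgroup.mem_centralizer_iff] at hc ⊢
    intro a ha
    have h := hc _ (by simpa using hAnorm _ (S.inv_mem hs) a ha)
    calc a * (s * c * s⁻¹) = s * ((s⁻¹ * a * s) * c) * s⁻¹ := by group
      _ = s * (c * (s⁻¹ * a * s)) * s⁻¹ := by rw [h]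
      _ = s * c * s⁻¹ * a := by group
  have hfactS (x : Gbar) :
      ∃ g ∈ G, ∃ d ∈ Subgroup.centralizer (S : Set Gbar), x = g * d := by
    obtain ⟨g, hg, c, hc, rfl⟩ := hfact x
    obtain ⟨k, hk, hkT⟩ := T.exists_mul_conj_mem_of_conj_mem_sup
      ((Subgroup.centralizer (A : Set Gbar)).subgroupOf G) (by
        refine Subgroup.le_normalizer_iff.mpr fun t ht y hy => ?_
        exact hcommutator ((memS t).2 ht) hy) c (by
        intro t ht
        have htS := (memS t).2 ht
        have hK : MulAut.conjNormal c t * t⁻¹ ∈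
            (Subgroup.centralizer (A : Set Gbar)).subgroupOf G := by
          rw [Subgroup.mem_subgroupOf]
          have := mul_mem hc (hcommutator htS (inv_mem hc))
          simpa [mul_assoc] using this
        have := mul_mem (Subgroup.mem_sup_right (S := (T : Subgroup G)) hK)
          (Subgroup.mem_sup_left ht)
        simpa using this)
    rw [Subgroup.mem_subgroupOf] at hk
    have hkc := mul_mem hk hc
    have hpow : ((k : Gbar) * c) ^ Nat.card T ∈ Subgroup.centralizer (S : Set Gbar) := by
      rw [Subgroup.mem_centralizer_iff]
      intro s hs
      have hconj : (k : Gbar) * c * s * ((k : Gbar) * c)⁻¹ ∈ S :=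
        (memS _).2 (hkT ⟨s, hSG hs⟩ ((memS _).1 hs))
      have hzS := mul_mem (inv_mem hs) hconj
      have hzC : s⁻¹ * ((k : Gbar) * c * s * ((k : Gbar) * c)⁻¹) ∈
          Subgroup.centralizer (A : Set Gbar) := by
        have := mul_mem (hcommutator (inv_mem hs) hkc) (inv_mem hkc)
        simpa [mul_assoc] using this
      have hzA := hcentric ⟨hzS, hzC⟩
      have hpowz := conj_pow_eq_mul_pow (Subgroup.mem_centralizer_iff.1 hkc _ hzA).symm
        (mul_inv_cancel_left s _).symm (Nat.card T)
      have hcard : Nat.card T = Nat.card S := by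
        rw [← hT]
        exact (Nat.card_congr
          ((T : Subgroup G).equivMapOfInjective _ G.subtype_injective).toEquiv)
      have hz1 := congrArg Subtype.val (pow_card_eq_one' (x := (⟨_, hzS⟩ : S)))
      simp only [Subgroup.coe_pow, Subgroup.coe_one] at hz1
      rw [hcard] at hpowz ⊢
      rw [hz1, mul_one] at hpowz
      exact (mul_inv_eq_iff_eq_mul.1 hpowz).symm
    obtain ⟨n, hn⟩ := IsPGroup.iff_card.1 T.2
    have hn' : Nat.card T = p ^ n := hn
    obtain ⟨g', hg', d, hd, h⟩ := Subgroup.exists_mul_eq_of_pow_mem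
      (hn' ▸ hindex.pow_right n : G.index.Coprime (Nat.card T)) (G.pow_index_mem _) hpow
    refine ⟨g * (k : Gbar)⁻¹ * g', mul_mem (mul_mem hg (inv_mem k.2)) hg', d, hd, ?_⟩
    rw [mul_assoc, ← h]
    group
  intro P Q hP _ gb _
  obtain ⟨g, hg, d, hd, rfl⟩ := hfactS gb
  refine ⟨g, hg, fun x hx => ?_⟩
  have hdx := Subgroup.mem_centralizer_iff.1 hd x (hP hx)
  calc g * x * g⁻¹ = g * (x * d) * d⁻¹ * g⁻¹ := by group
    _ = g * d * x * (g * d)⁻¹ := by rw [hdx]; group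
end

section
/- Let G be a finite group, N ⊴ G a normal subgroup, and M a finite abelian group equipped with an action of G by automorphisms (a G-module). Assume that the subgroup of N-fixed points M^N is trivial and that gcd(|N|, |M|) = 1. Then the first group cohomology H¹(G; M) vanishes. -/
namespace groupCohomology

variable {G M : Type*} [Group G] [AddCommGroup M]

/-- If `|N|` is finite and coprime to `|M|`, a crossed homomorphism `f : G → M` is principal
on `N`. -/
theorem exists_forall_mem_sub_eq_of_coprime [Finite M] (N : Subgroup G) [Finite N]
    (ρ : Representation ℤ G M) (hcop : Nat.Coprime (Nat.card N) (Nat.card M))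
    (f : G → M) (hf : ∀ g h, f (g * h) = ρ g (f h) + f g) :
    ∃ m : M, ∀ n ∈ N, ρ n m - m = f n := by
  have := Fintype.ofFinite N
  set S : M := ∑ h : N, f h with hS
  obtain ⟨m, hm⟩ := (nsmulCoprime hcop.symm).surjective (-S)
  rw [nsmulCoprime_apply] at hm
  refine ⟨m, fun n hn => (nsmulCoprime hcop.symm).injective ?_⟩
  have key : S = ρ n S + Nat.card N • f n := by
    calc S = ∑ h : N, f ((⟨n, hn⟩ : N) * h : N) :=
          (Equiv.sum_comp (Equiv.mulLeft (⟨n, hn⟩ : N)) fun h : N => f h).symm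
      _ = ρ n S + Nat.card N • f n := by
          simp [hf, Finset.sum_add_distrib, hS, map_sum]
  simp only [nsmulCoprime_apply]
  rw [smul_sub, ← map_nsmul, hm, map_neg, neg_sub_neg, sub_eq_iff_eq_add']
  exact key

/-- If `M` has no nonzero `N`-fixed point, a crossed homomorphism that is principal on the normal
subgroup `N` is principal on all of `G`. -/
theorem sub_eq_of_forall_mem_sub_eq (N : Subgroup G) [N.Normal] (ρ : Representation ℤ G M)
    (hfix : ∀ m : M, (∀ n ∈ N, ρ n m = m) → m = 0)
    (f : G → M) (hf : ∀ g h, f (g * h) = ρ g (f h) + f g)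
    (m : M) (hm : ∀ n ∈ N, ρ n m - m = f n) (g : G) : ρ g m - m = f g := by
  refine (sub_eq_zero.1 <| hfix (f g - (ρ g m - m)) fun n hn => ?_).symm
  have hn' : g⁻¹ * n * g ∈ N := by
    simpa using Subgroup.Normal.conj_mem ‹N.Normal› n hn g⁻¹
  have hgn : g * (g⁻¹ * n * g) = n * g := by group
  have h₁ := hf n g
  have h₂ := hf g (g⁻¹ * n * g)
  rw [← hm n hn] at h₁
  rw [← hm _ hn', map_sub, ← Module.End.mul_apply, ← map_mul, hgn, h₁, map_mul,
    Module.End.mul_apply] at h₂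
  rw [map_sub, map_sub, eq_sub_of_add_eq h₂]
  abel

end groupCohomology


/-- Let `G` be a finite group, `N ⊴ G`, and `M` a finite abelian group
with a `G`-action by automorphisms (i.e. a `G`-module, encoded as a representation of `G`
on the `ℤ`-module `M`). If `M^N = 0` and `gcd(|N|, |M|) = 1`, then `H¹(G; M) = 0`. -/
theorem stmt13 (G : Type) [Group G] [Finite G] (N : Subgroup G) [N.Normal]
    (M : Type) [AddCommGroup M] [Finite M]
    (ρ : Representation ℤ G M)
    (hfix : ∀ m : M, (∀ n ∈ N, ρ n m = m) → m = 0)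
    (hcop : Nat.Coprime (Nat.card N) (Nat.card M)) :
    Subsingleton (groupCohomology (Rep.of ρ) 1) := by
  refine subsingleton_of_forall_eq 0 fun x => ?_
  induction x using groupCohomology.H1_induction_on with
  | h f =>
    rw [groupCohomology.H1π_eq_zero_iff]
    have hf : ∀ g h, f (g * h) = ρ g (f h) + f g :=
      (groupCohomology.mem_cocycles₁_iff f).1 f.2
    obtain ⟨m, hm⟩ :=
      groupCohomology.exists_forall_mem_sub_eq_of_coprime N ρ hcop f hf
    exact ⟨m, funext fun g =>
      groupCohomology.sub_eq_of_forall_mem_sub_eq N ρ hfix f hf m hm g⟩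
end

section
/- Let p be an odd prime, ℓ ≥ 1, κ ≥ 2, and let m be a divisor of p − 1 with m ≥ 2. Let Γ = G(m, m, κ) ≤ GL_κ(ℤ/p^ℓ) act naturally on A = (ℤ/p^ℓ)^κ. Then the first group cohomology H¹(Γ; A) vanishes. -/
open Matrix

/-- For `k ∣ m` and a commutative ring `R`, `G(m, k, κ) ≤ GL_κ(R)` is the subgroup generated
by the permutation matrices together with the diagonal matrices `diag(u₁, …, u_κ)` with
`uᵢ^m = 1` for all `i` and `(u₁⋯u_κ)^(m/k) = 1`. -/
def Gmk (m k κ : ℕ) (R : Type) [CommRing R] : Subgroup (GL (Fin κ) R) :=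
  Subgroup.closure
    ({M : GL (Fin κ) R | ∃ σ : Equiv.Perm (Fin κ),
        (M : Matrix (Fin κ) (Fin κ) R) = Matrix.of fun i j => if σ j = i then (1 : R) else 0} ∪
     {M : GL (Fin κ) R | ∃ u : Fin κ → R, (∀ i, u i ^ m = 1) ∧ (∏ i, u i) ^ (m / k) = 1 ∧
        (M : Matrix (Fin κ) (Fin κ) R) = Matrix.diagonal u})

/-- The invertible diagonal matrix with the given units on the diagonal. -/
def diagGL {n R : Type*} [Fintype n] [DecidableEq n] [CommRing R] : (n → Rˣ) →* GL n R :=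
  (Units.map (diagonalRingHom n R : (n → R) →* Matrix n n R)).comp
    (MulEquiv.piUnits (M := fun _ : n => R)).symm.toMonoidHom

@[simp]
lemma coe_diagGL {n R : Type*} [Fintype n] [DecidableEq n] [CommRing R] (u : n → Rˣ) :
    (diagGL u : Matrix n n R) = diagonal fun i => (u i : R) := rfl

lemma diagGL_mem_Gmk {m κ : ℕ} {R : Type} [CommRing R] (u : Fin κ → Rˣ)
    (hu : ∀ i, u i ^ m = 1) (hprod : ∏ i, u i = 1) : diagGL u ∈ Gmk m m κ R := by
  refine Subgroup.subset_closure (Or.inr ⟨fun i => u i, fun i => ?_, ?_, coe_diagGL u⟩)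
  · rw [← Units.val_pow_eq_pow_val, hu, Units.val_one]
  · rw [← Units.coe_prod, hprod, Units.val_one, one_pow]

/-- Elements of `G(m, k, κ)` permute the diagonal matrices by permuting their entries. -/
lemma exists_perm_diagGL_mul {m k κ : ℕ} {R : Type} [CommRing R] {g : GL (Fin κ) R}
    (hg : g ∈ Gmk m k κ R) :
    ∃ σ : Equiv.Perm (Fin κ), ∀ u : Fin κ → Rˣ, diagGL u * g = g * diagGL (u ∘ σ) := by
  induction hg using Subgroup.closure_induction with
  | mem g hg =>
    rcases hg with ⟨σ, hσ⟩ | ⟨v, -, -, hv⟩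
    · refine ⟨σ, fun u => Units.ext ?_⟩
      ext i j
      simp only [Units.val_mul, coe_diagGL, hσ, diagonal_mul, mul_diagonal, of_apply,
        Function.comp_apply]
      split_ifs with h
      · rw [h, mul_one, one_mul]
      · rw [mul_zero, zero_mul]
    · refine ⟨1, fun u => Units.ext ?_⟩
      simp [hv, mul_comm]
  | one => exact ⟨1, fun u => by simp⟩
  | mul g h _ _ ihg ihh =>
    obtain ⟨σ, hσ⟩ := ihg
    obtain ⟨τ, hτ⟩ := ihh
    refine ⟨σ * τ, fun u => ?_⟩
    rw [← mul_assoc, hσ, mul_assoc, hτ, mul_assoc, Equiv.Perm.coe_mul, Function.comp_assoc]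
  | inv g _ ih =>
    obtain ⟨σ, hσ⟩ := ih
    refine ⟨σ⁻¹, fun u => ?_⟩
    have h := hσ (u ∘ ⇑σ⁻¹)
    rw [Function.comp_assoc, ← Equiv.Perm.coe_mul, inv_mul_cancel, Equiv.Perm.coe_one,
      Function.comp_id] at h
    rw [eq_inv_mul_iff_mul_eq, ← mul_assoc, ← h, mul_inv_cancel_right]

/-- For `κ ≥ 2`, a root of unity in any position extends to a tuple of product one. -/
lemma exists_prod_eq_one {m κ : ℕ} {G : Type*} [CommGroup G] (hκ : 2 ≤ κ) {ζ : G}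
    (hζ : ζ ^ m = 1) (i : Fin κ) :
    ∃ u : Fin κ → G, (∀ j, u j ^ m = 1) ∧ ∏ j, u j = 1 ∧ u i = ζ := by
  have : Nontrivial (Fin κ) := Fin.nontrivial_iff_two_le.2 hκ
  obtain ⟨j, hj⟩ := exists_ne i
  refine ⟨Pi.mulSingle i ζ * Pi.mulSingle j ζ⁻¹, fun a => ?_, ?_, ?_⟩
  · rw [Pi.mul_apply, mul_pow, Pi.mulSingle_apply, Pi.mulSingle_apply]
    split_ifs <;> simp [hζ]
  · simp [Finset.prod_mul_distrib]
  · simp [hj.symm]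

/-- If `R` has an `m`-th root of unity `ζ` with `ζ - 1` a unit and `κ ≥ 2`, then every
`1`-cocycle on `G(m, m, κ)` with values in `R^κ` is a coboundary. -/
lemma exists_eq_mulVec_sub_of_cocycle {m κ : ℕ} {R : Type} [CommRing R] (hκ : 2 ≤ κ)
    {ζ : Rˣ} (hζ : ζ ^ m = 1) (hζ1 : IsUnit ((ζ : R) - 1)) (f : Gmk m m κ R → Fin κ → R)
    (hf : ∀ g h, f (g * h) = ((g : GL (Fin κ) R) : Matrix (Fin κ) (Fin κ) R) *ᵥ f h + f g) :
    ∃ x, ∀ g, f g = ((g : GL (Fin κ) R) : Matrix (Fin κ) (Fin κ) R) *ᵥ x - x := by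
  choose d hdm hdprod hdi using exists_prod_eq_one hκ hζ
  let D (u : Fin κ → Rˣ) (hu : ∀ i, u i ^ m = 1) (hprod : ∏ i, u i = 1) : Gmk m m κ R :=
    ⟨diagGL u, diagGL_mem_Gmk u hu hprod⟩
  let x : Fin κ → R := fun i => ↑hζ1.unit⁻¹ * f (D (d i) (hdm i) (hdprod i)) i
  have hx (i) : ((ζ : R) - 1) * x i = f (D (d i) (hdm i) (hdprod i)) i := by
    rw [← mul_assoc, IsUnit.mul_val_inv, one_mul]
  have hdiag (u hu hprod) (i : Fin κ) : f (D u hu hprod) i = (u i : R) * x i - x i := by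
    have hcomm : D (d i) (hdm i) (hdprod i) * D u hu hprod =
        D u hu hprod * D (d i) (hdm i) (hdprod i) :=
      Subtype.ext (by simp only [D, Subgroup.coe_mul, ← map_mul, mul_comm])
    have h := congrFun (congrArg f hcomm) i
    rw [hf, hf] at h
    simp only [D, Pi.add_apply, coe_diagGL, mulVec_diagonal, hdi] at h
    have hx := hx i
    simp only [D] at hx
    apply hζ1.mul_left_cancel
    linear_combination h - ((u i : R) - 1) * hx
  refine ⟨x, fun g => ?_⟩
  ext i
  obtain ⟨σ, hσ⟩ := exists_perm_diagGL_mul g.2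
  have hσm (j) : (d i ∘ σ) j ^ m = 1 := hdm i (σ j)
  have hσprod : ∏ j, (d i ∘ σ) j = 1 := (Equiv.prod_comp σ (d i)).trans (hdprod i)
  have hcomm : D (d i) (hdm i) (hdprod i) * g = g * D (d i ∘ σ) hσm hσprod :=
    Subtype.ext (hσ (d i))
  have h := congrFun (congrArg f hcomm) i
  have hσf : f (D (d i ∘ σ) hσm hσprod) =
      ((diagGL (d i ∘ σ) : GL (Fin κ) R) : Matrix (Fin κ) (Fin κ) R) *ᵥ x - x := by
    ext j
    rw [hdiag _ hσm hσprod, Pi.sub_apply, coe_diagGL, mulVec_diagonal]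
  rw [hf, hf, hσf, mulVec_sub, mulVec_mulVec, ← Units.val_mul, ← hσ, Units.val_mul,
    ← mulVec_mulVec] at h
  have hdi' := hdiag (d i) (hdm i) (hdprod i) i
  simp only [D, Pi.add_apply, Pi.sub_apply, coe_diagGL, mulVec_diagonal, hdi] at h hdi'
  apply hζ1.mul_left_cancel
  rw [Pi.sub_apply]
  linear_combination h - hdi'

/-- For `1 < m ∣ p - 1`, the ring `ℤ/p^ℓ` has an `m`-th root of unity that is nontrivial
modulo `p`. -/
lemma ZMod.exists_pow_eq_one_isUnit_sub_one {p ℓ m : ℕ} (hp : p.Prime) (hℓ : 1 ≤ ℓ)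
    (hm : m ∣ p - 1) (hm2 : 2 ≤ m) :
    ∃ ζ : (ZMod (p ^ ℓ))ˣ, ζ ^ m = 1 ∧ IsUnit ((ζ : ZMod (p ^ ℓ)) - 1) := by
  have : Fact p.Prime := ⟨hp⟩
  have hdvd : p ∣ p ^ ℓ := dvd_pow_self p (by lia)
  have : NeZero (p ^ ℓ) := ⟨pow_ne_zero _ hp.ne_zero⟩
  obtain ⟨a, ha⟩ := IsCyclic.exists_ofOrder_eq_natCard (α := (ZMod p)ˣ)
  rw [Nat.card_eq_fintype_card, ZMod.card_units] at ha
  obtain ⟨b, rfl⟩ := ZMod.unitsMap_surjective hdvd a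
  obtain ⟨q, hq⟩ := hm
  have hq0 : 0 < q := Nat.pos_of_ne_zero (by rintro rfl; have := hp.two_le; lia)
  have hne : ZMod.unitsMap hdvd (b ^ (p ^ (ℓ - 1) * q)) ≠ 1 := by
    rw [map_pow]
    intro h
    have h := orderOf_dvd_of_pow_eq_one h
    rw [ha, hq] at h
    have hmp : m ∣ p ^ (ℓ - 1) := Nat.dvd_of_mul_dvd_mul_right hq0 h
    have hcop : m.Coprime p :=
      Nat.Coprime.coprime_dvd_left ⟨q, hq⟩
        (Nat.coprime_of_lt_prime (Nat.sub_ne_zero_of_lt hp.one_lt)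
          (Nat.sub_lt hp.pos one_pos) hp).symm
    have := Nat.Coprime.eq_one_of_dvd (hcop.pow_right _) hmp
    lia
  refine ⟨b ^ (p ^ (ℓ - 1) * q), ?_, ?_⟩
  · rw [← pow_mul, mul_assoc, mul_comm q, ← hq, ← Nat.totient_prime_pow hp hℓ,
      ZMod.pow_totient]
  · generalize b ^ (p ^ (ℓ - 1) * q) = ζ at hne
    by_contra hunit
    apply hne
    have hval : p ∣ ((ζ : ZMod (p ^ ℓ)) - 1).val := by
      by_contra hnd
      apply hunit
      rw [← ZMod.natCast_zmod_val ((ζ : ZMod (p ^ ℓ)) - 1), ZMod.isUnit_iff_coprime]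
      exact ((hp.coprime_iff_not_dvd.2 hnd).symm).pow_right _
    rw [← ZMod.natCast_eq_zero_iff, ZMod.natCast_val] at hval
    have hval : ZMod.castHom hdvd (ZMod p) ((ζ : ZMod (p ^ ℓ)) - 1) = 0 := hval
    rw [map_sub, map_one, sub_eq_zero] at hval
    exact Units.ext hval

/-- For an odd prime `p`, `ℓ ≥ 1`, `κ ≥ 2`, and `2 ≤ m ∣ p - 1`, the first
cohomology of `Γ = G(m, m, κ) ≤ GL_κ(ℤ/p^ℓ)` acting naturally on `A = (ℤ/p^ℓ)^κ`
vanishes. -/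
theorem stmt14 (p ℓ κ m : ℕ) (hp : p.Prime) (hodd : Odd p) (hℓ : 1 ≤ ℓ) (hκ : 2 ≤ κ)
    (hm : m ∣ p - 1) (hm2 : 2 ≤ m)
    (ρ : Representation ℤ ↥(Gmk m m κ (ZMod (p ^ ℓ))) (Fin κ → ZMod (p ^ ℓ)))
    (hρ : ∀ g : ↥(Gmk m m κ (ZMod (p ^ ℓ))), ∀ v : Fin κ → ZMod (p ^ ℓ),
      ρ g v = Matrix.mulVec
        ((g : GL (Fin κ) (ZMod (p ^ ℓ))) : Matrix (Fin κ) (Fin κ) (ZMod (p ^ ℓ))) v) :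
    Subsingleton (groupCohomology (Rep.of ρ) 1) := by
  obtain ⟨ζ, hζ, hζ1⟩ := ZMod.exists_pow_eq_one_isUnit_sub_one hp hℓ hm hm2
  refine subsingleton_of_forall_eq 0 fun c => ?_
  induction c using groupCohomology.H1_induction_on with
  | h f =>
  rw [groupCohomology.H1π_eq_zero_iff]
  obtain ⟨x, hx⟩ := exists_eq_mulVec_sub_of_cocycle hκ hζ hζ1 f fun g h =>
    ((groupCohomology.mem_cocycles₁_iff _).1 f.2 g h).trans (congrArg (· + f g) (hρ g (f h)))
  refine ⟨x, funext fun g => ?_⟩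
  rw [hx, ← hρ]
  rfl
end
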